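/- Let λ, a ∈ ℝ with λ ≠ 0, and let f be the entire function defined by f(z) = λ·sinh(z)/z + a for z ≠ 0 and f(0) = λ + a (the removable singularity at 0 being filled in). Then f does not have a wandering domain. -/

import Mathlib

/-!
Formalization of: "Absence of wandering domains for functions in class B whose
singular values escape uniformly, under a thickness condition along an invariant set A."
-/

open Set Metric Filter Topology

/-- The chordal (spherical) distance between two finite points of the Riemann sphere. -/
noncomputable def sphericalDist (z w : ℂ) : ℝ :=
  2 * dist z w / (Real.sqrt (1 + ‖z‖ ^ 2) * Real.sqrt (1 + ‖w‖ ^ 2))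

/-- A transcendental entire function: entire and not a polynomial. -/
def TranscendentalEntire (f : ℂ → ℂ) : Prop :=
  Differentiable ℂ f ∧ ¬∃ p : Polynomial ℂ, ∀ z : ℂ, f z = p.eval z

/-- `S` is the set of singular values of `f`: the smallest closed set `S ⊆ ℂ` such that
`f : ℂ ∖ f⁻¹(S) → ℂ ∖ S` is a covering map. -/
def IsSingularValueSet (f : ℂ → ℂ) (S : Set ℂ) : Prop :=
  IsClosed S ∧ IsCoveringMapOn f Sᶜ ∧
    ∀ T : Set ℂ, IsClosed T → IsCoveringMapOn f Tᶜ → S ⊆ T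

/-- The Fatou set of an entire function: points having a neighbourhood on which the family of
iterates is equicontinuous with respect to the spherical metric. -/
def FatouSet (f : ℂ → ℂ) : Set ℂ :=
  {z : ℂ | ∃ N : Set ℂ, IsOpen N ∧ z ∈ N ∧
    ∀ x ∈ N, ∀ ε > (0 : ℝ), ∃ δ > (0 : ℝ), ∀ y ∈ N, dist y x < δ →
      ∀ n : ℕ, sphericalDist (f^[n] y) (f^[n] x) < ε}

/-- A wandering domain: a connected component `W` of the Fatou set whose forward images are
pairwise disjoint. -/
def IsWanderingDomain (f : ℂ → ℂ) (W : Set ℂ) : Prop :=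
  (∃ z ∈ FatouSet f, W = connectedComponentIn (FatouSet f) z) ∧
    ∀ m n : ℕ, m ≠ n → f^[m] '' W ∩ f^[n] '' W = ∅

/-- A proper local biholomorphism onto a star-shaped domain has a holomorphic section through
every point. -/
theorem exists_holomorphic_section {f : ℂ → ℂ} {U S : Set ℂ} (hU : IsOpen U) (hS : IsOpen S)
    {s₀ : ℂ} (hs₀ : s₀ ∈ S) (hSc : StarConvex ℝ s₀ S) (hf : DifferentiableOn ℂ f U)
    (hd : ∀ z ∈ U, deriv f z ≠ 0) (hmap : MapsTo f U S)
    (hproper : ∀ K ⊆ S, IsCompact K → IsCompact (U ∩ f ⁻¹' K)) {z : ℂ} (hz : z ∈ U) :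
    ∃ φ : ℂ → ℂ, DifferentiableOn ℂ φ S ∧ MapsTo φ S U ∧ (∀ w ∈ S, f (φ w) = w) ∧
      φ (f z) = z := by
  classical
  let p : U → S := hmap.restrict f U S
  have hpc : Continuous p := hf.continuousOn.mapsToRestrict hmap
  have hlh : IsLocalHomeomorph p := by
    have hg : IsLocalHomeomorph (Subtype.val : S → ℂ) :=
      hS.isOpenEmbedding_subtypeVal.isLocalHomeomorph
    refine IsLocalHomeomorph.of_comp (g := (Subtype.val : S → ℂ)) ?_ hg hpc
    have h1 : IsLocalHomeomorphOn f U := by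
      intro x hx
      have han : AnalyticAt ℂ f x := hf.analyticAt (hU.mem_nhds hx)
      have hst := han.hasStrictDerivAt.hasStrictFDerivAt_equiv (hd x hx)
      exact ⟨HasStrictFDerivAt.toOpenPartialHomeomorph f hst,
        hst.mem_toOpenPartialHomeomorph_source, rfl⟩
    have h2 : IsLocalHomeomorph (Subtype.val : U → ℂ) :=
      hU.isOpenEmbedding_subtypeVal.isLocalHomeomorph
    rw [isLocalHomeomorph_iff_isLocalHomeomorphOn_univ]
    have h3 : IsLocalHomeomorphOn (f ∘ (Subtype.val : U → ℂ)) univ :=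
      h1.comp (isLocalHomeomorph_iff_isLocalHomeomorphOn_univ.1 h2) (fun x _ => x.2)
    exact h3
  have : LocallyCompactSpace S := hS.locallyCompactSpace
  have hpp : IsProperMap p := by
    rw [isProperMap_iff_isCompact_preimage]
    refine ⟨hpc, fun K hK => ?_⟩
    have h1 : IsCompact (Subtype.val '' K) := hK.image continuous_subtype_val
    have h2 := hproper (Subtype.val '' K) (by rintro _ ⟨x, _, rfl⟩; exact x.2) h1
    have h3 : p ⁻¹' K = Subtype.val ⁻¹' (U ∩ f ⁻¹' (Subtype.val '' K)) := by
      ext x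
      constructor
      · intro hx
        exact ⟨x.2, ⟨p x, hx, rfl⟩⟩
      · rintro ⟨_, y, hy, hyx⟩
        have : y = p x := Subtype.ext hyx
        rw [this] at hy
        exact hy
    rw [h3, Subtype.isCompact_iff, Subtype.image_preimage_coe,
      inter_eq_right.2 inter_subset_left]
    exact h2
  have hcov : IsCoveringMap p := by
    rw [isCoveringMap_iff_isCoveringMapOn_univ]
    refine hpp.isClosedMap.isCoveringMapOn_of_isLocalHomeomorphOn (fun x _ => ?_) ?_
    · have hc : IsCompact (p ⁻¹' {x}) := hpp.isCompact_preimage isCompact_singleton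
      refine hc.finite (IsDiscrete.of_openPartialHomeomorph (x := x) p subset_rfl ?_)
      intro e _
      obtain ⟨φ, hφ, h⟩ := hlh e
      exact ⟨φ, hφ, h.symm⟩
    · rw [preimage_univ]
      exact isLocalHomeomorph_iff_isLocalHomeomorphOn_univ.1 hlh
  have : ContractibleSpace S := hSc.contractibleSpace ⟨s₀, hs₀⟩
  have : LocallyPathConnectedSpace S := hS.locallyPathConnectedSpace
  obtain ⟨F, ⟨hF1, hF2⟩, -⟩ := hcov.existsUnique_continuousMap_lifts (ContinuousMap.id S)
    (p ⟨z, hz⟩) ⟨z, hz⟩ rfl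
  let φ : ℂ → ℂ := fun w => if h : w ∈ S then (F ⟨w, h⟩ : ℂ) else 0
  have hφ : ∀ w (h : w ∈ S), φ w = F ⟨w, h⟩ := fun w h => by simp [φ, h]
  have hsec : ∀ w ∈ S, f (φ w) = w := by
    intro w h
    rw [hφ w h]
    have := congrFun hF2 ⟨w, h⟩
    exact congrArg Subtype.val this
  have hmaps : MapsTo φ S U := fun w h => by rw [hφ w h]; exact (F ⟨w, h⟩).2
  refine ⟨φ, ?_, hmaps, hsec, ?_⟩
  · intro w hw
    have hcont : ContinuousOn φ S := by
      rw [continuousOn_iff_continuous_domRestrict]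
      have : S.domRestrict φ = Subtype.val ∘ F := by
        ext x
        exact hφ x x.2
      rw [this]
      exact continuous_subtype_val.comp F.continuous
    have hU' := hmaps hw
    have h1 : HasDerivAt f (deriv f (φ w)) (φ w) :=
      (hf.differentiableAt (hU.mem_nhds hU')).hasDerivAt
    exact (HasDerivAt.of_local_left_inverse (hcont.continuousAt (hS.mem_nhds hw)) h1 (hd _ hU')
      (by filter_upwards [hS.mem_nhds hw] with y hy using hsec y hy)).differentiableAt.differentiableWithinAt
  · rw [hφ (f z) (hmap hz)]
    exact congrArg Subtype.val hF1

theorem normSq_sub_lt_normSq_add_conj {z w : ℂ} (hz : 0 < z.re) (hw : 0 < w.re) :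
    ‖z - w‖ < ‖z + (starRingEnd ℂ) w‖ := by
  have h : ‖z - w‖ ^ 2 < ‖z + (starRingEnd ℂ) w‖ ^ 2 := by
    rw [← Complex.normSq_eq_norm_sq, ← Complex.normSq_eq_norm_sq, Complex.normSq_apply,
      Complex.normSq_apply]
    simp
    nlinarith [mul_pos hz hw]
  exact lt_of_pow_lt_pow_left₀ 2 (norm_nonneg _) h

theorem add_conj_ne_zero {z w : ℂ} (hz : 0 < z.re) (hw : 0 < w.re) :
    z + (starRingEnd ℂ) w ≠ 0 := by
  intro h
  have := congrArg Complex.re h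
  simp at this
  linarith

/-- Schwarz–Pick from a disc to the right half-plane. -/
theorem schwarz_ball_halfPlane {φ : ℂ → ℂ} {c : ℂ} {r : ℝ}
    (hd : DifferentiableOn ℂ φ (ball c r)) (hpos : ∀ z ∈ ball c r, 0 < (φ z).re) {z : ℂ}
    (hz : z ∈ ball c r) :
    ‖φ z - φ c‖ * r ≤ ‖z - c‖ * ‖φ z + (starRingEnd ℂ) (φ c)‖ := by
  have hr : 0 < r := nonempty_ball.1 ⟨z, hz⟩
  have hc := hpos c (mem_ball_self hr)
  set m : ℂ → ℂ := fun w => (φ w - φ c) / (φ w + (starRingEnd ℂ) (φ c)) with hm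
  have hmd : DifferentiableOn ℂ m (ball c r) :=
    (hd.sub_const _).div (hd.add_const _) (fun w hw => add_conj_ne_zero (hpos w hw) hc)
  have hmc : m c = 0 := by simp [hm]
  have hmaps : MapsTo m (ball c r) (closedBall (m c) 1) := by
    intro w hw
    rw [hmc, mem_closedBall_zero_iff, hm]
    simp only [norm_div]
    exact div_le_one_of_le₀ (normSq_sub_lt_normSq_add_conj (hpos w hw) hc).le (norm_nonneg _)
  have h := Complex.dist_le_div_mul_dist_of_mapsTo_ball hmd hmaps hz
  rw [hmc, dist_zero_right, dist_eq_norm, hm] at h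
  simp only [norm_div] at h
  have hp : 0 < ‖φ z + (starRingEnd ℂ) (φ c)‖ :=
    norm_pos_iff.2 (add_conj_ne_zero (hpos z hz) hc)
  rw [div_le_iff₀ hp] at h
  calc _ ≤ (1 / r * ‖z - c‖ * ‖φ z + (starRingEnd ℂ) (φ c)‖) * r := by gcongr
    _ = _ := by field_simp

/-- A two-point bound for the derivative at the base point. -/
theorem norm_deriv_le_of_two_point {φ : ℂ → ℂ} {c φ' : ℂ} {A B : ℝ} {ψ : ℂ → ℝ}
    (hd : HasDerivAt φ φ' c) (hψ : ContinuousAt ψ c) (hB : ψ c = B)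
    (h : ∀ᶠ z in 𝓝 c, ‖φ z - φ c‖ * A ≤ ‖z - c‖ * ψ z) : ‖φ'‖ * A ≤ B := by
  have h1 := (hasDerivAt_iff_tendsto_slope.1 hd).norm.mul_const A
  have h2 : Tendsto ψ (𝓝[≠] c) (𝓝 B) := by
    rw [← hB]; exact hψ.tendsto.mono_left nhdsWithin_le_nhds
  refine le_of_tendsto_of_tendsto h1 h2 ?_
  filter_upwards [h.filter_mono nhdsWithin_le_nhds, self_mem_nhdsWithin] with z hz hne
  have hne' : 0 < ‖z - c‖ := norm_pos_iff.2 (sub_ne_zero.2 hne)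
  rw [slope_def_field, norm_div, div_mul_eq_mul_div, div_le_iff₀ hne']
  linarith [hz]

theorem schwarz_ball_halfPlane_deriv {φ : ℂ → ℂ} {c : ℂ} {r : ℝ} (hr : 0 < r)
    (hd : DifferentiableOn ℂ φ (ball c r)) (hpos : ∀ z ∈ ball c r, 0 < (φ z).re) :
    ‖deriv φ c‖ * r ≤ 2 * (φ c).re := by
  have hmem := ball_mem_nhds c hr
  have hdc := hd.differentiableAt hmem
  refine norm_deriv_le_of_two_point (ψ := fun z => ‖φ z + (starRingEnd ℂ) (φ c)‖) hdc.hasDerivAt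
    (hdc.continuousAt.add continuousAt_const).norm ?_ ?_
  · rw [Complex.add_conj, Complex.norm_real, Real.norm_eq_abs,
      abs_of_pos (by linarith [hpos c (mem_ball_self hr)])]
  · filter_upwards [hmem] with z hz using schwarz_ball_halfPlane hd hpos hz

/-- Schwarz–Pick for self-maps of the right half-plane. -/
theorem schwarz_halfPlane {φ : ℂ → ℂ} (hd : DifferentiableOn ℂ φ {z | 0 < z.re})
    (hpos : ∀ z : ℂ, 0 < z.re → 0 < (φ z).re) {s c : ℂ} (hs : 0 < s.re) (hc : 0 < c.re) :
    ‖φ s - φ c‖ * ‖s + (starRingEnd ℂ) c‖ ≤ ‖s - c‖ * ‖φ s + (starRingEnd ℂ) (φ c)‖ := by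
  set p : ℂ → ℂ := fun ζ => (c + (starRingEnd ℂ) c * ζ) / (1 - ζ) with hp
  have hne : ∀ ζ ∈ ball (0 : ℂ) 1, (1 : ℂ) - ζ ≠ 0 := by
    intro ζ hζ h
    rw [mem_ball_zero_iff] at hζ
    rw [sub_eq_zero] at h
    rw [← h] at hζ
    simp at hζ
  have hpre : ∀ ζ ∈ ball (0 : ℂ) 1, 0 < (p ζ).re := by
    intro ζ hζ
    have h1 : 0 < Complex.normSq (1 - ζ) := Complex.normSq_pos.2 (hne ζ hζ)
    have hζ' : Complex.normSq ζ < 1 := by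
      rw [mem_ball_zero_iff] at hζ
      rw [Complex.normSq_eq_norm_sq]
      nlinarith [norm_nonneg ζ]
    have h2 : (p ζ).re = c.re * (1 - Complex.normSq ζ) / Complex.normSq (1 - ζ) := by
      rw [hp]
      simp only [Complex.div_re]
      field_simp
      simp [Complex.normSq_apply]
      ring
    rw [h2]
    have : 0 < 1 - Complex.normSq ζ := by linarith
    positivity
  have hpd : DifferentiableOn ℂ p (ball 0 1) := by
    refine DifferentiableOn.div ?_ ?_ hne <;> fun_prop
  have hcomp : DifferentiableOn ℂ (φ ∘ p) (ball 0 1) := hd.comp hpd (fun ζ hζ => hpre ζ hζ)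
  set ζ := (s - c) / (s + (starRingEnd ℂ) c) with hζ
  have hsc := add_conj_ne_zero hs hc
  have hscp : 0 < ‖s + (starRingEnd ℂ) c‖ := norm_pos_iff.2 hsc
  have hζm : ζ ∈ ball (0 : ℂ) 1 := by
    rw [mem_ball_zero_iff, hζ, norm_div, div_lt_one hscp]
    exact normSq_sub_lt_normSq_add_conj hs hc
  have hps : p ζ = s := by
    have h0 := hne ζ hζm
    rw [hp]
    simp only
    rw [div_eq_iff h0, hζ]
    field_simp
    ring
  have hp0 : p 0 = c := by simp [hp]
  have h := schwarz_ball_halfPlane hcomp (fun w hw => hpos _ (hpre w hw)) hζm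
  simp only [Function.comp, hps, hp0, sub_zero, mul_one] at h
  rw [hζ, norm_div] at h
  calc _ ≤ (‖s - c‖ / ‖s + (starRingEnd ℂ) c‖ * ‖φ s + (starRingEnd ℂ) (φ c)‖) *
      ‖s + (starRingEnd ℂ) c‖ := by gcongr
    _ = _ := by field_simp

theorem schwarz_halfPlane_deriv {φ : ℂ → ℂ} (hd : DifferentiableOn ℂ φ {z | 0 < z.re})
    (hpos : ∀ z : ℂ, 0 < z.re → 0 < (φ z).re) {c : ℂ} (hc : 0 < c.re) :
    ‖deriv φ c‖ * c.re ≤ (φ c).re := by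
  have hmem : {z : ℂ | 0 < z.re} ∈ 𝓝 c :=
    (isOpen_lt continuous_const Complex.continuous_re).mem_nhds hc
  have hdc := hd.differentiableAt hmem
  have key : ∀ w : ℂ, 0 < w.re → ‖w + (starRingEnd ℂ) w‖ = 2 * w.re := by
    intro w hw
    rw [Complex.add_conj, Complex.norm_real, Real.norm_eq_abs, abs_of_pos (by linarith)]
  have hcont : ContinuousAt (fun z : ℂ => ‖z + (starRingEnd ℂ) c‖) c := by fun_prop
  have hcpos : ‖c + (starRingEnd ℂ) c‖ ≠ 0 := by rw [key c hc]; positivity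
  have h := norm_deriv_le_of_two_point (A := 1) (B := (2 * (φ c).re) / (2 * c.re))
    (ψ := fun z => ‖φ z + (starRingEnd ℂ) (φ c)‖ / ‖z + (starRingEnd ℂ) c‖) hdc.hasDerivAt
    (((hdc.continuousAt.add continuousAt_const).norm).div hcont hcpos)
    (by rw [key c hc, key _ (hpos c hc)]) (by
      filter_upwards [hmem] with z hz
      have := schwarz_halfPlane hd hpos hz hc
      have hp : 0 < ‖z + (starRingEnd ℂ) c‖ := norm_pos_iff.2 (add_conj_ne_zero hz hc)
      rw [mul_one, ← mul_div_assoc, le_div_iff₀ hp]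
      exact this)
  rw [mul_one, le_div_iff₀ (by positivity)] at h
  linarith

/-- A holomorphic self-map of the right half-plane preserving the positive reals does not
increase the argument (expressed through squares). -/
theorem arg_sq_nonincreasing {Θ : ℂ → ℂ} (hd : DifferentiableOn ℂ Θ {z | 0 < z.re})
    (hpos : ∀ z : ℂ, 0 < z.re → 0 < (Θ z).re)
    (hreal : ∀ r : ℝ, 0 < r → (Θ r).im = 0) {s : ℂ} (hs : 0 < s.re) :
    (s ^ 2).re * ‖Θ s ^ 2‖ ≤ (Θ s ^ 2).re * ‖s ^ 2‖ := by
  set r := ‖s‖ with hr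
  have hrpos : 0 < r := hs.trans_le (Complex.re_le_norm s)
  have h := schwarz_halfPlane hd hpos hs (c := (r : ℂ)) (by simpa using hrpos)
  obtain ⟨ρ, hρ⟩ : ∃ ρ : ℝ, Θ r = ρ := ⟨(Θ r).re, by
    apply Complex.ext <;> simp [hreal r hrpos]⟩
  have hρpos : 0 < ρ := by
    have := hpos r (by simpa using hrpos)
    rw [hρ] at this; simpa using this
  rw [hρ, Complex.conj_ofReal, Complex.conj_ofReal] at h
  set w := Θ s with hw
  have hwre : 0 < w.re := hpos s hs
  have e1 : ∀ (x : ℂ) (t : ℝ), ‖x - t‖ ^ 2 = ‖x‖ ^ 2 + t ^ 2 - 2 * t * x.re := by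
    intro x t
    rw [← Complex.normSq_eq_norm_sq, ← Complex.normSq_eq_norm_sq, Complex.normSq_apply,
      Complex.normSq_apply]
    simp; ring
  have e2 : ∀ (x : ℂ) (t : ℝ), ‖x + t‖ ^ 2 = ‖x‖ ^ 2 + t ^ 2 + 2 * t * x.re := by
    intro x t
    rw [← Complex.normSq_eq_norm_sq, ← Complex.normSq_eq_norm_sq, Complex.normSq_apply,
      Complex.normSq_apply]
    simp; ring
  have h2 : ‖w - ρ‖ ^ 2 * ‖s + r‖ ^ 2 ≤ ‖s - r‖ ^ 2 * ‖w + ρ‖ ^ 2 := by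
    rw [← mul_pow, ← mul_pow]
    exact pow_le_pow_left₀ (by positivity) h 2
  rw [e1, e1, e2, e2, ← hr] at h2
  have hn := norm_nonneg w
  have hwpos : 0 < ‖w‖ := hwre.trans_le (Complex.re_le_norm w)
  have h3 : (‖w‖ ^ 2 + ρ ^ 2) * s.re ≤ 2 * ρ * w.re * r := by
    have : 0 ≤ 4 * r * (2 * ρ * w.re * r - (‖w‖ ^ 2 + ρ ^ 2) * s.re) := by nlinarith [h2]
    have := nonneg_of_mul_nonneg_right this (by positivity)
    linarith
  have h4 : ‖w‖ * s.re ≤ w.re * r := by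
    have : 2 * ρ * (‖w‖ * s.re) ≤ 2 * ρ * (w.re * r) := by
      nlinarith [mul_nonneg (sq_nonneg (‖w‖ - ρ)) hs.le]
    exact le_of_mul_le_mul_left this (by positivity)
  have e3 : ∀ x : ℂ, (x ^ 2).re = 2 * x.re ^ 2 - ‖x‖ ^ 2 := by
    intro x
    rw [← Complex.normSq_eq_norm_sq, Complex.normSq_apply, pow_two]
    simp; ring
  rw [e3, e3, norm_pow, norm_pow, ← hr]
  have h5 : (‖w‖ * s.re) ^ 2 ≤ (w.re * r) ^ 2 := pow_le_pow_left₀ (by positivity) h4 2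
  nlinarith [h5]

theorem sphericalDist_le (z w : ℂ) : sphericalDist z w ≤ 2 * dist z w := by
  unfold sphericalDist
  have h1 : 1 ≤ Real.sqrt (1 + ‖z‖ ^ 2) := Real.one_le_sqrt.2 (by nlinarith [sq_nonneg ‖z‖])
  have h2 : 1 ≤ Real.sqrt (1 + ‖w‖ ^ 2) := Real.one_le_sqrt.2 (by nlinarith [sq_nonneg ‖w‖])
  exact div_le_self (by positivity) (one_le_mul_of_one_le_of_one_le h1 h2)

theorem sqrt_one_add_sq_le {t : ℝ} (ht : 0 ≤ t) : Real.sqrt (1 + t ^ 2) ≤ 1 + t := by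
  rw [Real.sqrt_le_left (by linarith)]
  nlinarith

theorem le_sphericalDist (z w : ℂ) :
    2 * dist z w / ((1 + ‖z‖) * (1 + ‖w‖)) ≤ sphericalDist z w := by
  unfold sphericalDist
  have h1 := sqrt_one_add_sq_le (norm_nonneg z)
  have h2 := sqrt_one_add_sq_le (norm_nonneg w)
  gcongr

theorem dist_lt_one_of_sphericalDist_lt {z w : ℂ} {M : ℝ} (hw : ‖w‖ ≤ M)
    (h : sphericalDist z w < 2 / ((2 + M) * (1 + M))) : dist z w < 1 := by
  by_contra hd
  rw [not_lt] at hd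
  refine absurd ((le_sphericalDist z w).trans_lt h) (not_lt.2 ?_)
  have hM : 0 ≤ M := (norm_nonneg w).trans hw
  have h1 : 1 + ‖z‖ ≤ (2 + M) * dist z w := by
    have : ‖z‖ ≤ dist z w + ‖w‖ := by
      rw [dist_eq_norm]; simpa using norm_add_le (z - w) w
    nlinarith
  rw [div_le_div_iff₀ (by positivity) (by positivity)]
  have : (1 + ‖z‖) * (1 + ‖w‖) ≤ ((2 + M) * dist z w) * (1 + M) := by gcongr
  linarith

theorem lt_norm_of_sphericalDist_lt {z w : ℂ} {M : ℝ} (hM : 0 ≤ M) (hw : 2 * M + 1 ≤ ‖w‖)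
    (h : sphericalDist z w < 1 / (1 + M)) : M < ‖z‖ := by
  by_contra hd
  rw [not_lt] at hd
  refine absurd ((le_sphericalDist z w).trans_lt h) (not_lt.2 ?_)
  have h1 : ‖w‖ - M ≤ dist z w := by
    have : ‖w‖ ≤ dist w z + ‖z‖ := by
      rw [dist_eq_norm]; simpa using norm_add_le (w - z) z
    rw [dist_comm] at this
    linarith
  rw [div_le_div_iff₀ (by positivity) (by positivity)]
  have : (1 + ‖z‖) * (1 + ‖w‖) ≤ (1 + M) * (1 + ‖w‖) := by gcongr
  nlinarith

theorem dist_iterate_le_of_bounded {f : ℂ → ℂ} (hf : Differentiable ℂ f) {c : ℂ} {r M : ℝ}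
    (h : ∀ z ∈ ball c r, ‖f z‖ ≤ M) {y : ℂ} (hy : y ∈ ball c r) :
    dist (f y) (f c) ≤ 2 * M / r * dist y c := by
  have hr : 0 < r := nonempty_ball.1 ⟨y, hy⟩
  refine Complex.dist_le_div_mul_dist_of_mapsTo_ball hf.differentiableOn (fun z hz => ?_) hy
  rw [mem_closedBall, dist_eq_norm]
  calc _ ≤ ‖f z‖ + ‖f c‖ := norm_sub_le _ _
    _ ≤ M + M := add_le_add (h z hz) (h c (mem_ball_self hr))
    _ = _ := by ring

theorem subset_fatouSet_of_bounded {f : ℂ → ℂ} (hf : Differentiable ℂ f) {N : Set ℂ}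
    (hN : IsOpen N) {M : ℝ} (h : ∀ z ∈ N, ∀ n : ℕ, ‖f^[n] z‖ ≤ M) : N ⊆ FatouSet f := by
  intro z hz
  refine ⟨N, hN, hz, fun x hx ε hε => ?_⟩
  obtain ⟨r, hr, hrN⟩ := Metric.isOpen_iff.1 hN x hx
  have hM : 0 ≤ M := (norm_nonneg _).trans (h z hz 0)
  refine ⟨min r (ε / (4 * M / r + 1)), by positivity, fun y _ hyx n => ?_⟩
  have hy : y ∈ ball x r := lt_of_lt_of_le hyx (min_le_left _ _)
  have h1 := dist_iterate_le_of_bounded (hf.iterate n) (fun z hz => h z (hrN hz) n) hy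
  have h2 : dist y x < ε / (4 * M / r + 1) := lt_of_lt_of_le hyx (min_le_right _ _)
  rw [lt_div_iff₀ (by positivity)] at h2
  calc _ ≤ 2 * dist (f^[n] y) (f^[n] x) := sphericalDist_le _ _
    _ ≤ 2 * (2 * M / r * dist y x) := by gcongr
    _ ≤ dist y x * (4 * M / r + 1) := by
        have := dist_nonneg (x := y) (y := x)
        have e : 2 * (2 * M / r * dist y x) = dist y x * (4 * M / r) := by ring
        rw [e]; nlinarith
    _ < ε := h2

theorem isOpen_fatouSet (f : ℂ → ℂ) : IsOpen (FatouSet f) := by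
  rw [isOpen_iff_forall_mem_open]
  rintro z ⟨N, hN, hz, h⟩
  exact ⟨N, fun w hw => ⟨N, hN, hw, h⟩, hN, hz⟩

theorem mem_fatouSet_of_map_mem {f : ℂ → ℂ} (hf : Continuous f) {z : ℂ}
    (h : f z ∈ FatouSet f) : z ∈ FatouSet f := by
  obtain ⟨N, hN, hz, h⟩ := h
  refine ⟨f ⁻¹' N, hN.preimage hf, hz, fun x hx ε hε => ?_⟩
  obtain ⟨δ, hδ, hd⟩ := h (f x) hx ε hε
  obtain ⟨δ', hδ', hd'⟩ := Metric.continuous_iff.1 hf x δ hδ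
  refine ⟨min δ' (ε / 2), by positivity, fun y hy hyx n => ?_⟩
  rcases n with _ | n
  · have := sphericalDist_le y x
    have := hyx.trans_le (min_le_right _ _)
    simp only [Function.iterate_zero, id]
    linarith
  · exact hd (f y) hy (hd' y (hyx.trans_le (min_le_left _ _))) n

theorem map_mem_fatouSet {f : ℂ → ℂ} (hf : IsOpenMap f) {z : ℂ} (h : z ∈ FatouSet f) :
    f z ∈ FatouSet f := by
  obtain ⟨N, hN, hz, h⟩ := h
  refine ⟨f '' N, hf N hN, ⟨z, hz, rfl⟩, ?_⟩
  rintro _ ⟨x, hx, rfl⟩ ε hε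
  obtain ⟨δ, hδ, hd⟩ := h x hx ε hε
  have ho : IsOpen (f '' (N ∩ ball x δ)) := hf _ (hN.inter isOpen_ball)
  obtain ⟨δ', hδ', hs⟩ := Metric.isOpen_iff.1 ho (f x) ⟨x, ⟨hx, mem_ball_self hδ⟩, rfl⟩
  refine ⟨δ', hδ', fun y' _ hyx n => ?_⟩
  obtain ⟨y, ⟨hyN, hyδ⟩, rfl⟩ := hs hyx
  exact hd y hyN hyδ (n + 1)

theorem iterate_mem_fatouSet {f : ℂ → ℂ} (hf : IsOpenMap f) (n : ℕ) {z : ℂ}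
    (h : z ∈ FatouSet f) : f^[n] z ∈ FatouSet f := by
  induction n generalizing z with
  | zero => exact h
  | succ n ih => exact ih (map_mem_fatouSet hf h)

theorem equicontinuous_at_of_mem_fatouSet {f : ℂ → ℂ} {z : ℂ} (h : z ∈ FatouSet f) {ε : ℝ}
    (hε : 0 < ε) : ∃ δ > 0, ∀ y, dist y z < δ → ∀ n, sphericalDist (f^[n] y) (f^[n] z) < ε := by
  obtain ⟨N, hN, hz, h⟩ := h
  obtain ⟨δ, hδ, hd⟩ := h z hz ε hε
  obtain ⟨r, hr, hrN⟩ := Metric.isOpen_iff.1 hN z hz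
  exact ⟨min δ r, by positivity, fun y hy n =>
    hd y (hrN (hy.trans_le (min_le_right _ _))) (hy.trans_le (min_le_left _ _)) n⟩

namespace IsWanderingDomain
variable {f : ℂ → ℂ} {W : Set ℂ}

theorem subset_fatouSet (h : IsWanderingDomain f W) : W ⊆ FatouSet f := by
  obtain ⟨⟨z, -, rfl⟩, -⟩ := h
  exact connectedComponentIn_subset _ _

theorem isOpen (h : IsWanderingDomain f W) : IsOpen W := by
  obtain ⟨⟨z, -, rfl⟩, -⟩ := h
  exact (isOpen_fatouSet f).connectedComponentIn

theorem nonempty (h : IsWanderingDomain f W) : W.Nonempty := by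
  obtain ⟨⟨z, hz, rfl⟩, -⟩ := h
  exact ⟨z, mem_connectedComponentIn hz⟩

theorem subset_of_isPreconnected (h : IsWanderingDomain f W) {C : Set ℂ}
    (hC : IsPreconnected C) (hCF : C ⊆ FatouSet f) {w : ℂ} (hw : w ∈ W) (hwC : w ∈ C) :
    C ⊆ W := by
  obtain ⟨⟨z, -, rfl⟩, -⟩ := h
  rw [connectedComponentIn_eq hw]
  exact hC.subset_connectedComponentIn hwC hCF

theorem not_mem_of_mem (h : IsWanderingDomain f W) {m n : ℕ} (hmn : m ≠ n) {z : ℂ}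
    (hm : z ∈ f^[m] '' W) (hn : z ∈ f^[n] '' W) : False := by
  have : z ∈ f^[m] '' W ∩ f^[n] '' W := ⟨hm, hn⟩
  rw [h.2 m n hmn] at this
  exact this

end IsWanderingDomain

/-- The entire function `z ↦ l * sinh z / z + a`, with the singularity at the origin removed. -/
noncomputable def sinhMap (l a : ℝ) (z : ℂ) : ℂ := l * dslope Complex.sinh 0 z + a

/-- The restriction of `sinhMap` to the real line. -/
noncomputable def realMap (l a : ℝ) (x : ℝ) : ℝ := (sinhMap l a x).re

section basics
variable {l a : ℝ}

theorem sinhMap_of_ne {z : ℂ} (hz : z ≠ 0) : sinhMap l a z = l * Complex.sinh z / z + a := by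
  rw [sinhMap, dslope_of_ne _ hz, slope_def_field]
  simp [mul_div_assoc]

theorem sinhMap_zero : sinhMap l a 0 = l + a := by
  rw [sinhMap, dslope_same]
  simp

theorem differentiable_sinhMap : Differentiable ℂ (sinhMap l a) := by
  have h : Differentiable ℂ (dslope Complex.sinh 0) := by
    rw [← differentiableOn_univ, Complex.differentiableOn_dslope univ_mem]
    exact Complex.differentiable_sinh.differentiableOn
  exact (h.const_mul _).add_const _

theorem continuous_sinhMap : Continuous (sinhMap l a) := differentiable_sinhMap.continuous

theorem sinhMap_neg (z : ℂ) : sinhMap l a (-z) = sinhMap l a z := by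
  rcases eq_or_ne z 0 with rfl | hz
  · simp
  · rw [sinhMap_of_ne hz, sinhMap_of_ne (neg_ne_zero.2 hz), Complex.sinh_neg]
    field_simp

theorem sinhMap_conj (z : ℂ) :
    sinhMap l a ((starRingEnd ℂ) z) = (starRingEnd ℂ) (sinhMap l a z) := by
  rcases eq_or_ne z 0 with rfl | hz
  · simp [sinhMap_zero]
  · rw [sinhMap_of_ne hz, sinhMap_of_ne ((map_ne_zero _).2 hz), Complex.sinh_conj]
    simp

theorem sinhMap_ofReal (x : ℝ) : sinhMap l a x = realMap l a x := by
  have h := sinhMap_conj (l := l) (a := a) (x : ℂ)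
  rw [Complex.conj_ofReal] at h
  exact (Complex.conj_eq_iff_re.1 h.symm).symm

theorem realMap_of_ne {x : ℝ} (hx : x ≠ 0) : realMap l a x = l * Real.sinh x / x + a := by
  have h : sinhMap l a x = ((l * Real.sinh x / x + a : ℝ) : ℂ) := by
    rw [sinhMap_of_ne (by exact_mod_cast hx)]; push_cast; ring
  rw [realMap, h, Complex.ofReal_re]

theorem realMap_zero : realMap l a 0 = l + a := by
  rw [realMap, Complex.ofReal_zero, sinhMap_zero]; simp

theorem realMap_neg (x : ℝ) : realMap l a (-x) = realMap l a x := by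
  rw [realMap, realMap, Complex.ofReal_neg, sinhMap_neg]

theorem realMap_abs (x : ℝ) : realMap l a |x| = realMap l a x := by
  rcases abs_choice x with h | h <;> rw [h]
  exact realMap_neg x

theorem iterate_sinhMap_ofReal (n : ℕ) (x : ℝ) :
    (sinhMap l a)^[n] x = ((realMap l a)^[n] x : ℝ) := by
  induction n generalizing x with
  | zero => rfl
  | succ n ih => rw [Function.iterate_succ_apply, Function.iterate_succ_apply, sinhMap_ofReal, ih]

theorem sinhMap_im_mul (z : ℂ) : Complex.normSq z * (sinhMap l a z).im =
    l * (z.re * Real.cosh z.re * Real.sin z.im - z.im * Real.sinh z.re * Real.cos z.im) := by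
  rcases eq_or_ne z 0 with rfl | hz
  · simp
  · have h : Complex.normSq z ≠ 0 := by simpa using hz
    have hs : Complex.sinh z = ((Real.sinh z.re * Real.cos z.im : ℝ) : ℂ) +
        ((Real.cosh z.re * Real.sin z.im : ℝ) : ℂ) * Complex.I := by
      conv_lhs => rw [← Complex.re_add_im z]
      rw [Complex.sinh_add, Complex.sinh_mul_I, Complex.cosh_mul_I]
      push_cast; ring
    rw [sinhMap_of_ne hz, Complex.add_im, Complex.ofReal_im, Complex.div_im, hs]
    simp only [Complex.mul_re, Complex.mul_im, Complex.add_re, Complex.add_im, Complex.ofReal_re,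
      Complex.ofReal_im, Complex.I_re, Complex.I_im]
    field_simp
    ring

theorem sinhMap_re_mul (z : ℂ) : Complex.normSq z * ((sinhMap l a z).re - a) = if z = 0 then 0 else
    l * (z.re * Real.sinh z.re * Real.cos z.im + z.im * Real.cosh z.re * Real.sin z.im) := by
  rcases eq_or_ne z 0 with rfl | hz
  · simp
  · have h : Complex.normSq z ≠ 0 := by simpa using hz
    have hs : Complex.sinh z = ((Real.sinh z.re * Real.cos z.im : ℝ) : ℂ) +
        ((Real.cosh z.re * Real.sin z.im : ℝ) : ℂ) * Complex.I := by
      conv_lhs => rw [← Complex.re_add_im z]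
      rw [Complex.sinh_add, Complex.sinh_mul_I, Complex.cosh_mul_I]
      push_cast; ring
    rw [sinhMap_of_ne hz, Complex.add_re, Complex.ofReal_re, Complex.div_re, hs, if_neg hz]
    simp only [Complex.mul_re, Complex.mul_im, Complex.add_re, Complex.add_im, Complex.ofReal_re,
      Complex.ofReal_im, Complex.I_re, Complex.I_im]
    field_simp
    ring

theorem sinhMap_re_mul_of_ne {z : ℂ} (hz : z ≠ 0) :
    Complex.normSq z * ((sinhMap l a z).re - a) =
    l * (z.re * Real.sinh z.re * Real.cos z.im + z.im * Real.cosh z.re * Real.sin z.im) := by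
  rw [sinhMap_re_mul, if_neg hz]

theorem normSq_sinh (z : ℂ) :
    Complex.normSq (Complex.sinh z) = Real.sinh z.re ^ 2 + Real.sin z.im ^ 2 := by
  have hs : Complex.sinh z = ((Real.sinh z.re * Real.cos z.im : ℝ) : ℂ) +
      ((Real.cosh z.re * Real.sin z.im : ℝ) : ℂ) * Complex.I := by
    conv_lhs => rw [← Complex.re_add_im z]
    rw [Complex.sinh_add, Complex.sinh_mul_I, Complex.cosh_mul_I]
    push_cast; ring
  rw [hs, Complex.normSq_add_mul_I]
  have h1 := Real.cosh_sq z.re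
  have h2 := Real.sin_sq_add_cos_sq z.im
  have h3 : Real.cos z.im ^ 2 = 1 - Real.sin z.im ^ 2 := by linarith
  rw [mul_pow, mul_pow, h1, h3]; ring

theorem normSq_cosh (z : ℂ) :
    Complex.normSq (Complex.cosh z) = Real.sinh z.re ^ 2 + Real.cos z.im ^ 2 := by
  have hs : Complex.cosh z = ((Real.cosh z.re * Real.cos z.im : ℝ) : ℂ) +
      ((Real.sinh z.re * Real.sin z.im : ℝ) : ℂ) * Complex.I := by
    conv_lhs => rw [← Complex.re_add_im z]
    rw [Complex.cosh_add, Complex.sinh_mul_I, Complex.cosh_mul_I]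
    push_cast; ring
  rw [hs, Complex.normSq_add_mul_I]
  have h1 := Real.cosh_sq z.re
  have h2 := Real.sin_sq_add_cos_sq z.im
  have h3 : Real.sin z.im ^ 2 = 1 - Real.cos z.im ^ 2 := by linarith
  rw [mul_pow, mul_pow, h1, h3]; ring

theorem abs_sinh_re_le (z : ℂ) : |Real.sinh z.re| ≤ ‖Complex.sinh z‖ := by
  refine abs_le_of_sq_le_sq ?_ (norm_nonneg _)
  rw [← Complex.normSq_eq_norm_sq, normSq_sinh]
  nlinarith [sq_nonneg (Real.sin z.im)]

theorem hasDerivAt_sinhMap {z : ℂ} (hz : z ≠ 0) : HasDerivAt (sinhMap l a)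
    (l * (z * Complex.cosh z - Complex.sinh z) / z ^ 2) z := by
  have h : HasDerivAt (fun z : ℂ => (l : ℂ) * Complex.sinh z / z + a)
      (((l : ℂ) * Complex.cosh z * z - l * Complex.sinh z * 1) / z ^ 2) z :=
    ((((Complex.hasDerivAt_sinh z).const_mul (l : ℂ)).div (hasDerivAt_id z) hz)).add_const _
  have e : (l * (z * Complex.cosh z - Complex.sinh z) / z ^ 2 : ℂ) =
    (((l : ℂ) * Complex.cosh z * z - l * Complex.sinh z * 1) / z ^ 2) := by ring
  rw [e]
  refine h.congr_of_eventuallyEq ?_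
  filter_upwards [isOpen_ne.mem_nhds hz] with w hw using sinhMap_of_ne hw

theorem deriv_sinhMap {z : ℂ} (hz : z ≠ 0) : deriv (sinhMap l a) z =
    l * (z * Complex.cosh z - Complex.sinh z) / z ^ 2 := (hasDerivAt_sinhMap hz).deriv

theorem differentiable_realMap : Differentiable ℝ (realMap l a) := by
  intro x
  have h := (differentiable_sinhMap (l := l) (a := a) (x : ℂ)).hasDerivAt.real_of_complex
  exact h.differentiableAt

theorem continuous_realMap : Continuous (realMap l a) := differentiable_realMap.continuous

theorem hasDerivAt_realMap {x : ℝ} (hx : x ≠ 0) : HasDerivAt (realMap l a)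
    (l * (x * Real.cosh x - Real.sinh x) / x ^ 2) x := by
  have h := (hasDerivAt_sinhMap (l := l) (a := a) (z := (x : ℂ))
    (by exact_mod_cast hx)).real_of_complex
  have e : ((l : ℂ) * ((x : ℂ) * Complex.cosh x - Complex.sinh x) / (x : ℂ) ^ 2) =
    ((l * (x * Real.cosh x - Real.sinh x) / x ^ 2 : ℝ) : ℂ) := by push_cast; ring
  rw [e, Complex.ofReal_re] at h
  exact h

/-- `x cosh x - sinh x ≥ x ^ 3 / 3`. -/
theorem cube_le_mul_cosh_sub_sinh {x : ℝ} (hx : 0 ≤ x) :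
    x ^ 3 / 3 ≤ x * Real.cosh x - Real.sinh x := by
  have hmono : MonotoneOn (fun x : ℝ => x * Real.cosh x - Real.sinh x - x ^ 3 / 3) (Ici 0) := by
    refine monotoneOn_of_deriv_nonneg (convex_Ici 0) (by fun_prop) (by fun_prop) ?_
    intro y hy
    rw [interior_Ici] at hy
    have hy : 0 < y := hy
    have hd : HasDerivAt (fun x : ℝ => x * Real.cosh x - Real.sinh x - x ^ 3 / 3)
        (1 * Real.cosh y + y * Real.sinh y - Real.cosh y - (3 : ℕ) * y ^ (3 - 1) / 3) y :=
      (((hasDerivAt_id y).mul (Real.hasDerivAt_cosh y)).sub (Real.hasDerivAt_sinh y)).sub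
        ((hasDerivAt_pow 3 y).div_const 3)
    rw [hd.deriv]
    have := Real.self_le_sinh_iff.2 hy.le
    norm_num
    nlinarith
  have := hmono (by simp) hx hx
  simp at this
  linarith

theorem deriv_realMap_pos (hl : 0 < l) {x : ℝ} (hx : 0 < x) :
    l / 3 * x ≤ deriv (realMap l a) x := by
  rw [(hasDerivAt_realMap hx.ne').deriv, le_div_iff₀ (by positivity)]
  have := cube_le_mul_cosh_sub_sinh hx.le
  have h2 := mul_le_mul_of_nonneg_left this hl.le
  calc _ = l * (x ^ 3 / 3) := by ring
    _ ≤ _ := h2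

theorem strictMonoOn_realMap (hl : 0 < l) : StrictMonoOn (realMap l a) (Ici 0) := by
  refine strictMonoOn_of_deriv_pos (convex_Ici 0) continuous_realMap.continuousOn ?_
  intro x hx
  rw [interior_Ici] at hx
  have hx : 0 < x := hx
  have := deriv_realMap_pos (a := a) hl hx
  have : 0 < l / 3 * x := by positivity
  linarith

theorem realMap_lt_iff_abs (hl : 0 < l) {x y : ℝ} :
    realMap l a x < realMap l a y ↔ |x| < |y| := by
  rw [← realMap_abs x, ← realMap_abs y]
  exact (strictMonoOn_realMap hl).lt_iff_lt (abs_nonneg x) (abs_nonneg y)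

theorem realMap_le_iff_abs (hl : 0 < l) {x y : ℝ} :
    realMap l a x ≤ realMap l a y ↔ |x| ≤ |y| := by
  rw [← not_lt, realMap_lt_iff_abs hl, not_lt]

theorem realMap_ge (hl : 0 < l) (x : ℝ) : l + a ≤ realMap l a x := by
  rw [← realMap_zero, realMap_le_iff_abs hl]; simp

theorem sinhMap_mul_I_im (y : ℝ) : (sinhMap l a (y * Complex.I)).im = 0 := by
  rcases eq_or_ne y 0 with rfl | hy
  · simp [sinhMap_zero]
  have h := sinhMap_im_mul (l := l) (a := a) (y * Complex.I)
  simpa [hy] using h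

theorem sinhMap_mul_I {y : ℝ} (hy : y ≠ 0) :
    sinhMap l a (y * Complex.I) = ((l * Real.sin y / y + a : ℝ) : ℂ) := by
  rw [sinhMap_of_ne (by simp [hy]), Complex.sinh_mul_I]
  have : (y : ℂ) ≠ 0 := by exact_mod_cast hy
  push_cast
  field_simp

theorem sinhMap_mul_I_re_lt (hl : 0 < l) {y : ℝ} (hy : y ≠ 0) :
    (sinhMap l a (y * Complex.I)).re < l + a := by
  rw [sinhMap_mul_I hy, Complex.ofReal_re]
  have h : Real.sin y / y < 1 := by
    rcases lt_or_gt_of_ne hy with h | h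
    · rw [div_lt_one_of_neg h]
      have := Real.sin_lt (neg_pos.2 h)
      rw [Real.sin_neg] at this; linarith
    · rw [div_lt_one h]; exact Real.sin_lt h
  rw [mul_div_assoc]
  nlinarith

theorem norm_sinhMap_mul_I_le (hl : 0 < l) (y : ℝ) :
    ‖sinhMap l a (y * Complex.I)‖ ≤ l + |a| := by
  rcases eq_or_ne y 0 with rfl | hy
  · simp only [Complex.ofReal_zero, zero_mul, sinhMap_zero]
    refine (norm_add_le _ _).trans ?_
    simp [abs_of_pos hl]
  rw [sinhMap_mul_I hy, Complex.norm_real, Real.norm_eq_abs]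
  refine (abs_add_le _ _).trans ?_
  have : |l * Real.sin y / y| ≤ l := by
    rw [abs_div, abs_mul, abs_of_pos hl, div_le_iff₀ (abs_pos.2 hy)]
    exact mul_le_mul_of_nonneg_left Real.abs_sin_le_abs hl.le
  linarith

end basics

section calculus
variable {l a : ℝ}

theorem deriv_sinhMap_ne_zero (hl : 0 < l) {z : ℂ} (hz : z.re ≠ 0) :
    deriv (sinhMap l a) z ≠ 0 := by
  have hz0 : z ≠ 0 := by rintro rfl; simp at hz
  rw [deriv_sinhMap hz0]
  intro h
  have hl' : (l : ℂ) ≠ 0 := by exact_mod_cast hl.ne'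
  have h1 : z * Complex.cosh z = Complex.sinh z := by
    have := div_eq_zero_iff.1 h
    rcases this with h | h
    · rcases mul_eq_zero.1 h with h | h
      · exact absurd h hl'
      · exact sub_eq_zero.1 h
    · exact absurd (pow_eq_zero_iff (two_ne_zero)|>.1 h) hz0
  set x := z.re with hx
  set y := z.im with hy
  have hs : Complex.sinh z = ((Real.sinh x * Real.cos y : ℝ) : ℂ) +
      ((Real.cosh x * Real.sin y : ℝ) : ℂ) * Complex.I := by
    conv_lhs => rw [← Complex.re_add_im z]
    rw [Complex.sinh_add, Complex.sinh_mul_I, Complex.cosh_mul_I]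
    push_cast; ring
  have hc : Complex.cosh z = ((Real.cosh x * Real.cos y : ℝ) : ℂ) +
      ((Real.sinh x * Real.sin y : ℝ) : ℂ) * Complex.I := by
    conv_lhs => rw [← Complex.re_add_im z]
    rw [Complex.cosh_add, Complex.sinh_mul_I, Complex.cosh_mul_I]
    push_cast; ring
  have hre := congrArg Complex.re h1
  have him := congrArg Complex.im h1
  rw [hs, hc] at hre him
  simp only [Complex.mul_re, Complex.mul_im, Complex.add_re, Complex.add_im, Complex.ofReal_re,
      Complex.ofReal_im, Complex.I_re, Complex.I_im, ← hx, ← hy] at hre him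
  have e1 := Real.cosh_sq x
  have e2 := Real.sin_sq_add_cos_sq y
  have A : x * (Real.sinh x ^ 2 + Real.cos y ^ 2) = Real.sinh x * Real.cosh x := by
    linear_combination (Real.cosh x * Real.cos y) * hre + (Real.sinh x * Real.sin y) * him
      + (-x * Real.cos y ^ 2) * e1 + (Real.sinh x * Real.cosh x - x * Real.sinh x ^ 2) * e2
  have B : y * (Real.sinh x ^ 2 + Real.cos y ^ 2) = Real.sin y * Real.cos y := by
    linear_combination (Real.cosh x * Real.cos y) * him - (Real.sinh x * Real.sin y) * hre
      + (-y * Real.cos y ^ 2 + Real.sin y * Real.cos y) * e1 + (- y * Real.sinh x ^ 2) * e2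
  have hD : 1 < Real.sinh x ^ 2 + Real.cos y ^ 2 := by
    have hcosh := Real.one_le_cosh x
    rcases lt_or_gt_of_ne hz with h | h
    · have := Real.sinh_lt_self_iff.2 h
      nlinarith
    · have := Real.self_lt_sinh_iff.2 h
      nlinarith
  have hy0 : y = 0 := by
    by_contra hne
    have h3 : |y| * (Real.sinh x ^ 2 + Real.cos y ^ 2) ≤ |y| := by
      rw [← abs_of_pos (by linarith : 0 < Real.sinh x ^ 2 + Real.cos y ^ 2), ← abs_mul, B, abs_mul]
      exact (mul_le_mul Real.abs_sin_le_abs (Real.abs_cos_le_one y) (abs_nonneg _)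
        (abs_nonneg _)).trans_eq (mul_one _)
    have := abs_pos.2 hne
    nlinarith
  rw [hy0] at hre
  simp at hre
  rcases lt_or_gt_of_ne hz with h | h
  · have h5 := cube_le_mul_cosh_sub_sinh (x := -x) (by linarith)
    rw [Real.cosh_neg, Real.sinh_neg] at h5
    have : 0 < (-x) ^ 3 := by apply pow_pos; linarith
    linarith
  · have h5 := cube_le_mul_cosh_sub_sinh (x := x) (by linarith)
    have : 0 < x ^ 3 := by positivity
    linarith

theorem isOpenMap_sinhMap (hl : 0 < l) : IsOpenMap (sinhMap l a) := by
  rcases AnalyticOnNhd.is_constant_or_isOpenMap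
    (fun z _ => (differentiable_sinhMap (l := l) (a := a)).analyticAt z) with ⟨w, hw⟩ | h
  · exfalso
    refine deriv_sinhMap_ne_zero (a := a) hl (z := 1) (by simp) ?_
    have : sinhMap l a = fun _ => w := funext hw
    rw [this]; simp
  · exact h

theorem sinhMap_im_pos (hl : 0 < l) {z : ℂ} (hx : 0 < z.re) (hy : 0 < z.im)
    (hy' : z.im < Real.pi) : 0 < (sinhMap l a z).im := by
  have hz : 0 < Complex.normSq z := Complex.normSq_pos.2 (by rintro rfl; simp at hx)
  refine pos_of_mul_pos_right (a := Complex.normSq z) ?_ hz.le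
  rw [sinhMap_im_mul]
  refine mul_pos hl ?_
  have hsin := Real.sin_pos_of_pos_of_lt_pi hy hy'
  have hc := Real.cosh_pos z.re
  have hs := Real.sinh_pos_iff.2 hx
  rcases le_or_gt (Real.cos z.im) 0 with h | h
  · have : z.im * Real.sinh z.re * Real.cos z.im ≤ 0 :=
      mul_nonpos_of_nonneg_of_nonpos (by positivity) h
    have : 0 < z.re * Real.cosh z.re * Real.sin z.im := by positivity
    linarith
  · have hlt : z.im < Real.pi / 2 := by
      by_contra h2
      have := Real.cos_nonpos_of_pi_div_two_le_of_le (not_lt.1 h2) (by linarith [Real.pi_pos])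
      linarith
    have h3 := Real.lt_tan hy hlt
    rw [Real.tan_eq_sin_div_cos, lt_div_iff₀ h] at h3
    have h4 := cube_le_mul_cosh_sub_sinh hx.le
    have h5 : 0 < z.re ^ 3 := by positivity
    have h6 : Real.sinh z.re < z.re * Real.cosh z.re := by linarith
    nlinarith [mul_lt_mul'' h6 h3 hs.le (by positivity)]

theorem sinhMap_im_neg (hl : 0 < l) {z : ℂ} (hx : 0 < z.re) (hy : z.im < 0)
    (hy' : -Real.pi < z.im) : (sinhMap l a z).im < 0 := by
  have h := sinhMap_im_pos (l := l) (a := a) hl (z := (starRingEnd ℂ) z) (by simpa using hx)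
    (by simpa using hy) (by simp; linarith)
  rw [sinhMap_conj] at h
  simpa using h

theorem exists_growth (hl : 0 < l) (a B : ℝ) : ∃ X > 0, ∀ z : ℂ, |z.im| ≤ B → X ≤ ‖z‖ →
    ‖z‖ + 1 ≤ ‖sinhMap l a z‖ := by
  set X := max (max 3 B) (max (|a| + 1) (144 / l)) with hX
  have hX3 : 3 ≤ X := (le_max_left _ _).trans (le_max_left _ _)
  have hXB : B ≤ X := (le_max_right _ _).trans (le_max_left _ _)
  have hXa : |a| + 1 ≤ X := (le_max_left _ _).trans (le_max_right _ _)
  have hXl : 144 / l ≤ X := (le_max_right _ _).trans (le_max_right _ _)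
  refine ⟨2 * X, by linarith, fun z hzB hz => ?_⟩
  have hz0 : z ≠ 0 := by rintro rfl; simp at hz; linarith
  have hnz : 0 < ‖z‖ := norm_pos_iff.2 hz0
  have h1 := Complex.norm_le_abs_re_add_abs_im z
  set x := |z.re| with hx
  have hxX : X ≤ x := by linarith
  have h2 : ‖z‖ ≤ 2 * x := by linarith
  have h3 : x ^ 3 / 24 ≤ Real.sinh x := by
    have e := Real.pow_div_factorial_le_exp (x := x) (by linarith) 3
    have e2 : Real.exp (-x) ≤ 1 := Real.exp_le_one_iff.2 (by linarith)
    rw [Real.sinh_eq]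
    norm_num [Nat.factorial] at e
    have : (27 : ℝ) ≤ x ^ 3 := by
      have := pow_le_pow_left₀ (by norm_num) (hX3.trans hxX) 3
      linarith
    linarith
  have h4 : Real.sinh x ≤ ‖Complex.sinh z‖ := by
    have := abs_sinh_re_le z
    rw [Real.abs_sinh] at this
    exact this
  have h5 : ‖z‖ * (‖z‖ + 1 + |a|) ≤ l * ‖Complex.sinh z‖ := by
    have : 144 ≤ l * x := by
      rw [div_le_iff₀ hl] at hXl
      nlinarith
    have h6 : 6 * x ^ 2 ≤ l * (x ^ 3 / 24) := by nlinarith [sq_nonneg x]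
    have h7 : l * (x ^ 3 / 24) ≤ l * ‖Complex.sinh z‖ := by gcongr; linarith
    have h8 : ‖z‖ * (‖z‖ + 1 + |a|) ≤ (2 * x) * (2 * x + x) := by
      gcongr ?_ * ?_
      linarith
    linarith [h8]
  have h6 : ‖z‖ + 1 + |a| ≤ ‖(l : ℂ) * Complex.sinh z / z‖ := by
    rw [norm_div, norm_mul, Complex.norm_real, Real.norm_eq_abs, abs_of_pos hl, le_div_iff₀ hnz]
    linarith
  rw [sinhMap_of_ne hz0]
  have := norm_sub_le ((l : ℂ) * Complex.sinh z / z + a) a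
  simp only [add_sub_cancel_right, Complex.norm_real, Real.norm_eq_abs] at this
  linarith

theorem exists_realMap_growth (hl : 0 < l) (a : ℝ) : ∃ X > 0, ∀ x : ℝ, X ≤ |x| →
    |x| + 1 ≤ realMap l a x := by
  obtain ⟨X, hX, h⟩ := exists_growth hl a 0
  refine ⟨max X |a|, lt_max_of_lt_left hX, fun x hx => ?_⟩
  have h1 := h x (by simp) (by simpa using (le_max_left _ _).trans hx)
  rw [sinhMap_ofReal, Complex.norm_real, Complex.norm_real, Real.norm_eq_abs,
    Real.norm_eq_abs] at h1
  have h2 := realMap_ge (a := a) hl x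
  have h3 := neg_abs_le a
  have h4 := (le_max_right _ _).trans hx
  rcases le_abs'.1 h1 with h | h <;> linarith

end calculus

section sections
variable {l a : ℝ}

theorem isBounded_inter_preimage (hl : 0 < l) {C K : Set ℂ} {B : ℝ} (hC : ∀ z ∈ C, |z.im| ≤ B)
    (hK : IsCompact K) : Bornology.IsBounded (C ∩ sinhMap l a ⁻¹' K) := by
  obtain ⟨X, hX, h⟩ := exists_growth hl a B
  obtain ⟨R, hR⟩ := isBounded_iff_forall_norm_le.1 hK.isBounded
  refine isBounded_iff_forall_norm_le.2 ⟨max X R, fun z hz => ?_⟩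
  by_contra hcon
  rw [not_le] at hcon
  have h1 := h z (hC z hz.1) ((le_max_left _ _).trans hcon.le)
  have h2 := hR _ hz.2
  have := (le_max_right X R).trans hcon.le
  linarith

theorem isCompact_inter_preimage (hl : 0 < l) {C K : Set ℂ} {B : ℝ} (hC : ∀ z ∈ C, |z.im| ≤ B)
    (hCc : IsClosed C) (hK : IsCompact K) : IsCompact (C ∩ sinhMap l a ⁻¹' K) :=
  Metric.isCompact_of_isClosed_isBounded (hCc.inter (hK.isClosed.preimage continuous_sinhMap))
    (isBounded_inter_preimage hl hC hK)

/-- The half-plane containing the numbers whose imaginary part has the sign of `σ`. -/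
def signHalfPlane (σ : ℝ) : Set ℂ := {w | 0 < σ * w.im}

theorem isOpen_signHalfPlane (σ : ℝ) : IsOpen (signHalfPlane σ) :=
  isOpen_lt continuous_const (by fun_prop)

theorem convex_signHalfPlane (σ : ℝ) : Convex ℝ (signHalfPlane σ) := by
  intro x hx y hy s t hs ht hst
  have hx : 0 < σ * x.im := hx
  have hy : 0 < σ * y.im := hy
  change 0 < σ * (s • x + t • y).im
  simp only [Complex.add_im, Complex.real_smul, Complex.mul_im, Complex.ofReal_re,
    Complex.ofReal_im, zero_mul, add_zero]
  have : σ * (s * x.im + t * y.im) = s * (σ * x.im) + t * (σ * y.im) := by ring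
  rw [this]
  rcases hs.eq_or_lt with rfl | hs
  · have : t = 1 := by linarith
    subst this; simpa using hy
  · have := mul_pos hs hx
    have := mul_nonneg ht hy.le
    linarith

theorem sinhMap_im_eq_zero_of_re_eq_zero {z : ℂ} (h : z.re = 0) : (sinhMap l a z).im = 0 := by
  have : z = (z.im : ℂ) * Complex.I := by
    apply Complex.ext <;> simp [h]
  rw [this]; exact sinhMap_mul_I_im _

theorem sinhMap_im_eq_zero_of_im_eq_zero {z : ℂ} (h : z.im = 0) : (sinhMap l a z).im = 0 := by
  have : z = (z.re : ℂ) := by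
    apply Complex.ext <;> simp [h]
  rw [this, sinhMap_ofReal]; simp

theorem exists_section_of_re_pos (hl : 0 < l) {σ : ℝ} (hσ : σ = 1 ∨ σ = -1) {z : ℂ}
    (hx : 0 < z.re) (hz : 0 < σ * (sinhMap l a z).im) :
    ∃ φ : ℂ → ℂ, DifferentiableOn ℂ φ (signHalfPlane σ) ∧
      (∀ w ∈ signHalfPlane σ, sinhMap l a (φ w) = w) ∧ φ (sinhMap l a z) = z := by
  have hσ2 : σ ^ 2 = 1 := by rcases hσ with rfl | rfl <;> norm_num
  obtain ⟨k, hk1, hk2⟩ : ∃ k : ℤ, -(σ * (Real.pi / 2)) + k * (2 * Real.pi) ≤ z.im ∧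
      z.im < -(σ * (Real.pi / 2)) + (k + 1) * (2 * Real.pi) := by
    obtain ⟨k, ⟨h1, h2⟩, -⟩ := existsUnique_zsmul_near_of_pos (a := 2 * Real.pi)
      (by positivity) (z.im + σ * (Real.pi / 2))
    refine ⟨k, ?_, ?_⟩
    · rw [zsmul_eq_mul] at h1; linarith
    · rw [zsmul_eq_mul] at h2; push_cast at h2; linarith
  set y₀ := -(σ * (Real.pi / 2)) + k * (2 * Real.pi) with hy₀
  have hsin : ∀ m : ℤ, Real.sin (-(σ * (Real.pi / 2)) + m * (2 * Real.pi)) = -σ := by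
    intro m
    rw [Real.sin_add_int_mul_two_pi]
    rcases hσ with rfl | rfl <;> simp [Real.sin_neg]
  have hcos : ∀ m : ℤ, Real.cos (-(σ * (Real.pi / 2)) + m * (2 * Real.pi)) = 0 := by
    intro m
    rw [Real.cos_add_int_mul_two_pi]
    rcases hσ with rfl | rfl <;> simp
  have hline : ∀ m : ℤ, ∀ w : ℂ, 0 < w.re → w.im = -(σ * (Real.pi / 2)) + m * (2 * Real.pi) →
      σ * (sinhMap l a w).im < 0 := by
    intro m w hw him
    have hw0 : 0 < Complex.normSq w := Complex.normSq_pos.2 (by rintro rfl; simp at hw)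
    have h := sinhMap_im_mul (l := l) (a := a) w
    rw [him, hsin, hcos] at h
    have h2 : Complex.normSq w * (σ * (sinhMap l a w).im) = -(l * (w.re * Real.cosh w.re)) := by
      linear_combination σ * h - l * w.re * Real.cosh w.re * hσ2
    have : 0 < l * (w.re * Real.cosh w.re) := by have := Real.cosh_pos w.re; positivity
    by_contra hcon
    have := mul_nonneg hw0.le (not_lt.1 hcon)
    linarith
  set U : Set ℂ := {w | 0 < w.re ∧ y₀ < w.im ∧ w.im < y₀ + 2 * Real.pi ∧
    0 < σ * (sinhMap l a w).im} with hUdef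
  have him_cont : Continuous fun w => σ * (sinhMap l a w).im :=
    continuous_const.mul (Complex.continuous_im.comp continuous_sinhMap)
  have hU : IsOpen U := by
    refine (isOpen_lt continuous_const Complex.continuous_re).inter
      ((isOpen_lt continuous_const Complex.continuous_im).inter
      ((isOpen_lt Complex.continuous_im continuous_const).inter
      (isOpen_lt continuous_const him_cont)))
  have hzU : z ∈ U := by
    refine ⟨hx, lt_of_le_of_ne hk1 ?_, by linarith, hz⟩
    intro h
    exact absurd (hline k z hx h.symm) (not_lt.2 hz.le)
  have hσI : σ • Complex.I ∈ signHalfPlane σ := by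
    change 0 < σ * (σ • Complex.I).im
    rcases hσ with rfl | rfl <;> simp
  suffices hproper : ∀ K ⊆ signHalfPlane σ, IsCompact K →
      IsCompact (U ∩ sinhMap l a ⁻¹' K) by
    obtain ⟨φ, h1, -, h3, h4⟩ := exists_holomorphic_section (f := sinhMap l a) hU
      (isOpen_signHalfPlane σ) hσI ((convex_signHalfPlane σ).starConvex hσI)
      differentiable_sinhMap.differentiableOn
      (fun w hw => deriv_sinhMap_ne_zero hl hw.1.ne') (fun w hw => hw.2.2.2) hproper hzU
    exact ⟨φ, h1, h3, h4⟩
  intro K hKS hK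
  · set C : Set ℂ := {w | 0 ≤ w.re ∧ y₀ ≤ w.im ∧ w.im ≤ y₀ + 2 * Real.pi} with hC
    have hCc : IsClosed C :=
      (isClosed_le continuous_const Complex.continuous_re).inter
      ((isClosed_le continuous_const Complex.continuous_im).inter
      (isClosed_le Complex.continuous_im continuous_const))
    have hCB : ∀ w ∈ C, |w.im| ≤ |y₀| + 2 * Real.pi := by
      rintro w ⟨-, h1, h2⟩
      have := neg_abs_le y₀
      have := le_abs_self y₀
      have := Real.pi_pos
      exact abs_le.2 ⟨by linarith, by linarith⟩
    have heq : U ∩ sinhMap l a ⁻¹' K = C ∩ sinhMap l a ⁻¹' K := by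
      ext w
      constructor
      · rintro ⟨⟨h1, h2, h3, h4⟩, h5⟩
        exact ⟨⟨h1.le, h2.le, h3.le⟩, h5⟩
      · rintro ⟨⟨h1, h2, h3⟩, h5⟩
        have h6 : 0 < σ * (sinhMap l a w).im := hKS h5
        have h7 : 0 < w.re := by
          refine lt_of_le_of_ne h1 fun h => ?_
          rw [sinhMap_im_eq_zero_of_re_eq_zero h.symm] at h6
          simp at h6
        refine ⟨⟨h7, lt_of_le_of_ne h2 fun h => ?_, lt_of_le_of_ne h3 fun h => ?_, h6⟩, h5⟩
        · exact absurd (hline k w h7 h.symm) (not_lt.2 h6.le)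
        · refine absurd (hline (k + 1) w h7 ?_) (not_lt.2 h6.le)
          rw [h, hy₀]; push_cast; ring
    rw [heq]
    exact isCompact_inter_preimage hl hCB hCc hK

/-- Inverse branches over half-planes. -/
theorem exists_section_halfPlane (hl : 0 < l) {z : ℂ} (hz : (sinhMap l a z).im ≠ 0) :
    ∃ σ : ℝ, (σ = 1 ∨ σ = -1) ∧ 0 < σ * (sinhMap l a z).im ∧
    ∃ φ : ℂ → ℂ, DifferentiableOn ℂ φ (signHalfPlane σ) ∧
      (∀ w ∈ signHalfPlane σ, sinhMap l a (φ w) = w) ∧ φ (sinhMap l a z) = z := by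
  obtain ⟨σ, hσ, hpos⟩ : ∃ σ : ℝ, (σ = 1 ∨ σ = -1) ∧ 0 < σ * (sinhMap l a z).im := by
    rcases lt_or_gt_of_ne hz with h | h
    · exact ⟨-1, Or.inr rfl, by linarith⟩
    · exact ⟨1, Or.inl rfl, by linarith⟩
  refine ⟨σ, hσ, hpos, ?_⟩
  have hre : z.re ≠ 0 := fun h => hz (sinhMap_im_eq_zero_of_re_eq_zero h)
  rcases lt_or_gt_of_ne hre with h | h
  · obtain ⟨φ, h1, h2, h3⟩ := exists_section_of_re_pos (a := a) hl hσ (z := -z) (by simpa using h)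
      (by rwa [sinhMap_neg])
    refine ⟨fun w => -φ w, h1.neg, fun w hw => by rw [sinhMap_neg, h2 w hw], ?_⟩
    rw [sinhMap_neg] at h3
    simp [h3]
  · exact exists_section_of_re_pos hl hσ h hpos

end sections

section sections
variable {l a : ℝ}

theorem IsPreconnected.pos_of_ne_zero {C : Set ℂ} (hC : IsPreconnected C) {p : ℂ → ℝ}
    (hp : ContinuousOn p C) (hne : ∀ z ∈ C, p z ≠ 0) {z₀ : ℂ} (hz₀ : z₀ ∈ C) (h₀ : 0 < p z₀) :
    ∀ z ∈ C, 0 < p z := by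
  intro z hz
  by_contra hcon
  obtain ⟨w, hw, hw0⟩ := hC.intermediate_value hz hz₀ hp ⟨not_lt.1 hcon, h₀.le⟩
  exact hne w hw hw0

theorem im_ne_zero_of_sinhMap {z : ℂ} (h : (sinhMap l a z).im ≠ 0) : z.im ≠ 0 :=
  fun h' => h (sinhMap_im_eq_zero_of_im_eq_zero h')

theorem re_ne_zero_of_sinhMap {z : ℂ} (h : (sinhMap l a z).im ≠ 0) : z.re ≠ 0 :=
  fun h' => h (sinhMap_im_eq_zero_of_re_eq_zero h')

theorem deriv_mul_deriv_section {f φ : ℂ → ℂ} {S : Set ℂ} (hS : IsOpen S)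
    (hf : Differentiable ℂ f) (hφ : DifferentiableOn ℂ φ S) (h : ∀ w ∈ S, f (φ w) = w) {w : ℂ}
    (hw : w ∈ S) : deriv f (φ w) * deriv φ w = 1 := by
  have h1 : HasDerivAt (f ∘ φ) (deriv f (φ w) * deriv φ w) w :=
    (hf (φ w)).hasDerivAt.comp w (hφ.differentiableAt (hS.mem_nhds hw)).hasDerivAt
  have h2 : HasDerivAt (f ∘ φ) 1 w := by
    refine (hasDerivAt_id w).congr_of_eventuallyEq ?_
    filter_upwards [hS.mem_nhds hw] with y hy using h y hy
  exact h1.unique h2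

/-- Hyperbolic expansion of `sinhMap` between quadrants and half-planes. -/
theorem norm_mul_im_le_deriv (hl : 0 < l) {z : ℂ} (hz : (sinhMap l a z).im ≠ 0) :
    ‖z‖ * |(sinhMap l a z).im| ≤ ‖deriv (sinhMap l a) z‖ * (|z.re| * |z.im|) := by
  obtain ⟨σ, hσ, hpos, φ, hφd, hφs, hφz⟩ := exists_section_halfPlane hl hz
  set w₀ := sinhMap l a z with hw₀
  have hσ2 : σ * σ = 1 := by rcases hσ with rfl | rfl <;> norm_num
  have hne : ∀ w ∈ signHalfPlane σ, (φ w).re * (φ w).im ≠ 0 := by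
    intro w hw
    have h : (sinhMap l a (φ w)).im ≠ 0 := by
      rw [hφs w hw]
      rintro h
      have : 0 < σ * w.im := hw
      rw [h] at this; simp at this
    exact mul_ne_zero (re_ne_zero_of_sinhMap h) (im_ne_zero_of_sinhMap h)
  have hmem : w₀ ∈ signHalfPlane σ := hpos
  obtain ⟨τ, hτ, hτpos⟩ : ∃ τ : ℝ, (τ = 1 ∨ τ = -1) ∧ 0 < τ * ((φ w₀).re * (φ w₀).im) := by
    rcases lt_or_gt_of_ne (hne w₀ hmem) with h | h
    · exact ⟨-1, Or.inr rfl, by linarith⟩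
    · exact ⟨1, Or.inl rfl, by linarith⟩
  have hτ0 : τ ≠ 0 := by rcases hτ with rfl | rfl <;> norm_num
  have hφpos : ∀ w ∈ signHalfPlane σ, 0 < τ * ((φ w).re * (φ w).im) := by
    refine (convex_signHalfPlane σ).isPreconnected.pos_of_ne_zero
      (p := fun w => τ * ((φ w).re * (φ w).im)) ?_ (fun w hw => mul_ne_zero hτ0 (hne w hw))
      hmem hτpos
    have hc := hφd.continuousOn
    exact continuousOn_const.mul ((Complex.continuous_re.comp_continuousOn hc).mul
      (Complex.continuous_im.comp_continuousOn hc))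
  set ι : ℂ → ℂ := fun u => Complex.I * σ * u with hι
  have hιmem : ∀ u : ℂ, 0 < u.re → ι u ∈ signHalfPlane σ := by
    intro u hu
    change 0 < σ * (Complex.I * σ * u).im
    simp only [Complex.mul_im, Complex.mul_re, Complex.I_re, Complex.I_im, Complex.ofReal_re,
      Complex.ofReal_im]
    ring_nf
    rw [pow_two, hσ2]; linarith
  set ψ : ℂ → ℂ := fun u => -Complex.I * τ * φ (ι u) ^ 2 with hψ
  set u₀ : ℂ := -Complex.I * σ * w₀ with hu₀
  have hσc : (σ : ℂ) * σ = 1 := by exact_mod_cast hσ2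
  have hιu : ι u₀ = w₀ := by
    simp only [hι, hu₀]
    linear_combination (-Complex.I ^ 2 * w₀) * hσc - w₀ * Complex.I_sq
  have hιd : ∀ u, HasDerivAt ι (Complex.I * σ) u := fun u => by
    simpa using (hasDerivAt_id u).const_mul (Complex.I * (σ : ℂ))
  have hψd : DifferentiableOn ℂ ψ {z | 0 < z.re} := by
    refine DifferentiableOn.const_mul (DifferentiableOn.pow ?_ 2) _
    exact hφd.comp (fun u _ => (hιd u).differentiableAt.differentiableWithinAt)
      (fun u hu => hιmem u hu)
  have hψre : ∀ u, (ψ u).re = 2 * (τ * ((φ (ι u)).re * (φ (ι u)).im)) := by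
    intro u
    simp only [hψ, pow_two, Complex.mul_re, Complex.mul_im, Complex.neg_re, Complex.neg_im,
      Complex.I_re, Complex.I_im, Complex.ofReal_re, Complex.ofReal_im]
    ring
  have hψpos : ∀ u : ℂ, 0 < u.re → 0 < (ψ u).re := by
    intro u hu
    rw [hψre]
    have := hφpos _ (hιmem u hu)
    linarith
  have hu₀re : u₀.re = σ * w₀.im := by
    simp [hu₀]
  have h := schwarz_halfPlane_deriv hψd hψpos (c := u₀) (by rw [hu₀re]; exact hpos)
  have hφw : HasDerivAt φ (deriv φ w₀) (ι u₀) := by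
    rw [hιu]
    exact (hφd.differentiableAt ((isOpen_signHalfPlane σ).mem_nhds hmem)).hasDerivAt
  have hψ' : HasDerivAt ψ (-Complex.I * τ * ((2 : ℕ) * φ (ι u₀) ^ (2 - 1) *
      (deriv φ w₀ * (Complex.I * σ)))) u₀ :=
    ((hφw.comp u₀ (hιd u₀)).pow 2).const_mul _
  have hστ : |σ| = 1 ∧ |τ| = 1 := by
    constructor
    · rcases hσ with rfl | rfl <;> simp
    · rcases hτ with rfl | rfl <;> simp
  rw [hψ'.deriv, hψre, hιu, hφz, hu₀re] at h
  simp only [norm_mul, norm_neg, Complex.norm_I, Complex.norm_real, Real.norm_eq_abs, hστ.1,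
    hστ.2] at h
  norm_num at h
  have h1 : σ * w₀.im = |w₀.im| := by
    rw [← abs_of_pos hpos, abs_mul, hστ.1, one_mul]
  have h2 : τ * (z.re * z.im) = |z.re| * |z.im| := by
    rw [hφz] at hτpos
    rw [← abs_of_pos hτpos, abs_mul, hστ.2, one_mul, abs_mul]
  rw [h1, h2] at h
  have h3 := congrArg norm (deriv_mul_deriv_section (isOpen_signHalfPlane σ)
    differentiable_sinhMap hφd hφs hmem)
  rw [hφz, norm_mul, norm_one] at h3
  have h4 : ‖z‖ * ‖deriv φ w₀‖ * |w₀.im| ≤ |z.re| * |z.im| := by linarith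
  calc ‖z‖ * |w₀.im| = (‖deriv (sinhMap l a) z‖ * ‖deriv φ w₀‖) * (‖z‖ * |w₀.im|) := by
        rw [h3, one_mul]
    _ = ‖deriv (sinhMap l a) z‖ * (‖z‖ * ‖deriv φ w₀‖ * |w₀.im|) := by ring
    _ ≤ _ := by gcongr

/-- A connected subset of the Fatou set which avoids the real axis and meets an image of a
wandering domain is contained in that image. -/
theorem subset_image_iterate (hl : 0 < l) {W : Set ℂ} (hW : IsWanderingDomain (sinhMap l a) W)
    {n : ℕ} {C : Set ℂ} (hC : IsPreconnected C) (hCF : C ⊆ FatouSet (sinhMap l a))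
    (hne : ∀ z ∈ C, z.im ≠ 0) {z : ℂ} (hz : z ∈ C) (hzW : z ∈ (sinhMap l a)^[n] '' W) :
    C ⊆ (sinhMap l a)^[n] '' W := by
  induction n generalizing C z with
  | zero =>
    simp only [Function.iterate_zero, image_id] at hzW ⊢
    exact hW.subset_of_isPreconnected hC hCF hzW hz
  | succ n ih =>
    obtain ⟨w, hw, rfl⟩ := hzW
    rw [Function.iterate_succ_apply'] at hz
    set y := (sinhMap l a)^[n] w with hy
    obtain ⟨σ, hσ, hpos, φ, hφd, hφs, hφz⟩ := exists_section_halfPlane hl (hne _ hz)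
    have hσ0 : σ ≠ 0 := by rcases hσ with rfl | rfl <;> norm_num
    have hCσ : C ⊆ signHalfPlane σ :=
      hC.pos_of_ne_zero (p := fun z => σ * z.im) (by fun_prop)
        (fun z hz => mul_ne_zero hσ0 (hne z hz)) hz hpos
    have hsub : φ '' C ⊆ (sinhMap l a)^[n] '' W := by
      refine ih (hC.image φ (hφd.continuousOn.mono hCσ)) ?_ ?_ (z := y) ⟨_, hz, hφz⟩ ⟨w, hw, rfl⟩
      · rintro _ ⟨c, hc, rfl⟩
        refine mem_fatouSet_of_map_mem continuous_sinhMap ?_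
        rw [hφs c (hCσ hc)]
        exact hCF hc
      · rintro _ ⟨c, hc, rfl⟩
        refine im_ne_zero_of_sinhMap (l := l) (a := a) ?_
        rw [hφs c (hCσ hc)]
        exact hne c hc
    intro c hc
    obtain ⟨v, hv, hvc⟩ := hsub ⟨c, hc, rfl⟩
    refine ⟨v, hv, ?_⟩
    rw [Function.iterate_succ_apply', hvc, hφs c (hCσ hc)]

end sections

section slit
variable {l a : ℝ}

/-- The plane slit along the real half-line `(-∞, c]`. -/
def slit (c : ℝ) : Set ℂ := {w | w.im ≠ 0 ∨ c < w.re}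

theorem isOpen_slit (c : ℝ) : IsOpen (slit c) :=
  (isOpen_ne_fun Complex.continuous_im continuous_const).union
    (isOpen_lt continuous_const Complex.continuous_re)

theorem starConvex_slit (c : ℝ) : StarConvex ℝ ((c : ℂ) + 1) (slit c) := by
  intro y hy s t hs ht hst
  simp only [slit, mem_ofPred_eq, Complex.add_im, Complex.add_re, Complex.real_smul, Complex.mul_im,
    Complex.mul_re, Complex.ofReal_re, Complex.ofReal_im, Complex.one_re, Complex.one_im] at hy ⊢
  rcases ht.eq_or_lt with rfl | ht
  · have : s = 1 := by linarith
    subst this; right; linarith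
  rcases hy with hy | hy
  · left
    simpa using ⟨ht.ne', hy⟩
  · right
    have hs' : s = 1 - t := by linarith
    subst hs'
    nlinarith

theorem sinhMap_re_lt_of_strip (hl : 0 < l) {z : ℂ} (hx : 0 < z.re) (hy : Real.pi ≤ |z.im|)
    (hy' : |z.im| ≤ 3 * Real.pi / 2) : (sinhMap l a z).re < a := by
  have hz0 : z ≠ 0 := by rintro rfl; simp at hx
  have hz : 0 < Complex.normSq z := Complex.normSq_pos.2 hz0
  have h := sinhMap_re_mul_of_ne (l := l) (a := a) hz0
  have hpi := Real.pi_pos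
  have e1 : Real.cos z.im = -Real.cos (|z.im| - Real.pi) := by
    rw [Real.cos_sub_pi, Real.cos_abs, neg_neg]
  have e2 : z.im * Real.sin z.im = -(|z.im| * Real.sin (|z.im| - Real.pi)) := by
    rw [Real.sin_sub_pi]
    rcases abs_choice z.im with h | h <;> rw [h] <;> simp
  have h1 : 0 ≤ Real.cos (|z.im| - Real.pi) :=
    Real.cos_nonneg_of_neg_pi_div_two_le_of_le (by linarith) (by linarith)
  have h2 : 0 ≤ Real.sin (|z.im| - Real.pi) := Real.sin_nonneg_of_nonneg_of_le_pi (by linarith) (by linarith)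
  have hs := Real.sinh_pos_iff.2 hx
  have hc := Real.cosh_pos z.re
  have h3 : 0 < z.re * Real.sinh z.re * Real.cos (|z.im| - Real.pi) + |z.im| * Real.cosh z.re * Real.sin (|z.im| - Real.pi) := by
    rcases h1.eq_or_lt with h1 | h1
    · have : Real.sin (|z.im| - Real.pi) ^ 2 = 1 := by
        have := Real.sin_sq_add_cos_sq (|z.im| - Real.pi)
        rw [← h1] at this; linarith
      have h4 : 0 < Real.sin (|z.im| - Real.pi) := by
        refine lt_of_le_of_ne h2 fun h => ?_
        rw [← h] at this; norm_num at this
      rw [← h1]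
      have : 0 < |z.im| := by linarith
      simp only [mul_zero, zero_add]
      positivity
    · positivity
  have h4 : Complex.normSq z * ((sinhMap l a z).re - a) < 0 := by
    rw [h]
    have : z.re * Real.sinh z.re * Real.cos z.im + z.im * Real.cosh z.re * Real.sin z.im < 0 := by
      have : z.im * Real.cosh z.re * Real.sin z.im = Real.cosh z.re * (z.im * Real.sin z.im) := by
        ring
      rw [this, e1, e2]
      nlinarith
    exact mul_neg_of_pos_of_neg hl this
  by_contra hcon
  have := mul_nonneg hz.le (sub_nonneg.2 (not_lt.1 hcon))
  linarith

theorem sinhMap_mem_slit (hl : 0 < l) {z : ℂ} (hx : 0 < z.re) (hy : |z.im| < Real.pi) :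
    sinhMap l a z ∈ slit (l + a) := by
  rw [abs_lt] at hy
  rcases lt_trichotomy z.im 0 with h | h | h
  · exact Or.inl (sinhMap_im_neg hl hx h hy.1).ne
  · right
    have : z = (z.re : ℂ) := by apply Complex.ext <;> simp [h]
    rw [this, sinhMap_ofReal, Complex.ofReal_re, ← realMap_zero, realMap_lt_iff_abs hl]
    simpa using hx.ne'
  · exact Or.inl (sinhMap_im_pos hl hx h hy.2).ne'

/-- The principal inverse branch of `sinhMap`, defined on a slit plane. -/
theorem exists_slit_section (hl : 0 < l) (a : ℝ) : ∃ φ : ℂ → ℂ,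
    DifferentiableOn ℂ φ (slit (l + a)) ∧
    (∀ w ∈ slit (l + a), 0 < (φ w).re ∧ sinhMap l a (φ w) = w) ∧
    (∀ x : ℝ, l + a < x → (φ x).im = 0) ∧
    (∀ w : ℂ, w.im ≠ 0 → 0 < w.im * (φ w).im) ∧
    (∀ z : ℂ, 0 < z.re → |z.im| < Real.pi → φ (sinhMap l a z) = z) ∧
    ∃ M₀ : ℝ, ∀ M ≥ M₀, ∀ w ∈ slit (l + a), ‖w‖ < M → ‖φ w‖ < M := by
  have hpi := Real.pi_pos
  set S := slit (l + a) with hS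
  set U : Set ℂ := {z | 0 < z.re ∧ |z.im| < 3 * Real.pi / 2 ∧ sinhMap l a z ∈ S ∧
    (|z.im| < Real.pi ∨ 0 < z.im * (sinhMap l a z).im)} with hU
  have him : Continuous fun z => z.im * (sinhMap l a z).im :=
    Complex.continuous_im.mul (Complex.continuous_im.comp continuous_sinhMap)
  have habs : Continuous fun z : ℂ => |z.im| := Complex.continuous_im.abs
  have hUo : IsOpen U :=
    (isOpen_lt continuous_const Complex.continuous_re).inter
      ((isOpen_lt habs continuous_const).inter
      (((isOpen_slit _).preimage continuous_sinhMap).inter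
      ((isOpen_lt habs continuous_const).union (isOpen_lt continuous_const him))))
  have hStripU : ∀ z : ℂ, 0 < z.re → |z.im| < Real.pi → z ∈ U := fun z hx hy =>
    ⟨hx, by linarith, sinhMap_mem_slit hl hx hy, Or.inl hy⟩
  have hproper : ∀ K ⊆ S, IsCompact K → IsCompact (U ∩ sinhMap l a ⁻¹' K) := by
    intro K hKS hK
    set C : Set ℂ := {z | 0 ≤ z.re ∧ |z.im| ≤ 3 * Real.pi / 2 ∧
      (|z.im| ≤ Real.pi ∨ 0 ≤ z.im * (sinhMap l a z).im)} with hC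
    have hCc : IsClosed C :=
      (isClosed_le continuous_const Complex.continuous_re).inter
      ((isClosed_le habs continuous_const).inter
      ((isClosed_le habs continuous_const).union (isClosed_le continuous_const him)))
    have heq : U ∩ sinhMap l a ⁻¹' K = C ∩ sinhMap l a ⁻¹' K := by
      ext z
      constructor
      · rintro ⟨⟨h1, h2, h3, h4⟩, h5⟩
        exact ⟨⟨h1.le, h2.le, h4.imp (fun h => h.le) (fun h => h.le)⟩, h5⟩
      · rintro ⟨⟨h1, h2, h3⟩, h5⟩
        have h6 : sinhMap l a z ∈ S := hKS h5
        have h7 : 0 < z.re := by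
          refine lt_of_le_of_ne h1 fun h => ?_
          have hzI : z = (z.im : ℂ) * Complex.I := by apply Complex.ext <;> simp [← h]
          rcases h6 with h6 | h6
          · exact h6 (sinhMap_im_eq_zero_of_re_eq_zero h.symm)
          · rcases eq_or_ne z.im 0 with h0 | h0
            · rw [hzI, h0] at h6; simp [sinhMap_zero] at h6
            · have := sinhMap_mul_I_re_lt (a := a) hl h0
              rw [← hzI] at this; linarith
        have hnorm : 0 < Complex.normSq z :=
          Complex.normSq_pos.2 (by rintro rfl; simp at h7)
        have him_formula := sinhMap_im_mul (l := l) (a := a) z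
        have hs := Real.sinh_pos_iff.2 h7
        have hc := Real.cosh_pos z.re
        have h8 : |z.im| < 3 * Real.pi / 2 := by
          refine lt_of_le_of_ne h2 fun h => ?_
          have hcos : Real.cos z.im = 0 := by
            rw [← Real.cos_abs, h, show 3 * Real.pi / 2 = Real.pi / 2 + Real.pi by ring,
              Real.cos_add_pi, Real.cos_pi_div_two, neg_zero]
          have hsin : z.im * Real.sin z.im = -|z.im| := by
            have : Real.sin |z.im| = -1 := by
              rw [h, show 3 * Real.pi / 2 = Real.pi / 2 + Real.pi by ring,
              Real.sin_add_pi, Real.sin_pi_div_two]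
            rcases abs_choice z.im with h' | h' <;> rw [h'] at this ⊢
            · rw [this]; ring
            · rw [Real.sin_neg] at this
              have : Real.sin z.im = 1 := by linarith
              rw [this]; ring
          rcases h3 with h3 | h3
          · rw [h] at h3; linarith
          · have e : Complex.normSq z * (z.im * (sinhMap l a z).im) =
              -(l * (z.re * Real.cosh z.re * |z.im|)) := by
              rw [hcos] at him_formula
              linear_combination z.im * him_formula + l * z.re * Real.cosh z.re * hsin
            have : 0 < |z.im| := by rw [h]; positivity
            have : 0 < l * (z.re * Real.cosh z.re * |z.im|) := by positivity
            have := mul_nonneg hnorm.le h3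
            linarith
        refine ⟨⟨h7, h8, h6, ?_⟩, h5⟩
        rcases lt_or_ge |z.im| Real.pi with h9 | h9
        · exact Or.inl h9
        right
        have hre := sinhMap_re_lt_of_strip (a := a) hl h7 h9 h2
        have hne : (sinhMap l a z).im ≠ 0 := by
          rcases h6 with h6 | h6
          · exact h6
          · linarith
        have hz0 : z.im ≠ 0 := by
          intro h; rw [h] at h9; simp at h9; linarith
        rcases h9.eq_or_lt with h9 | h9
        · have hcos : Real.cos z.im = -1 := by
            rw [← Real.cos_abs, ← h9, Real.cos_pi]
          have hsin : Real.sin z.im = 0 := by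
            have := Real.sin_sq_add_cos_sq z.im
            rw [hcos] at this
            have : Real.sin z.im ^ 2 = 0 := by linarith
            exact pow_eq_zero_iff two_ne_zero |>.1 this
          rw [hcos, hsin] at him_formula
          have e : Complex.normSq z * (z.im * (sinhMap l a z).im) =
              l * (z.im ^ 2 * Real.sinh z.re) := by
            linear_combination z.im * him_formula
          refine pos_of_mul_pos_right (a := Complex.normSq z) ?_ hnorm.le
          rw [e]
          positivity
        · rcases h3 with h3 | h3
          · linarith
          · exact lt_of_le_of_ne h3 (mul_ne_zero hz0 hne).symm
    rw [heq]
    exact isCompact_inter_preimage hl (fun z hz => hz.2.1) hCc hK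
  have h1U : (1 : ℂ) ∈ U := hStripU 1 (by simp) (by simpa using hpi)
  have hs₀ : (((l + a : ℝ) : ℂ) + 1) ∈ S := Or.inr (by simp)
  obtain ⟨φ, hφd, hφU, hφs, hφ1⟩ := exists_holomorphic_section hUo (isOpen_slit (l + a)) hs₀
    (starConvex_slit (l + a)) differentiable_sinhMap.differentiableOn
    (fun z hz => deriv_sinhMap_ne_zero hl hz.1.ne') (fun z hz => hz.2.2.1) hproper h1U
  have hreal : ∀ x : ℝ, l + a < x → (φ x).im = 0 := by
    intro x hx
    have hxS : (x : ℂ) ∈ S := Or.inr (by simpa using hx)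
    obtain ⟨h1, h2, h3, h4⟩ := hφU hxS
    rw [hφs _ hxS] at h4
    rcases h4 with h4 | h4
    · by_contra hne
      rw [abs_lt] at h4
      have h5 := congrArg Complex.im (hφs _ hxS)
      rw [Complex.ofReal_im] at h5
      rcases lt_or_gt_of_ne hne with h | h
      · exact (sinhMap_im_neg hl h1 h h4.1).ne h5
      · exact (sinhMap_im_pos hl h1 h h4.2).ne' h5
    · simp at h4
  have hEq : EqOn (φ ∘ sinhMap l a) id {z : ℂ | 0 < z.re ∧ |z.im| < Real.pi} := by
    have hStripo : IsOpen {z : ℂ | 0 < z.re ∧ |z.im| < Real.pi} :=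
      (isOpen_lt continuous_const Complex.continuous_re).inter (isOpen_lt habs continuous_const)
    have hStripc : Convex ℝ {z : ℂ | 0 < z.re ∧ |z.im| < Real.pi} := by
      have h1 : Convex ℝ {z : ℂ | 0 < z.re} := convex_halfSpace_re_gt 0
      have h2 : Convex ℝ {z : ℂ | z.im < Real.pi} := convex_halfSpace_im_lt Real.pi
      have h3 : Convex ℝ {z : ℂ | -Real.pi < z.im} := convex_halfSpace_im_gt (-Real.pi)
      convert h1.inter (h3.inter h2) using 1
      ext z
      simp [abs_lt]
    have h1 : AnalyticOnNhd ℂ (φ ∘ sinhMap l a) {z : ℂ | 0 < z.re ∧ |z.im| < Real.pi} := by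
      refine DifferentiableOn.analyticOnNhd ?_ hStripo
      exact hφd.comp differentiable_sinhMap.differentiableOn
        (fun z hz => sinhMap_mem_slit hl hz.1 hz.2)
    refine h1.eqOn_of_preconnected_of_frequently_eq (analyticOnNhd_id) hStripc.isPreconnected
      (z₀ := 1) ⟨by simp, by simpa using hpi⟩ ?_
    have hreal_eq : ∀ x : ℝ, 0 < x → φ (sinhMap l a x) = x := by
      intro x hx
      have hlt : l + a < realMap l a x := by
        rw [← realMap_zero, realMap_lt_iff_abs hl]; simpa using hx.ne'
      have hmem : ((realMap l a x : ℝ) : ℂ) ∈ S := Or.inr (by simpa using hlt)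
      have him0 := hreal _ hlt
      rw [sinhMap_ofReal]
      set u := φ (realMap l a x) with hu
      have hure : u = (u.re : ℂ) := by apply Complex.ext <;> simp [him0]
      have hup := (hφU hmem).1
      have h2 := hφs _ hmem
      rw [← hu, hure, sinhMap_ofReal] at h2
      have h3 : realMap l a u.re = realMap l a x := by exact_mod_cast h2
      have h4 : u.re = x := (strictMonoOn_realMap hl).injOn hup.le hx.le h3
      rw [hure, h4]
    have ht : Tendsto (fun x : ℝ => (x : ℂ)) (𝓝[≠] 1) (𝓝[≠] (1 : ℂ)) := by
      refine tendsto_nhdsWithin_of_tendsto_nhds_of_eventually_within _ ?_ ?_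
      · have := (Complex.continuous_ofReal.tendsto (1 : ℝ)).mono_left
          (nhdsWithin_le_nhds (s := {(1 : ℝ)}ᶜ))
        simpa using this
      · filter_upwards [self_mem_nhdsWithin] with x hx
        have hx : x ≠ 1 := hx
        exact fun h => hx (Complex.ofReal_eq_one.1 h)
    refine ht.frequently (Eventually.frequently ?_)
    filter_upwards [nhdsWithin_le_nhds (lt_mem_nhds (show (0 : ℝ) < 1 by norm_num))] with x hx
    exact hreal_eq x hx
  obtain ⟨X, hX, hgrow⟩ := exists_growth hl a (3 * Real.pi / 2)
  refine ⟨φ, hφd, fun w hw => ⟨(hφU hw).1, hφs w hw⟩, hreal, ?_, fun z h1 h2 => hEq ⟨h1, h2⟩,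
    X, ?_⟩
  · intro w hw
    have hwS : w ∈ S := Or.inl hw
    obtain ⟨h1, h2, h3, h4⟩ := hφU hwS
    have h5 := hφs w hwS
    rw [h5] at h4
    rcases h4 with h4 | h4
    · rw [abs_lt] at h4
      have hne : (φ w).im ≠ 0 := im_ne_zero_of_sinhMap (l := l) (a := a) (by rwa [h5])
      rcases lt_or_gt_of_ne hne with h | h
      · have := sinhMap_im_neg (a := a) hl h1 h h4.1
        rw [h5] at this
        exact mul_pos_of_neg_of_neg this h
      · have := sinhMap_im_pos (a := a) hl h1 h h4.2
        rw [h5] at this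
        exact mul_pos this h
    · rwa [mul_comm] at h4
  · intro M hM w hw hwM
    by_contra hcon
    rw [not_lt] at hcon
    have h1 := hgrow (φ w) (hφU hw).2.1.le (hM.trans hcon)
    rw [hφs w hw] at h1
    linarith

end slit

section lens

/-- The principal square root. -/
noncomputable def csqrt (z : ℂ) : ℂ := Complex.exp (Complex.log z / 2)

theorem csqrt_sq {z : ℂ} (hz : z ≠ 0) : csqrt z ^ 2 = z := by
  rw [csqrt, ← Complex.exp_nat_mul]
  push_cast
  rw [mul_div_cancel₀ _ two_ne_zero, Complex.exp_log hz]

theorem csqrt_re_pos {z : ℂ} (hz : z ∈ Complex.slitPlane) : 0 < (csqrt z).re := by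
  rw [csqrt, Complex.exp_re]
  have h1 := Complex.mem_slitPlane_iff_arg.1 hz
  have h2 : (Complex.log z / 2).im = z.arg / 2 := by
    rw [show (Complex.log z / 2) = (Complex.log z / (2 : ℝ)) by push_cast; rfl,
      Complex.div_ofReal_im, Complex.log_im]
  rw [h2]
  have h3 := Complex.neg_pi_lt_arg z
  have h4 := lt_of_le_of_ne (Complex.arg_le_pi z) h1.1
  exact mul_pos (Real.exp_pos _) (Real.cos_pos_of_mem_Ioo ⟨by linarith, by linarith⟩)

theorem csqrt_ofReal_im {x : ℝ} (hx : 0 < x) : (csqrt x).im = 0 := by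
  rw [csqrt, ← Complex.ofReal_log hx.le]
  rw [show ((Real.log x : ℝ) : ℂ) / 2 = ((Real.log x / 2 : ℝ) : ℂ) by push_cast; rfl]
  exact Complex.exp_ofReal_im _

theorem differentiableOn_csqrt : DifferentiableOn ℂ csqrt Complex.slitPlane := fun _ hz =>
  (((Complex.differentiableAt_log hz).div_const 2).cexp).differentiableWithinAt

/-- The plane slit along the two real rays complementary to the interval `(t, e)`. -/
def slitInterval (t e : ℝ) : Set ℂ := {w | w.im ≠ 0 ∨ (t < w.re ∧ w.re < e)}

theorem ofReal_mem_slitInterval {t e x : ℝ} : (x : ℂ) ∈ slitInterval t e ↔ t < x ∧ x < e := by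
  simp [slitInterval]

theorem moebius_mem_slitPlane {u v : ℝ} (huv : u < v) {w : ℂ} (hw : w ∈ slitInterval u v) :
    (w - u) / (v - w) ∈ Complex.slitPlane := by
  have hvw : (v : ℂ) - w ≠ 0 := by
    intro h
    have : w = v := (sub_eq_zero.1 h).symm
    rcases hw with h | h <;> simp [this] at h
  have hN : 0 < Complex.normSq ((v : ℂ) - w) := Complex.normSq_pos.2 hvw
  rw [Complex.mem_slitPlane_iff]
  rcases hw with h | h
  · right
    have : ((w - u) / (v - w)).im = w.im * (v - u) / Complex.normSq ((v : ℂ) - w) := by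
      rw [Complex.div_im]
      simp
      field_simp
      ring
    rw [this]
    exact div_ne_zero (mul_ne_zero h (by linarith)) hN.ne'
  · by_cases h0 : w.im = 0
    · left
      have : ((w - u) / (v - w)).re = (w.re - u) * (v - w.re) / Complex.normSq ((v : ℂ) - w) := by
        rw [Complex.div_re]
        simp [h0]
      rw [this]
      exact div_pos (mul_pos (by linarith) (by linarith)) hN
    · right
      have : ((w - u) / (v - w)).im = w.im * (v - u) / Complex.normSq ((v : ℂ) - w) := by
        rw [Complex.div_im]
        simp
        field_simp
        ring
      rw [this]
      exact div_ne_zero (mul_ne_zero h0 (by linarith)) hN.ne'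

theorem moebius_inv_mem {t e : ℝ} (hte : t < e) {p : ℂ} (hp : p ∈ Complex.slitPlane) :
    (t + e * p) / (1 + p) ∈ slitInterval t e ∧ 1 + p ≠ 0 := by
  rw [Complex.mem_slitPlane_iff] at hp
  have h1p : 1 + p ≠ 0 := by
    intro h
    have : p = -1 := by linear_combination h
    subst this
    norm_num at hp
  refine ⟨?_, h1p⟩
  have hN : 0 < Complex.normSq (1 + p) := Complex.normSq_pos.2 h1p
  by_cases h0 : p.im = 0
  · have hp : 0 < p.re := by simpa [h0] using hp
    right
    have : ((t + e * p) / (1 + p)).re = (t + e * p.re) / (1 + p.re) := by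
      have : p = (p.re : ℂ) := by apply Complex.ext <;> simp [h0]
      rw [this]
      norm_cast
    rw [this, lt_div_iff₀ (by linarith), div_lt_iff₀ (by linarith)]
    constructor <;> nlinarith
  · left
    have : ((t + e * p) / (1 + p)).im = p.im * (e - t) / Complex.normSq (1 + p) := by
      rw [Complex.div_im]
      simp
      field_simp
      ring
    rw [this]
    exact div_ne_zero (mul_ne_zero h0 (by linarith)) hN.ne'

/-- Real-symmetric holomorphic maps between planes slit along complements of real intervals do not
increase the lens angle. -/
theorem lens_angle {Φ : ℂ → ℂ} {t e u v κ : ℝ} (hte : t < e)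
    (hΦ : DifferentiableOn ℂ Φ (slitInterval t e))
    (hmaps : MapsTo Φ (slitInterval t e) (slitInterval u v))
    (hreal : ∀ x : ℝ, t < x → x < e → (Φ x).im = 0) {z : ℂ} (hz : z.im ≠ 0)
    (hκ : 0 ≤ κ) (h : κ * |z.im| * (e - t) + z.im ^ 2 ≤ (z.re - t) * (e - z.re)) :
    κ * |(Φ z).im| * (v - u) + (Φ z).im ^ 2 ≤ ((Φ z).re - u) * (v - (Φ z).re) := by
  have huv : u < v := by
    have h1 : t < (t + e) / 2 := by linarith
    have h2 : (t + e) / 2 < e := by linarith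
    have h3 := hmaps (ofReal_mem_slitInterval.2 ⟨h1, h2⟩)
    rcases h3 with h3 | h3
    · exact absurd (hreal _ h1 h2) h3
    · linarith
  set W : ℂ → ℂ := fun s => (t + e * s ^ 2) / (1 + s ^ 2) with hW
  set Θ : ℂ → ℂ := fun s => csqrt ((Φ (W s) - u) / (v - Φ (W s))) with hΘ
  have hsq : ∀ s : ℂ, 0 < s.re → s ^ 2 ∈ Complex.slitPlane := by
    intro s hs
    rw [Complex.mem_slitPlane_iff]
    by_cases h0 : s.im = 0
    · left; simp [pow_two, h0, hs]
    · right
      simp only [pow_two, Complex.mul_im]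
      intro h
      have : s.re * s.im = 0 := by linarith
      simp [hs.ne', h0] at this
  have hWm : ∀ s : ℂ, 0 < s.re → W s ∈ slitInterval t e := fun s hs =>
    (moebius_inv_mem hte (hsq s hs)).1
  have hvne : ∀ w ∈ slitInterval u v, (v : ℂ) - w ≠ 0 := by
    intro w hw h
    have : w = v := (sub_eq_zero.1 h).symm
    rcases hw with h | h <;> simp [this] at h
  have hWd : DifferentiableOn ℂ W {s | 0 < s.re} := by
    intro s hs
    have := (moebius_inv_mem hte (hsq s hs)).2
    refine DifferentiableAt.differentiableWithinAt ?_
    fun_prop (disch := assumption)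
  have hΦW : DifferentiableOn ℂ (fun s => Φ (W s)) {s | 0 < s.re} :=
    hΦ.comp hWd fun s hs => hWm s hs
  have hΘd : DifferentiableOn ℂ Θ {s | 0 < s.re} := by
    have h1 : DifferentiableOn ℂ (fun s => (Φ (W s) - u) / (v - Φ (W s))) {s | 0 < s.re} :=
      (hΦW.sub_const _).div (hΦW.const_sub _) fun s hs => hvne _ (hmaps (hWm s hs))
    have h2 := DifferentiableOn.comp (g := csqrt) differentiableOn_csqrt h1
      fun s hs => moebius_mem_slitPlane huv (hmaps (hWm s hs))
    exact h2
  have hΘpos : ∀ s : ℂ, 0 < s.re → 0 < (Θ s).re := fun s hs =>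
    csqrt_re_pos (moebius_mem_slitPlane huv (hmaps (hWm s hs)))
  have hΘreal : ∀ r : ℝ, 0 < r → (Θ r).im = 0 := by
    intro r hr
    have h1 : W r = (((t + e * r ^ 2) / (1 + r ^ 2) : ℝ) : ℂ) := by simp [hW]
    have h2 := hWm r (by simpa using hr)
    rw [h1, ofReal_mem_slitInterval] at h2
    have h3 := hreal _ h2.1 h2.2
    have h4 := hmaps (ofReal_mem_slitInterval.2 h2)
    rw [← h1] at h3 h4
    have h5 : Φ (W r) = ((Φ (W r)).re : ℂ) := by apply Complex.ext <;> simp [h3]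
    rcases h4 with h4 | h4
    · exact absurd h3 h4
    · simp only [hΘ]
      rw [h5, ← Complex.ofReal_sub, ← Complex.ofReal_sub, ← Complex.ofReal_div]
      exact csqrt_ofReal_im (div_pos (by linarith) (by linarith))
  have hzs : z ∈ slitInterval t e := Or.inl hz
  set q : ℂ := (z - t) / (e - z) with hq
  have hqs : q ∈ Complex.slitPlane := moebius_mem_slitPlane hte hzs
  have hq0 : q ≠ 0 := Complex.slitPlane_ne_zero hqs
  have hez : (e : ℂ) - z ≠ 0 := by
    intro h
    have : z = e := (sub_eq_zero.1 h).symm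
    simp [this] at hz
  have hWz : W (csqrt q) = z := by
    have h1 := (moebius_inv_mem hte hqs).2
    have hte' : (e : ℂ) - t ≠ 0 := by
      rw [← Complex.ofReal_sub]; exact_mod_cast (sub_pos.2 hte).ne'
    simp only [hW, csqrt_sq hq0]
    rw [div_eq_iff h1, hq]
    field_simp
    ring
  have key := arg_sq_nonincreasing hΘd hΘpos hΘreal (csqrt_re_pos hqs)
  set w := Φ z with hw
  have hws : w ∈ slitInterval u v := hmaps hzs
  have hΘz : Θ (csqrt q) ^ 2 = (w - u) / (v - w) := by
    simp only [hΘ, hWz]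
    exact csqrt_sq (Complex.slitPlane_ne_zero (moebius_mem_slitPlane huv hws))
  rw [hΘz, csqrt_sq hq0] at key
  set q' : ℂ := (w - u) / (v - w) with hq'
  have hvw := hvne w hws
  have hN : 0 < Complex.normSq ((e : ℂ) - z) := Complex.normSq_pos.2 hez
  have hN' : 0 < Complex.normSq ((v : ℂ) - w) := Complex.normSq_pos.2 hvw
  have qre : q.re * Complex.normSq ((e : ℂ) - z) = (z.re - t) * (e - z.re) - z.im ^ 2 := by
    rw [hq, Complex.div_re]; simp; field_simp; ring
  have qim : q.im * Complex.normSq ((e : ℂ) - z) = z.im * (e - t) := by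
    rw [hq, Complex.div_im]; simp; field_simp; ring
  have qre' : q'.re * Complex.normSq ((v : ℂ) - w) = (w.re - u) * (v - w.re) - w.im ^ 2 := by
    rw [hq', Complex.div_re]; simp; field_simp; ring
  have qim' : q'.im * Complex.normSq ((v : ℂ) - w) = w.im * (v - u) := by
    rw [hq', Complex.div_im]; simp; field_simp; ring
  have hq1 : κ * |q.im| ≤ q.re := by
    have h1 : |q.im| * Complex.normSq ((e : ℂ) - z) = |z.im| * (e - t) := by
      rw [← abs_of_pos hN, ← abs_mul, qim, abs_mul, abs_of_pos (sub_pos.2 hte)]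
    refine le_of_mul_le_mul_right (a := Complex.normSq ((e : ℂ) - z)) ?_ hN
    rw [qre, mul_assoc, h1]
    linarith
  have hqre : 0 ≤ q.re := le_trans (by positivity) hq1
  have hqn : 0 < ‖q‖ := norm_pos_iff.2 hq0
  have hq're : 0 ≤ q'.re := by
    have : 0 ≤ q'.re * ‖q‖ := le_trans (by positivity) key
    exact nonneg_of_mul_nonneg_left this hqn
  have hqim : 0 < |q.im| := by
    rw [abs_pos]
    intro h
    rw [h, zero_mul] at qim
    exact mul_ne_zero hz (sub_pos.2 hte).ne' qim.symm
  have key2 : q.re * |q'.im| ≤ q'.re * |q.im| := by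
    have h1 : (q.re * ‖q'‖) ^ 2 ≤ (q'.re * ‖q‖) ^ 2 := by gcongr
    rw [mul_pow, mul_pow, ← Complex.normSq_eq_norm_sq, ← Complex.normSq_eq_norm_sq,
      Complex.normSq_apply, Complex.normSq_apply] at h1
    refine le_of_sq_le_sq ?_ (by positivity)
    rw [mul_pow, mul_pow, sq_abs, sq_abs]
    nlinarith
  have hq2 : κ * |q'.im| ≤ q'.re := by
    refine le_of_mul_le_mul_right (a := |q.im|) ?_ hqim
    calc κ * |q'.im| * |q.im| = κ * |q.im| * |q'.im| := by ring
      _ ≤ q.re * |q'.im| := by gcongr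
      _ ≤ _ := key2
  have h1 : |q'.im| * Complex.normSq ((v : ℂ) - w) = |w.im| * (v - u) := by
    rw [← abs_of_pos hN', ← abs_mul, qim', abs_mul, abs_of_pos (sub_pos.2 huv)]
  have h2 := mul_le_mul_of_nonneg_right hq2 hN'.le
  rw [qre', mul_assoc, h1] at h2
  linarith

end lens

section pullback
variable {l a M₀ : ℝ} {φ : ℂ → ℂ}

/-- `φ` is the principal inverse branch of `sinhMap l a` on the slit plane. -/
structure IsSlitSection (l a : ℝ) (φ : ℂ → ℂ) (M₀ : ℝ) : Prop where
  differentiableOn : DifferentiableOn ℂ φ (slit (l + a))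
  re_pos : ∀ w ∈ slit (l + a), 0 < (φ w).re
  map_eq : ∀ w ∈ slit (l + a), sinhMap l a (φ w) = w
  ofReal_im : ∀ x : ℝ, l + a < x → (φ x).im = 0
  im_mul_pos : ∀ w : ℂ, w.im ≠ 0 → 0 < w.im * (φ w).im
  left_inv : ∀ z : ℂ, 0 < z.re → |z.im| < Real.pi → φ (sinhMap l a z) = z
  norm_lt : ∀ M ≥ M₀, ∀ w ∈ slit (l + a), ‖w‖ < M → ‖φ w‖ < M

theorem exists_isSlitSection (hl : 0 < l) (a : ℝ) : ∃ φ M₀, IsSlitSection l a φ M₀ := by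
  obtain ⟨φ, h1, h2, h3, h4, h5, M₀, h6⟩ := exists_slit_section hl a
  exact ⟨φ, M₀, h1, fun w hw => (h2 w hw).1, fun w hw => (h2 w hw).2, h3, h4, h5, h6⟩

/-- Iterated inverse branches, with prescribed signs of the real part. -/
noncomputable def pullback (φ : ℂ → ℂ) (s : ℕ → ℝ) : ℕ → ℂ → ℂ
  | 0 => id
  | k + 1 => fun w => s k * φ (pullback φ s k w)

/-- The first `k` inverse branches do not meet the critical value on the interval `(t, e)`. -/
def Unobstructed (c : ℝ) (φ : ℂ → ℂ) (s : ℕ → ℝ) (t e : ℝ) (k : ℕ) : Prop :=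
  ∀ i < k, ∀ x : ℝ, t < x → x < e → c < (pullback φ s i x).re

/-- A sequence of signs. -/
def IsSign (s : ℕ → ℝ) : Prop := ∀ k, s k = 1 ∨ s k = -1

variable {s : ℕ → ℝ}

theorem IsSign.ne_zero (hs : IsSign s) (k : ℕ) : s k ≠ 0 := by
  rcases hs k with h | h <;> rw [h] <;> norm_num

theorem IsSign.abs_eq (hs : IsSign s) (k : ℕ) : |s k| = 1 := by
  rcases hs k with h | h <;> rw [h] <;> norm_num

theorem IsSign.sinhMap_mul (hs : IsSign s) (k : ℕ) (z : ℂ) :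
    sinhMap l a (s k * z) = sinhMap l a z := by
  rcases hs k with h | h <;> rw [h] <;> simp [sinhMap_neg]

theorem IsSlitSection.pullback_im_ne_zero (h : IsSlitSection l a φ M₀) (hs : IsSign s) {w : ℂ}
    (hw : w.im ≠ 0) (k : ℕ) : (pullback φ s k w).im ≠ 0 := by
  induction k with
  | zero => exact hw
  | succ k ih =>
    simp only [pullback, Complex.im_ofReal_mul]
    refine mul_ne_zero (hs.ne_zero k) fun h0 => ?_
    have := h.im_mul_pos _ ih
    rw [h0] at this; simp at this

variable {t e : ℝ} {k : ℕ}

theorem Unobstructed.mono {c : ℝ} {j : ℕ} (hU : Unobstructed c φ s t e k) (hjk : j ≤ k) :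
    Unobstructed c φ s t e j := fun i hi => hU i (hi.trans_le hjk)

theorem Unobstructed.mem_slit (h : IsSlitSection l a φ M₀) (hs : IsSign s)
    (hU : Unobstructed (l + a) φ s t e k) {i : ℕ} (hi : i < k) {w : ℂ}
    (hw : w ∈ slitInterval t e) : pullback φ s i w ∈ slit (l + a) := by
  by_cases h0 : w.im = 0
  · right
    have : w = (w.re : ℂ) := by apply Complex.ext <;> simp [h0]
    rw [this]
    have hw := hw.resolve_left (not_not.2 h0)
    exact hU i hi _ hw.1 hw.2
  · exact Or.inl (h.pullback_im_ne_zero hs h0 i)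

theorem Unobstructed.pullback_ofReal_im (h : IsSlitSection l a φ M₀)
    (hU : Unobstructed (l + a) φ s t e k) {x : ℝ} (hx : t < x) (hx' : x < e) :
    (pullback φ s k x).im = 0 := by
  induction k with
  | zero => simp [pullback]
  | succ k ih =>
    have h1 := ih (hU.mono k.le_succ)
    have h2 : pullback φ s k x = ((pullback φ s k x).re : ℂ) := by
      apply Complex.ext <;> simp [h1]
    simp only [pullback, Complex.im_ofReal_mul]
    rw [h2, h.ofReal_im _ (hU k k.lt_succ_self x hx hx'), mul_zero]

theorem Unobstructed.differentiableOn (h : IsSlitSection l a φ M₀) (hs : IsSign s)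
    (hU : Unobstructed (l + a) φ s t e k) :
    DifferentiableOn ℂ (pullback φ s k) (slitInterval t e) := by
  induction k with
  | zero => exact differentiableOn_id
  | succ k ih =>
    have h1 := h.differentiableOn.comp (ih (hU.mono k.le_succ))
      fun w hw => hU.mem_slit h hs k.lt_succ_self hw
    exact h1.const_mul (s k : ℂ)

theorem Unobstructed.iterate_pullback (h : IsSlitSection l a φ M₀) (hs : IsSign s)
    (hU : Unobstructed (l + a) φ s t e k) {w : ℂ} (hw : w ∈ slitInterval t e) {i j : ℕ}
    (hij : j + i ≤ k) : (sinhMap l a)^[i] (pullback φ s (j + i) w) = pullback φ s j w := by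
  induction i with
  | zero => rfl
  | succ i ih =>
    rw [Function.iterate_succ_apply, ← add_assoc]
    simp only [pullback]
    rw [hs.sinhMap_mul, h.map_eq _ (hU.mem_slit h hs (by omega) hw)]
    exact ih (by omega)

theorem Unobstructed.iterate_pullback_self (h : IsSlitSection l a φ M₀) (hs : IsSign s)
    (hU : Unobstructed (l + a) φ s t e k) {w : ℂ} (hw : w ∈ slitInterval t e) :
    (sinhMap l a)^[k] (pullback φ s k w) = w := by
  have := hU.iterate_pullback h hs hw (i := k) (j := 0) (by omega)
  simpa [pullback] using this

theorem Unobstructed.re_ne_zero (h : IsSlitSection l a φ M₀) (hs : IsSign s)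
    (hU : Unobstructed (l + a) φ s t e k) {w : ℂ} (hw : w ∈ slitInterval t e) {j : ℕ}
    (hj : j < k) : (pullback φ s (j + 1) w).re ≠ 0 := by
  simp only [pullback, Complex.re_ofReal_mul]
  exact mul_ne_zero (hs.ne_zero j) (h.re_pos _ (hU.mem_slit h hs hj hw)).ne'

theorem Unobstructed.iterate_re_ne_zero (h : IsSlitSection l a φ M₀) (hs : IsSign s)
    (hU : Unobstructed (l + a) φ s t e k) {w : ℂ} (hw : w ∈ slitInterval t e) {i : ℕ}
    (hi : i < k) : ((sinhMap l a)^[i] (pullback φ s k w)).re ≠ 0 := by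
  have h1 := hU.iterate_pullback h hs hw (i := i) (j := k - i) (by omega)
  rw [Nat.sub_add_cancel hi.le] at h1
  rw [h1, show k - i = k - i - 1 + 1 by omega]
  exact hU.re_ne_zero h hs hw (by omega)

theorem IsSlitSection.pullback_iterate (h : IsSlitSection l a φ M₀) (hs : IsSign s) {y : ℂ}
    {n : ℕ} (hy : ∀ i < n, 0 < s i * ((sinhMap l a)^[n - 1 - i] y).re ∧
      |((sinhMap l a)^[n - 1 - i] y).im| < Real.pi) {j : ℕ} (hj : j ≤ n) :
    pullback φ s j ((sinhMap l a)^[n] y) = (sinhMap l a)^[n - j] y := by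
  induction j with
  | zero => rfl
  | succ j ih =>
    simp only [pullback]
    rw [ih (by omega), show n - j = n - (j + 1) + 1 by omega, Function.iterate_succ_apply']
    obtain ⟨h1, h2⟩ := hy j (by omega)
    rw [show n - 1 - j = n - (j + 1) by omega] at h1 h2
    rw [← hs.sinhMap_mul j, h.left_inv]
    · rcases hs j with h | h <;> rw [h] <;> simp
    · simpa using h1
    · simpa [abs_mul, hs.abs_eq] using h2

theorem Unobstructed.norm_pullback_lt (h : IsSlitSection l a φ M₀) (hs : IsSign s)
    (hU : Unobstructed (l + a) φ s t e k) {M : ℝ} (hM : M₀ ≤ M) {w : ℂ}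
    (hw : w ∈ slitInterval t e) (hwM : ‖w‖ < M) : ‖pullback φ s k w‖ < M := by
  induction k with
  | zero => exact hwM
  | succ k ih =>
    simp only [pullback, norm_mul, Complex.norm_real, Real.norm_eq_abs, hs.abs_eq, one_mul]
    exact h.norm_lt M hM _ (hU.mem_slit h hs k.lt_succ_self hw) (ih (hU.mono k.le_succ))

end pullback

section obstruction

theorem exists_image_Ioo_eq {F : ℝ → ℝ} {t e M : ℝ} (hte : t < e) (hF : ContinuousOn F (Ioo t e))
    (hi : InjOn F (Ioo t e)) (hM : ∀ x ∈ Ioo t e, |F x| ≤ M) :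
    ∃ u v, u < v ∧ F '' Ioo t e = Ioo u v := by
  have hm := hF.strictMonoOn_of_injOn_Ioo hte hi
  have hne : (F '' Ioo t e).Nonempty := (nonempty_Ioo.2 hte).image F
  have hba : BddAbove (F '' Ioo t e) := by
    refine ⟨M, ?_⟩
    rintro _ ⟨x, hx, rfl⟩
    exact (abs_le.1 (hM x hx)).2
  have hbb : BddBelow (F '' Ioo t e) := by
    refine ⟨-M, ?_⟩
    rintro _ ⟨x, hx, rfl⟩
    exact (abs_le.1 (hM x hx)).1
  have hoc : (F '' Ioo t e).OrdConnected := (isPreconnected_Ioo.image F hF).ordConnected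
  have hbig : ∀ x ∈ Ioo t e, (∃ x' ∈ Ioo t e, F x < F x') ∧ ∃ x' ∈ Ioo t e, F x' < F x := by
    intro x hx
    have hr : (x + e) / 2 ∈ Ioo t e := ⟨by linarith [hx.1, hx.2], by linarith [hx.1, hx.2]⟩
    have hr' : x < (x + e) / 2 := by linarith [hx.1, hx.2]
    have hl : (t + x) / 2 ∈ Ioo t e := ⟨by linarith [hx.1, hx.2], by linarith [hx.1, hx.2]⟩
    have hl' : (t + x) / 2 < x := by linarith [hx.1, hx.2]
    rcases hm with hm | hm
    · exact ⟨⟨_, hr, hm hx hr hr'⟩, ⟨_, hl, hm hl hx hl'⟩⟩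
    · exact ⟨⟨_, hl, hm hl hx hl'⟩, ⟨_, hr, hm hx hr hr'⟩⟩
  have hsub : ∀ y ∈ F '' Ioo t e, sInf (F '' Ioo t e) < y ∧ y < sSup (F '' Ioo t e) := by
    rintro _ ⟨x, hx, rfl⟩
    obtain ⟨⟨p, hp, hpx⟩, q, hq, hqx⟩ := hbig x hx
    exact ⟨(csInf_le hbb ⟨q, hq, rfl⟩).trans_lt hqx, hpx.trans_le (le_csSup hba ⟨p, hp, rfl⟩)⟩
  have ⟨y₀, hy₀⟩ := hne
  refine ⟨sInf (F '' Ioo t e), sSup (F '' Ioo t e), (hsub _ hy₀).1.trans (hsub _ hy₀).2,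
    Subset.antisymm (fun y hy => hsub y hy) ?_⟩
  intro y hy
  obtain ⟨p, hp, hpy⟩ := exists_lt_of_csInf_lt hne hy.1
  obtain ⟨q, hq, hqy⟩ := exists_lt_of_lt_csSup hne hy.2
  exact hoc.out hp hq ⟨hpy.le, hqy.le⟩

variable {l a M₀ : ℝ} {φ : ℂ → ℂ} {s : ℕ → ℝ} {t e : ℝ} {k : ℕ}

theorem Unobstructed.ofReal_re (h : IsSlitSection l a φ M₀)
    (hU : Unobstructed (l + a) φ s t e k) {x : ℝ} (hx : x ∈ Ioo t e) :
    (((pullback φ s k x).re : ℝ) : ℂ) = pullback φ s k x := by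
  apply Complex.ext <;> simp [hU.pullback_ofReal_im h hx.1 hx.2]

theorem Unobstructed.realMap_iterate (h : IsSlitSection l a φ M₀) (hs : IsSign s)
    (hU : Unobstructed (l + a) φ s t e k) {x : ℝ} (hx : x ∈ Ioo t e) :
    (realMap l a)^[k] (pullback φ s k x).re = x ∧
      ∀ i < k, (realMap l a)^[i] (pullback φ s k x).re ≠ 0 := by
  have hm : (x : ℂ) ∈ slitInterval t e := ofReal_mem_slitInterval.2 hx
  constructor
  · have := hU.iterate_pullback_self h hs hm
    rw [← hU.ofReal_re h hx, iterate_sinhMap_ofReal] at this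
    exact_mod_cast this
  · intro i hi
    have := hU.iterate_re_ne_zero h hs hm hi
    rw [← hU.ofReal_re h hx, iterate_sinhMap_ofReal, Complex.ofReal_re] at this
    exact this

theorem Unobstructed.exists_image_Ioo (h : IsSlitSection l a φ M₀) (hs : IsSign s)
    (hU : Unobstructed (l + a) φ s t e k) (hte : t < e) :
    ∃ u v, u < v ∧ (fun x : ℝ => (pullback φ s k x).re) '' Ioo t e = Ioo u v ∧
      MapsTo (pullback φ s k) (slitInterval t e) (slitInterval u v) := by
  have hc : ContinuousOn (fun x : ℝ => (pullback φ s k x).re) (Ioo t e) :=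
    Complex.continuous_re.comp_continuousOn ((hU.differentiableOn h hs).continuousOn.comp
      Complex.continuous_ofReal.continuousOn fun x hx => ofReal_mem_slitInterval.2 hx)
  have hi : InjOn (fun x : ℝ => (pullback φ s k x).re) (Ioo t e) := by
    intro x hx y hy hxy
    have h1 := (hU.realMap_iterate h hs hx).1
    have h2 := (hU.realMap_iterate h hs hy).1
    simp only at hxy
    rw [← h1, hxy, h2]
  have hM : ∀ x ∈ Ioo t e, |(pullback φ s k x).re| ≤ max M₀ (|t| + |e| + 1) := by
    intro x hx
    refine (Complex.abs_re_le_norm _).trans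
      (hU.norm_pullback_lt h hs (le_max_left _ _) (ofReal_mem_slitInterval.2 hx) ?_).le
    refine lt_max_of_lt_right ?_
    rw [Complex.norm_real, Real.norm_eq_abs, abs_lt]
    constructor
    · have := neg_abs_le t; have := abs_nonneg e; linarith [hx.1]
    · have := le_abs_self e; have := abs_nonneg t; linarith [hx.2]
  obtain ⟨u, v, huv, himg⟩ := exists_image_Ioo_eq hte hc hi hM
  refine ⟨u, v, huv, himg, ?_⟩
  intro w hw
  by_cases h0 : w.im = 0
  · have hw' := hw.resolve_left (not_not.2 h0)
    have : w = (w.re : ℂ) := by apply Complex.ext <;> simp [h0]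
    right
    rw [this]
    have : (pullback φ s k (w.re : ℂ)).re ∈ Ioo u v := himg ▸ ⟨w.re, hw', rfl⟩
    exact this
  · exact Or.inl (h.pullback_im_ne_zero hs h0 k)

/-- The signs of the real parts along the orbit of `y`, in reverse order starting from time `n`. -/
noncomputable def orbitSign (l a : ℝ) (y : ℂ) (n i : ℕ) : ℝ :=
  if 0 < ((sinhMap l a)^[n - 1 - i] y).re then 1 else -1

theorem isSign_orbitSign (y : ℂ) (n : ℕ) : IsSign (orbitSign l a y n) := by
  intro k
  unfold orbitSign
  split_ifs <;> simp

theorem orbitSign_mul_pos {y : ℂ} {n i : ℕ} (h : ((sinhMap l a)^[n - 1 - i] y).re ≠ 0) :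
    0 < orbitSign l a y n i * ((sinhMap l a)^[n - 1 - i] y).re := by
  unfold orbitSign
  split_ifs with h1
  · simpa using h1
  · have := lt_of_le_of_ne (not_lt.1 h1) h
    linarith

theorem pullback_orbitSign (h : IsSlitSection l a φ M₀) {y : ℂ} {n : ℕ}
    (hy : ∀ i < n, ((sinhMap l a)^[i] y).re ≠ 0 ∧ |((sinhMap l a)^[i] y).im| < Real.pi) {j : ℕ}
    (hj : j ≤ n) :
    pullback φ (orbitSign l a y n) j ((sinhMap l a)^[n] y) = (sinhMap l a)^[n - j] y :=
  h.pullback_iterate (isSign_orbitSign y n)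
    (fun i hi => ⟨orbitSign_mul_pos (hy _ (by omega)).1, (hy _ (by omega)).2⟩) hj

theorem exists_first_obstruction {c : ℝ} {n : ℕ} (hn : ¬Unobstructed c φ s t e n) :
    ∃ k < n, Unobstructed c φ s t e k ∧
      ∃ x : ℝ, t < x ∧ x < e ∧ (pullback φ s k x).re ≤ c := by
  induction n with
  | zero => exact absurd (fun i hi => absurd hi (Nat.not_lt_zero i)) hn
  | succ n ih =>
    by_cases h : Unobstructed c φ s t e n
    · refine ⟨n, n.lt_succ_self, h, ?_⟩
      by_contra hcon
      push Not at hcon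
      refine hn fun i hi => ?_
      rcases (Nat.lt_succ_iff.1 hi).eq_or_lt with rfl | hi
      · exact hcon
      · exact h i hi
    · obtain ⟨k, hk, hobs⟩ := ih h
      exact ⟨k, hk.trans n.lt_succ_self, hobs⟩

/-- If pulling back along an orbit is obstructed by the critical value, then iterates of a real
neighbourhood of the critical value return to the given interval. -/
theorem obstruction (h : IsSlitSection l a φ M₀) {y : ℂ} {n : ℕ} {κ : ℝ} (hκ : 0 ≤ κ)
    (hy : ∀ i ≤ n, ((sinhMap l a)^[i] y).im ≠ 0 ∧ ((sinhMap l a)^[i] y).re ≠ 0 ∧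
      |((sinhMap l a)^[i] y).im| < Real.pi) (hte : t < e)
    (hlens : κ * |((sinhMap l a)^[n] y).im| * (e - t) + ((sinhMap l a)^[n] y).im ^ 2 ≤
      (((sinhMap l a)^[n] y).re - t) * (e - ((sinhMap l a)^[n] y).re))
    (hU : ¬Unobstructed (l + a) φ (orbitSign l a y n) t e n) :
    ∃ k < n, ∀ x : ℝ, l + a ≤ x →
      x < ((sinhMap l a)^[n - k] y).re + κ * |((sinhMap l a)^[n - k] y).im| →
      (realMap l a)^[k] x ∈ Ioo t e ∧ ∀ i < k, (realMap l a)^[i] x ≠ 0 := by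
  obtain ⟨k, hk, hUk, x₀, hx₀, hx₀', hle⟩ := exists_first_obstruction hU
  have hs := isSign_orbitSign (l := l) (a := a) y n
  obtain ⟨u, v, huv, himg, hmaps⟩ := hUk.exists_image_Ioo h hs hte
  refine ⟨k, hk, fun x hx hx' => ?_⟩
  have hpb := pullback_orbitSign h (fun i hi => (hy i hi.le).2) hk.le
  have hang := lens_angle hte (hUk.differentiableOn h hs) hmaps
    (fun x hx hx' => hUk.pullback_ofReal_im h hx hx') (hy n le_rfl).1 hκ hlens
  rw [hpb] at hang
  set w := (sinhMap l a)^[n - k] y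
  have hwim : 0 < |w.im| := abs_pos.2 (hy (n - k) (by omega)).1
  have hsq : 0 < w.im ^ 2 := by rw [← sq_abs]; positivity
  have hvu : 0 < v - u := by linarith
  have hpos : 0 < (w.re - u) * (v - w.re) := by
    have : 0 ≤ κ * |w.im| * (v - u) := by positivity
    linarith
  have hb : 0 < w.re - u ∧ 0 < v - w.re := by
    rcases pos_and_pos_or_neg_and_neg_of_mul_pos hpos with h | h
    · exact h
    · linarith [h.1, h.2]
  have hv : κ * |w.im| ≤ v - w.re := by
    have h1 : κ * |w.im| * (w.re - u) ≤ κ * |w.im| * (v - u) := by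
      have : 0 ≤ κ * |w.im| := by positivity
      gcongr
      linarith [hb.2]
    refine le_of_mul_le_mul_left (a := w.re - u) ?_ hb.1
    linarith
  have hu : u < l + a := by
    have : (pullback φ (orbitSign l a y n) k x₀).re ∈ Ioo u v := himg ▸ ⟨x₀, ⟨hx₀, hx₀'⟩, rfl⟩
    exact this.1.trans_le hle
  have hxm : x ∈ Ioo u v := ⟨by linarith, by linarith⟩
  rw [← himg] at hxm
  obtain ⟨τ, hτ, rfl⟩ := hxm
  have := hUk.realMap_iterate h hs hτ
  simp only
  rw [this.1]
  exact ⟨hτ, this.2⟩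

end obstruction

section tame
variable {l a : ℝ} {W : Set ℂ} {w : ℂ}

/-- Some disc about `w` lies in an image of `W`, and its iterates avoid the real axis. -/
def IsTame (f : ℂ → ℂ) (W : Set ℂ) (w : ℂ) : Prop :=
  ∃ ρ > 0, ∃ N, ball w ρ ⊆ f^[N] '' W ∧ ∀ y ∈ ball w ρ, ∀ n, (f^[n] y).im ≠ 0

theorem IsTame.map {f : ℂ → ℂ} (hf : IsOpenMap f) (h : IsTame f W w) : IsTame f W (f w) := by
  obtain ⟨ρ, hρ, N, hN, hn⟩ := h
  obtain ⟨ρ', hρ', hsub⟩ := Metric.isOpen_iff.1 (hf _ (isOpen_ball (x := w) (ε := ρ))) (f w)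
    ⟨w, mem_ball_self hρ, rfl⟩
  refine ⟨ρ', hρ', N + 1, ?_, ?_⟩
  · intro y hy
    obtain ⟨x, hx, rfl⟩ := hsub hy
    obtain ⟨v, hv, rfl⟩ := hN hx
    exact ⟨v, hv, Function.iterate_succ_apply' _ _ _⟩
  · intro y hy n
    obtain ⟨x, hx, rfl⟩ := hsub hy
    rw [← Function.iterate_succ_apply]
    exact hn x hx _

theorem IsTame.iterate {f : ℂ → ℂ} (hf : IsOpenMap f) (h : IsTame f W w) (n : ℕ) :
    IsTame f W (f^[n] w) := by
  induction n with
  | zero => exact h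
  | succ n ih => rw [Function.iterate_succ_apply']; exact ih.map hf

theorem IsTame.im_ne_zero {f : ℂ → ℂ} (h : IsTame f W w) (n : ℕ) : (f^[n] w).im ≠ 0 := by
  obtain ⟨ρ, hρ, N, hN, hn⟩ := h
  exact hn w (mem_ball_self hρ) n

theorem differentiable_iterate {f : ℂ → ℂ} (hf : Differentiable ℂ f) (n : ℕ) :
    Differentiable ℂ f^[n] := by
  induction n with
  | zero => exact differentiable_id
  | succ n ih => rw [Function.iterate_succ']; exact hf.comp ih

theorem deriv_iterate_succ {f : ℂ → ℂ} (hf : Differentiable ℂ f) (n : ℕ) (z : ℂ) :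
    deriv f^[n + 1] z = deriv f (f^[n] z) * deriv f^[n] z := by
  rw [Function.iterate_succ']
  exact deriv_comp z (hf _) (differentiable_iterate hf n z)

theorem IsTame.exists_norm_deriv_le {f : ℂ → ℂ} (hf : Differentiable ℂ f) (h : IsTame f W w) :
    ∃ ρ > 0, ∀ n, ‖deriv f^[n] w‖ * ρ ≤ 2 * |(f^[n] w).im| := by
  obtain ⟨ρ, hρ, N, hN, hn⟩ := h
  refine ⟨ρ, hρ, fun n => ?_⟩
  have hd := differentiable_iterate hf n
  obtain ⟨τ, hτ, hpos⟩ : ∃ τ : ℝ, |τ| = 1 ∧ 0 < τ * (f^[n] w).im := by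
    rcases lt_or_gt_of_ne (hn w (mem_ball_self hρ) n) with h | h
    · exact ⟨-1, by simp, by linarith⟩
    · exact ⟨1, by simp, by linarith⟩
  have hτ0 : τ ≠ 0 := by rintro rfl; simp at hτ
  have hall : ∀ y ∈ ball w ρ, 0 < τ * (f^[n] y).im := by
    refine (convex_ball w ρ).isPreconnected.pos_of_ne_zero (p := fun y => τ * (f^[n] y).im) ?_
      (fun y hy => mul_ne_zero hτ0 (hn y hy n)) (mem_ball_self hρ) hpos
    exact (continuous_const.mul (Complex.continuous_im.comp hd.continuous)).continuousOn
  set ψ : ℂ → ℂ := fun y => (-Complex.I * τ) * f^[n] y with hψ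
  have hre : ∀ y, (ψ y).re = τ * (f^[n] y).im := by intro y; simp [hψ]
  have h1 := schwarz_ball_halfPlane_deriv (φ := ψ) (c := w) hρ (hd.differentiableOn.const_mul _)
    (fun y hy => by rw [hre]; exact hall y hy)
  have h2 : deriv ψ w = (-Complex.I * τ) * deriv f^[n] w := deriv_const_mul _ (hd w)
  rw [hre, h2] at h1
  simp only [norm_mul, norm_neg, Complex.norm_I, Complex.norm_real, Real.norm_eq_abs, hτ,
    one_mul] at h1
  rwa [← abs_of_pos hpos, abs_mul, hτ, one_mul] at h1

theorem abs_sq_le_sinh {x : ℝ} : x ^ 2 / 4 ≤ |Real.sinh x| := by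
  have key : ∀ x : ℝ, 0 ≤ x → x ^ 2 / 4 ≤ Real.sinh x := by
    intro x hx
    have h1 := Real.quadratic_le_exp_of_nonneg hx
    have h2 : Real.exp (-x) ≤ 1 := Real.exp_le_one_iff.2 (by linarith)
    rw [Real.sinh_eq]
    linarith
  rw [Real.abs_sinh, ← sq_abs]
  exact key _ (abs_nonneg x)

theorem exists_norm_le_deriv (hl : 0 < l) (a : ℝ) : ∃ X > 0, ∀ z : ℂ, X ≤ |z.re| →
    |z.im| ≤ |z.re| → ‖sinhMap l a z‖ ≤ 6 * ‖deriv (sinhMap l a) z‖ := by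
  refine ⟨max 4 (8 * |a| / l), by positivity, fun z hX hz => ?_⟩
  have h4 : 4 ≤ |z.re| := (le_max_left _ _).trans hX
  have h8 : 8 * |a| / l ≤ |z.re| := (le_max_right _ _).trans hX
  rw [div_le_iff₀ hl] at h8
  have hzn : |z.re| ≤ ‖z‖ := Complex.abs_re_le_norm z
  have hzn' : ‖z‖ ≤ 2 * |z.re| := (Complex.norm_le_abs_re_add_abs_im z).trans (by linarith)
  have hz0 : z ≠ 0 := by rintro rfl; simp at h4; linarith
  have hzpos : 0 < ‖z‖ := norm_pos_iff.2 hz0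
  set S := |Real.sinh z.re| with hS
  have hS4 : z.re ^ 2 / 4 ≤ S := abs_sq_le_sinh
  rw [← sq_abs] at hS4
  have hS1 : 4 ≤ S := by nlinarith
  have hch : Real.cosh z.re ≤ 2 * S := by
    have h1 := Real.cosh_sq z.re
    have h2 : S ^ 2 = Real.sinh z.re ^ 2 := sq_abs _
    nlinarith [Real.cosh_pos z.re]
  have hcosh : S ≤ ‖Complex.cosh z‖ := by
    refine le_of_sq_le_sq ?_ (norm_nonneg _)
    rw [← Complex.normSq_eq_norm_sq, normSq_cosh, sq_abs]
    nlinarith [sq_nonneg (Real.cos z.im)]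
  have hsinh : ‖Complex.sinh z‖ ≤ 2 * S := by
    refine le_trans ?_ hch
    refine le_of_sq_le_sq ?_ (Real.cosh_pos _).le
    rw [← Complex.normSq_eq_norm_sq, normSq_sinh, Real.cosh_sq]
    nlinarith [Real.sin_sq_le_one z.im]
  have hd : l * S / 2 ≤ ‖deriv (sinhMap l a) z‖ * ‖z‖ := by
    rw [deriv_sinhMap hz0, norm_div, norm_mul, norm_pow, Complex.norm_real, Real.norm_eq_abs,
      abs_of_pos hl]
    have h1 : ‖z‖ * S - 2 * S ≤ ‖z * Complex.cosh z - Complex.sinh z‖ := by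
      have := norm_sub_norm_le (z * Complex.cosh z) (Complex.sinh z)
      rw [norm_mul] at this
      have h2 : ‖z‖ * S ≤ ‖z‖ * ‖Complex.cosh z‖ := by gcongr
      linarith
    have h2 : ‖z‖ * S / 2 ≤ ‖z * Complex.cosh z - Complex.sinh z‖ := by nlinarith
    have e : l * ‖z * Complex.cosh z - Complex.sinh z‖ / ‖z‖ ^ 2 * ‖z‖ =
      l * ‖z * Complex.cosh z - Complex.sinh z‖ / ‖z‖ := by field_simp
    rw [e, le_div_iff₀ hzpos]
    calc l * S / 2 * ‖z‖ = l * (‖z‖ * S / 2) := by ring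
      _ ≤ _ := by gcongr
  have hf : ‖sinhMap l a z‖ * ‖z‖ ≤ 3 * (l * S) := by
    rw [sinhMap_of_ne hz0, ← norm_mul, add_mul, div_mul_cancel₀ _ hz0]
    refine (norm_add_le _ _).trans ?_
    rw [norm_mul, norm_mul, Complex.norm_real, Complex.norm_real, Real.norm_eq_abs,
      Real.norm_eq_abs, abs_of_pos hl]
    have h1 : l * ‖Complex.sinh z‖ ≤ l * (2 * S) := by gcongr
    have h2 : |a| * ‖z‖ ≤ |a| * (2 * |z.re|) := by gcongr
    have h3 : |a| * (2 * |z.re|) ≤ l * S := by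
      have : l * (|z.re| ^ 2 / 4) ≤ l * S := by gcongr
      nlinarith [abs_nonneg z.re]
    linarith
  refine le_of_mul_le_mul_right (a := ‖z‖) ?_ hzpos
  linarith

end tame

section asymptotics
variable {l a : ℝ} {W : Set ℂ} {w : ℂ}

theorem IsTame.re_ne_zero (h : IsTame (sinhMap l a) W w) (n : ℕ) :
    ((sinhMap l a)^[n] w).re ≠ 0 := by
  have := h.im_ne_zero (n + 1)
  rw [Function.iterate_succ_apply'] at this
  exact re_ne_zero_of_sinhMap this

/-- The ratio of the imaginary and the real part along an orbit. -/
noncomputable def orbitSlope (l a : ℝ) (w : ℂ) (n : ℕ) : ℝ :=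
  |((sinhMap l a)^[n] w).im| / |((sinhMap l a)^[n] w).re|

theorem IsTame.derivRatio (hl : 0 < l) (h : IsTame (sinhMap l a) W w) :
    Summable (fun n => orbitSlope l a w n ^ 2) ∧ ∃ K > 0, ∀ n,
      ‖deriv (sinhMap l a) ((sinhMap l a)^[n] w)‖ * |((sinhMap l a)^[n] w).im| ≤
        K * |((sinhMap l a)^[n + 1] w).im| := by
  have hf : Differentiable ℂ (sinhMap l a) := differentiable_sinhMap
  obtain ⟨ρ, hρ, hD⟩ := h.exists_norm_deriv_le hf
  have hY : ∀ n, 0 < |((sinhMap l a)^[n] w).im| := fun n => abs_pos.2 (h.im_ne_zero n)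
  have hX : ∀ n, 0 < |((sinhMap l a)^[n] w).re| := fun n => abs_pos.2 (h.re_ne_zero n)
  set D : ℕ → ℝ := fun n => ‖deriv (sinhMap l a)^[n] w‖ / |((sinhMap l a)^[n] w).im| with hDdef
  have hD2 : ∀ n, D n ≤ 2 / ρ := fun n => by
    rw [hDdef]; simp only
    rw [div_le_div_iff₀ (hY n) hρ]; exact hD n
  have hDs : ∀ n, D (n + 1) * |((sinhMap l a)^[n + 1] w).im| =
      ‖deriv (sinhMap l a) ((sinhMap l a)^[n] w)‖ * |((sinhMap l a)^[n] w).im| * D n := by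
    intro n
    simp only [hDdef]
    rw [div_mul_cancel₀ _ (hY _).ne', deriv_iterate_succ hf, norm_mul]
    field_simp [(hY n).ne']
  have hD0 : 0 < D 0 := by
    simp only [hDdef, Function.iterate_zero, deriv_id, norm_one]
    exact div_pos (by simp) (hY 0)
  have hDnn : ∀ n, 0 ≤ D n := fun n => div_nonneg (norm_nonneg _) (abs_nonneg _)
  have hstep : ∀ n, D n ^ 2 * (1 + orbitSlope l a w n ^ 2) ≤ D (n + 1) ^ 2 := by
    intro n
    have h1 : ‖(sinhMap l a)^[n] w‖ * D n ≤ D (n + 1) * |((sinhMap l a)^[n] w).re| := by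
      have h2 := norm_mul_im_le_deriv hl (z := (sinhMap l a)^[n] w)
        (by rw [← Function.iterate_succ_apply' (sinhMap l a)]; exact h.im_ne_zero _)
      rw [← Function.iterate_succ_apply' (sinhMap l a)] at h2
      refine le_of_mul_le_mul_right ?_ (hY (n + 1))
      calc _ = ‖(sinhMap l a)^[n] w‖ * |((sinhMap l a)^[n + 1] w).im| * D n := by ring
        _ ≤ _ * D n := mul_le_mul_of_nonneg_right h2 (hDnn n)
        _ = (‖deriv (sinhMap l a) ((sinhMap l a)^[n] w)‖ * |((sinhMap l a)^[n] w).im| * D n) *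
          |((sinhMap l a)^[n] w).re| := by ring
        _ = _ := by rw [← hDs]; ring
    have h3 := pow_le_pow_left₀ (mul_nonneg (norm_nonneg _) (hDnn n)) h1 2
    rw [mul_pow, mul_pow, ← Complex.normSq_eq_norm_sq, Complex.normSq_apply, sq_abs] at h3
    unfold orbitSlope
    have hx : ((sinhMap l a)^[n] w).re ≠ 0 := h.re_ne_zero n
    rw [div_pow (|((sinhMap l a)^[n] w).im|), sq_abs, sq_abs]
    have hx2 : 0 < ((sinhMap l a)^[n] w).re ^ 2 := by positivity
    refine le_of_mul_le_mul_right (le_trans (le_of_eq ?_) h3) hx2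
    field_simp
  have hmono : ∀ n, D 0 ≤ D n := by
    intro n
    induction n with
    | zero => exact le_rfl
    | succ n ih =>
      refine ih.trans (le_of_sq_le_sq ?_ (hDnn _))
      nlinarith [hstep n, sq_nonneg (D n * orbitSlope l a w n)]
  constructor
  · have : Summable fun n => D 0 ^ 2 * orbitSlope l a w n ^ 2 := by
      refine summable_of_sum_range_le (c := (2 / ρ) ^ 2) (fun n => by positivity) fun n => ?_
      have : ∑ i ∈ Finset.range n, D 0 ^ 2 * orbitSlope l a w i ^ 2 ≤ D n ^ 2 - D 0 ^ 2 := by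
        induction n with
        | zero => simp
        | succ n ih =>
          rw [Finset.sum_range_succ]
          have h2 : D 0 ^ 2 * orbitSlope l a w n ^ 2 ≤ D n ^ 2 * orbitSlope l a w n ^ 2 := by
            gcongr; exact hmono n
          linarith [hstep n]
      have h3 : D n ^ 2 ≤ (2 / ρ) ^ 2 := pow_le_pow_left₀ (hDnn n) (hD2 n) 2
      linarith [sq_nonneg (D 0)]
    exact (summable_mul_left_iff (pow_ne_zero 2 hD0.ne')).1 this
  · refine ⟨2 / ρ / D 0, by positivity, fun n => ?_⟩
    rw [div_mul_eq_mul_div, le_div_iff₀ hD0]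
    calc _ ≤ ‖deriv (sinhMap l a) ((sinhMap l a)^[n] w)‖ * |((sinhMap l a)^[n] w).im| * D n := by
          gcongr; exact hmono n
      _ = D (n + 1) * |((sinhMap l a)^[n + 1] w).im| := (hDs n).symm
      _ ≤ _ := by gcongr; exact hD2 _

theorem IsTame.tendsto_orbitSlope (hl : 0 < l) (h : IsTame (sinhMap l a) W w) :
    Tendsto (orbitSlope l a w) atTop (𝓝 0) := by
  have := (h.derivRatio hl).1.tendsto_atTop_zero.sqrt
  simpa [Real.sqrt_sq (show 0 ≤ orbitSlope l a w _ from div_nonneg (abs_nonneg _) (abs_nonneg _))]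
    using this

theorem IsTame.asymptotics (hl : 0 < l) (h : IsTame (sinhMap l a) W w) :
    Tendsto (fun n => |((sinhMap l a)^[n] w).im|) atTop (𝓝 0) ∧
      ∃ Xs > 0, ∀ᶠ n in atTop, |((sinhMap l a)^[n] w).re| < Xs := by
  obtain ⟨K, hK, hKn⟩ := (h.derivRatio hl).2
  obtain ⟨Xb, hXb, hb⟩ := exists_norm_le_deriv hl a
  obtain ⟨Xg, hXg, hg⟩ := exists_growth hl a 1
  have hY : ∀ n, 0 < |((sinhMap l a)^[n] w).im| := fun n => abs_pos.2 (h.im_ne_zero n)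
  have hX : ∀ n, 0 < |((sinhMap l a)^[n] w).re| := fun n => abs_pos.2 (h.re_ne_zero n)
  have ht := h.tendsto_orbitSlope hl
  have ht0 : ∀ n, 0 ≤ orbitSlope l a w n := fun n => div_nonneg (abs_nonneg _) (abs_nonneg _)
  have hYt : ∀ n, |((sinhMap l a)^[n] w).im| = orbitSlope l a w n * |((sinhMap l a)^[n] w).re| :=
    fun n => by unfold orbitSlope; rw [div_mul_cancel₀ _ (hX n).ne']
  have hbig : ∀ n, orbitSlope l a w n ≤ 1 → Xb ≤ |((sinhMap l a)^[n] w).re| →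
      |((sinhMap l a)^[n] w).im| ≤ 6 * K * orbitSlope l a w (n + 1) := by
    intro n hn hXn
    have h1 := hb _ hXn (by rw [hYt]; nlinarith [hX n])
    rw [← Function.iterate_succ_apply' (sinhMap l a)] at h1
    have h2 : |((sinhMap l a)^[n + 1] w).re| ≤ 6 * ‖deriv (sinhMap l a) ((sinhMap l a)^[n] w)‖ :=
      (Complex.abs_re_le_norm _).trans h1
    refine le_of_mul_le_mul_right (a := |((sinhMap l a)^[n + 1] w).re|) ?_ (hX _)
    rw [mul_assoc _ (orbitSlope l a w (n + 1)), ← hYt]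
    calc _ ≤ |((sinhMap l a)^[n] w).im| *
          (6 * ‖deriv (sinhMap l a) ((sinhMap l a)^[n] w)‖) := by gcongr
      _ = 6 * (‖deriv (sinhMap l a) ((sinhMap l a)^[n] w)‖ * |((sinhMap l a)^[n] w).im|) := by ring
      _ ≤ 6 * (K * |((sinhMap l a)^[n + 1] w).im|) := by linarith [hKn n]
      _ = _ := by ring
  have hY0 : Tendsto (fun n => |((sinhMap l a)^[n] w).im|) atTop (𝓝 0) := by
    have hlim : Tendsto (fun n => Xb * orbitSlope l a w n + 6 * K * orbitSlope l a w (n + 1)) atTop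
        (𝓝 0) := by
      have := (ht.const_mul Xb).add (((tendsto_add_atTop_iff_nat 1).2 ht).const_mul (6 * K))
      simpa using this
    refine tendsto_of_tendsto_of_tendsto_of_le_of_le' tendsto_const_nhds hlim
      (Eventually.of_forall fun n => abs_nonneg _) ?_
    filter_upwards [ht.eventually_le_const (show (0 : ℝ) < 1 by norm_num)] with n hn
    have h1 : 0 ≤ Xb * orbitSlope l a w n := mul_nonneg hXb.le (ht0 n)
    have h2 : 0 ≤ 6 * K * orbitSlope l a w (n + 1) := mul_nonneg (by positivity) (ht0 _)
    by_cases hc : Xb ≤ |((sinhMap l a)^[n] w).re|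
    · linarith [hbig n hn hc]
    · rw [hYt n]
      nlinarith [ht0 n, not_le.1 hc]
  refine ⟨hY0, max (max Xb Xg) (6 * K), by positivity, ?_⟩
  set Xs := max (max Xb Xg) (6 * K)
  have hs1 : Xb ≤ Xs := (le_max_left _ _).trans (le_max_left _ _)
  have hs2 : Xg ≤ Xs := (le_max_right _ _).trans (le_max_left _ _)
  have hs3 : 6 * K ≤ Xs := le_max_right _ _
  obtain ⟨n0, hn0⟩ := eventually_atTop.1 ((ht.eventually_le_const
    (show (0 : ℝ) < 1 by norm_num)).and (hY0.eventually_le_const (show (0 : ℝ) < 1 by norm_num)))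
  refine eventually_atTop.2 ⟨n0, fun n hn => ?_⟩
  by_contra hcon
  rw [not_lt] at hcon
  have hall : ∀ m ≥ n, Xs ≤ |((sinhMap l a)^[m] w).re| := by
    intro m hm
    induction m, hm using Nat.le_induction with
    | base => exact hcon
    | succ m hm ih =>
      have h1 := hg ((sinhMap l a)^[m] w) (hn0 m (hn.trans hm)).2
        (hs2.trans (ih.trans (Complex.abs_re_le_norm _)))
      rw [← Function.iterate_succ_apply' (sinhMap l a)] at h1
      have h2 := Complex.norm_le_abs_re_add_abs_im ((sinhMap l a)^[m + 1] w)
      have h3 := Complex.abs_re_le_norm ((sinhMap l a)^[m] w)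
      linarith [(hn0 (m + 1) (by omega)).2]
  have hYm : ∀ m ≥ n, |((sinhMap l a)^[n] w).im| ≤ |((sinhMap l a)^[m] w).im| := by
    intro m hm
    induction m, hm using Nat.le_induction with
    | base => exact le_rfl
    | succ m hm ih =>
      refine ih.trans ((hbig m (hn0 m (hn.trans hm)).1 (hs1.trans (hall m hm))).trans ?_)
      rw [hYt (m + 1)]
      have := hall (m + 1) (by omega)
      nlinarith [ht0 (m + 1)]
  have := ge_of_tendsto hY0 (eventually_atTop.2 ⟨n, hYm⟩)
  linarith [hY n]

end asymptotics

section shadow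
variable {l a : ℝ} {w : ℂ}

theorem exists_taylor_bound {f : ℂ → ℂ} (hf : Differentiable ℂ f) (R : ℝ) :
    ∃ C > 0, ∀ z h : ℂ, ‖z‖ ≤ R → ‖z + h‖ ≤ R → ‖f (z + h) - f z - h * deriv f z‖ ≤ C * ‖h‖ ^ 2 := by
  have hd : Differentiable ℂ (deriv f) := hf.deriv
  have hdd : Continuous (deriv (deriv f)) := hd.deriv.continuous
  obtain ⟨C, hC⟩ := (isCompact_closedBall (0 : ℂ) R).exists_bound_of_continuousOn hdd.continuousOn
  refine ⟨max C 1, by positivity, fun z h hz hzh => ?_⟩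
  set s := closedBall (0 : ℂ) R ∩ closedBall z ‖h‖
  have hs : Convex ℝ s := (convex_closedBall _ _).inter (convex_closedBall _ _)
  have hz1 : z ∈ closedBall (0 : ℂ) R := by simpa using hz
  have hlip : ∀ u ∈ s, ‖deriv f u - deriv f z‖ ≤ max C 1 * ‖h‖ := by
    intro u hu
    have := (convex_closedBall (0 : ℂ) R).norm_image_sub_le_of_norm_deriv_le
      (fun x _ => hd x) (fun x hx => (hC x hx).trans (le_max_left C 1)) hz1 hu.1
    refine this.trans ?_
    gcongr
    simpa [dist_eq_norm] using hu.2
  have := hs.norm_image_sub_le_of_norm_hasDerivWithin_le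
    (f := fun u => f u - u * deriv f z) (f' := fun u => deriv f u - deriv f z)
    (fun u _ => (((hf u).hasDerivAt.sub ((hasDerivAt_id u).mul_const (deriv f z))).congr_deriv
      (by simp)).hasDerivWithinAt) hlip
    (x := z) (y := z + h) ⟨hz1, by simp⟩ ⟨by simpa using hzh, by simp⟩
  refine le_trans (le_of_eq ?_) (this.trans (le_of_eq ?_))
  · congr 1; ring
  · rw [add_sub_cancel_left]; ring

theorem sinhMap_abs_re_im (z : ℂ) :
    (sinhMap l a (⟨|z.re|, |z.im|⟩ : ℂ)).re = (sinhMap l a z).re ∧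
      |(sinhMap l a (⟨|z.re|, |z.im|⟩ : ℂ)).im| = |(sinhMap l a z).im| := by
  have key : (⟨|z.re|, |z.im|⟩ : ℂ) = z ∨ (⟨|z.re|, |z.im|⟩ : ℂ) = -z ∨
      (⟨|z.re|, |z.im|⟩ : ℂ) = (starRingEnd ℂ) z ∨
      (⟨|z.re|, |z.im|⟩ : ℂ) = -(starRingEnd ℂ) z := by
    rcases abs_choice z.re with h1 | h1 <;> rcases abs_choice z.im with h2 | h2 <;>
      rw [h1, h2] <;> simp [Complex.ext_iff]
  rcases key with h | h | h | h <;> rw [h] <;> simp [sinhMap_neg, sinhMap_conj]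

set_option maxHeartbeats 1000000 in
theorem exists_shadow (hl : 0 < l) (a : ℝ) {κ : ℝ} (hκ : 0 ≤ κ) {M : ℝ} (hM : 0 < M) :
    ∃ D ≥ 2, ∀ z : ℂ, z.re ≠ 0 → |z.re| ≤ M → |z.im| ≤ 1 → D * |z.im| ≤ |z.re| →
      |z.re| / 2 ≤ |z.re| + κ * |z.im| - D * |z.im| ^ 2 / |z.re| ∧
      realMap l a (|z.re| + κ * |z.im| - D * |z.im| ^ 2 / |z.re|) ≤
        (sinhMap l a z).re + κ * |(sinhMap l a z).im| := by
  obtain ⟨C, hC, hT⟩ := exists_taylor_bound (differentiable_sinhMap (l := l) (a := a)) (M + κ + 2)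
  set D := 2 + 3 * (C * ((κ + 1) ^ 2 + κ + 1)) / l with hD
  have hD2 : 2 ≤ D := by
    have : 0 ≤ 3 * (C * ((κ + 1) ^ 2 + κ + 1)) / l := by positivity
    linarith
  refine ⟨D, hD2, fun z hz0 hzM hz1 hzD => ?_⟩
  obtain ⟨e1, e2⟩ := sinhMap_abs_re_im (l := l) (a := a) z
  rw [← e1, ← e2]
  set x := |z.re| with hx
  set y := |z.im| with hy
  have hx0 : 0 < x := abs_pos.2 hz0
  have hy0 : 0 ≤ y := abs_nonneg _
  have hxy : 2 * y ≤ x := by nlinarith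
  have hq : D * y ^ 2 / x ≤ y := by
    rw [div_le_iff₀ hx0]; nlinarith
  have hq0 : 0 ≤ D * y ^ 2 / x := by positivity
  have hκy : 0 ≤ κ * y := by positivity
  have hκy1 : κ * y ≤ κ := by nlinarith
  set b := x + κ * y - D * y ^ 2 / x with hb
  refine ⟨by linarith, ?_⟩
  set g' := deriv (realMap l a) x with hg'
  have hder : deriv (sinhMap l a) x = (g' : ℂ) := by
    have h2 : HasDerivAt (fun t : ℝ => sinhMap l a t) (deriv (sinhMap l a) x) x :=
      (differentiable_sinhMap (x : ℂ)).hasDerivAt.comp_ofReal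
    have h3 : HasDerivAt (fun t : ℝ => ((realMap l a t : ℝ) : ℂ)) (g' : ℂ) x :=
      (differentiable_realMap x).hasDerivAt.ofReal_comp
    refine h2.unique (h3.congr_of_eventuallyEq (Eventually.of_forall fun t => ?_))
    simp [sinhMap_ofReal]
  have hg3 : l / 3 * x ≤ g' := deriv_realMap_pos hl hx0
  -- imaginary displacement
  have hA := hT x (Complex.I * y) (by rw [Complex.norm_real, Real.norm_of_nonneg hx0.le]; linarith)
    ((norm_add_le _ _).trans (by
      simp only [norm_mul, Complex.norm_I, one_mul, Complex.norm_real,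
        Real.norm_of_nonneg hx0.le, Real.norm_of_nonneg hy0]
      linarith))
  have hzz : (⟨x, y⟩ : ℂ) = x + Complex.I * y := by apply Complex.ext <;> simp
  rw [← hzz, hder, sinhMap_ofReal] at hA
  have hny : ‖Complex.I * (y : ℂ)‖ = y := by simp [abs_of_nonneg hy0]
  rw [hny] at hA
  have hAre := (Complex.abs_re_le_norm _).trans hA
  have hAim := (Complex.abs_im_le_norm _).trans hA
  simp only [Complex.sub_re, Complex.sub_im, Complex.mul_re, Complex.mul_im, Complex.I_re,
    Complex.I_im, Complex.ofReal_re, Complex.ofReal_im] at hAre hAim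
  ring_nf at hAre hAim
  -- real displacement
  have hB := hT x ((b - x : ℝ) : ℂ)
    (by rw [Complex.norm_real, Real.norm_of_nonneg hx0.le]; linarith)
    (by
      rw [← Complex.ofReal_add, Complex.norm_real, Real.norm_eq_abs, abs_le]
      constructor <;> linarith)
  rw [← Complex.ofReal_add, hder, sinhMap_ofReal, sinhMap_ofReal, ← Complex.ofReal_mul,
    ← Complex.ofReal_sub, ← Complex.ofReal_sub, Complex.norm_real, Complex.norm_real,
    Real.norm_eq_abs, Real.norm_eq_abs, sq_abs, show x + (b - x) = b by ring] at hB
  have hB1 := (abs_le.1 hB).2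
  have hbx : (b - x) ^ 2 ≤ ((κ + 1) * y) ^ 2 := by
    apply sq_le_sq'
    · have : b - x = κ * y - D * y ^ 2 / x := by rw [hb]; ring
      nlinarith
    · have : b - x = κ * y - D * y ^ 2 / x := by rw [hb]; ring
      nlinarith
  have hdrop : l / 3 * D * y ^ 2 ≤ D * y ^ 2 / x * g' := by
    calc l / 3 * D * y ^ 2 = D * y ^ 2 / x * (l / 3 * x) := by field_simp
      _ ≤ _ := by gcongr
  have hDl : C * ((κ + 1) ^ 2 + κ + 1) ≤ l / 3 * D := by
    rw [hD]
    have : l / 3 * (2 + 3 * (C * ((κ + 1) ^ 2 + κ + 1)) / l) =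
      2 * l / 3 + C * ((κ + 1) ^ 2 + κ + 1) := by field_simp
    rw [this]; linarith
  have h1 := (abs_le.1 hAre).1
  have h2 : y * g' - C * y ^ 2 ≤ |(sinhMap l a (⟨x, y⟩ : ℂ)).im| := by
    have := (abs_le.1 hAim).1
    linarith [le_abs_self (sinhMap l a (⟨x, y⟩ : ℂ)).im]
  have h3 : κ * (y * g' - C * y ^ 2) ≤ κ * |(sinhMap l a (⟨x, y⟩ : ℂ)).im| := by gcongr
  have h4 : C * (b - x) ^ 2 ≤ C * ((κ + 1) * y) ^ 2 := by gcongr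
  have h5 : C * ((κ + 1) ^ 2 + κ + 1) * y ^ 2 ≤ l / 3 * D * y ^ 2 := by gcongr
  have h6 : (b - x) * g' = κ * y * g' - D * y ^ 2 / x * g' := by rw [hb]; ring
  linarith

end shadow

section goodOrbit
variable {l a : ℝ} {w : ℂ} {ρ : ℝ} {φ : ℂ → ℂ} {M₀ : ℝ}

/-- An orbit in the strip `|Im z| < 1` off the coordinate axes with controlled derivatives. -/
structure GoodOrbit (l a ρ : ℝ) (w : ℂ) : Prop where
  rho_pos : 0 < ρ
  im_ne_zero : ∀ n, ((sinhMap l a)^[n] w).im ≠ 0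
  re_ne_zero : ∀ n, ((sinhMap l a)^[n] w).re ≠ 0
  im_lt : ∀ n, |((sinhMap l a)^[n] w).im| < 1
  deriv_le : ∀ n, ‖deriv (sinhMap l a)^[n] w‖ * ρ ≤ 2 * |((sinhMap l a)^[n] w).im|
  summable : Summable fun n => orbitSlope l a w n ^ 2
  tendsto_im : Tendsto (fun n => |((sinhMap l a)^[n] w).im|) atTop (𝓝 0)

theorem GoodOrbit.lt_pi (G : GoodOrbit l a ρ w) (n : ℕ) :
    |((sinhMap l a)^[n] w).im| < Real.pi := by
  linarith [G.im_lt n, Real.pi_gt_three]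

theorem ball_subset_slitInterval {z : ℂ} {r t e : ℝ} (ht : t ≤ z.re - r) (he : z.re + r ≤ e) :
    ball z r ⊆ slitInterval t e := by
  intro w hw
  right
  rw [mem_ball, dist_eq_norm] at hw
  have := abs_lt.1 ((Complex.abs_re_le_norm (w - z)).trans_lt hw)
  simp only [Complex.sub_re] at this
  constructor <;> linarith

theorem GoodOrbit.not_unobstructed (h : IsSlitSection l a φ M₀) (G : GoodOrbit l a ρ w) {n : ℕ}
    {t e R M : ℝ} (hR : 0 < R) (hM : M₀ ≤ M) (hMR : 4 * M < R * ρ)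
    (ht : t ≤ ((sinhMap l a)^[n] w).re - R * |((sinhMap l a)^[n] w).im|)
    (he : ((sinhMap l a)^[n] w).re + R * |((sinhMap l a)^[n] w).im| ≤ e)
    (hb : ‖(sinhMap l a)^[n] w‖ + R * |((sinhMap l a)^[n] w).im| ≤ M) :
    ¬Unobstructed (l + a) φ (orbitSign l a w n) t e n := by
  intro hU
  have hs := isSign_orbitSign (l := l) (a := a) w n
  set z := (sinhMap l a)^[n] w with hz
  have hY : 0 < |z.im| := abs_pos.2 (G.im_ne_zero n)
  have hr : 0 < R * |z.im| := mul_pos hR hY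
  have hsub := ball_subset_slitInterval ht he
  set P := pullback φ (orbitSign l a w n) n with hP
  have hPd : DifferentiableOn ℂ P (ball z (R * |z.im|)) := (hU.differentiableOn h hs).mono hsub
  have hPz : P z = w := by
    have := pullback_orbitSign h (y := w) (n := n)
      (fun i _ => ⟨G.re_ne_zero i, G.lt_pi i⟩) (j := n) le_rfl
    simpa using this
  have hbd : ∀ u ∈ ball z (R * |z.im|), ‖P u‖ < M := fun u hu =>
    hU.norm_pullback_lt h hs hM (hsub hu) (by
      rw [mem_ball, dist_eq_norm] at hu
      have : ‖u‖ ≤ ‖u - z‖ + ‖z‖ := by simpa using norm_add_le (u - z) z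
      linarith)
  have hmaps : MapsTo P (ball z (R * |z.im|)) (ball (P z) (2 * M)) := by
    intro u hu
    rw [mem_ball, dist_eq_norm]
    have h1 := hbd u hu
    have h2 := hbd z (mem_ball_self hr)
    exact (norm_sub_le _ _).trans_lt (by linarith)
  have hder := Complex.norm_deriv_le_div_of_mapsTo_ball hPd (hmaps.mono_right ball_subset_closedBall) hr
  have hdat : DifferentiableAt ℂ P z := hPd.differentiableAt (ball_mem_nhds z hr)
  have hchain : deriv (sinhMap l a)^[n] w * deriv P z = 1 := by
    have h1 := ((differentiable_iterate (differentiable_sinhMap (l := l) (a := a)) n (P z)).hasDerivAt.comp z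
      hdat.hasDerivAt)
    rw [hPz] at h1
    refine (h1.congr_of_eventuallyEq ?_).unique (hasDerivAt_id z)
    filter_upwards [ball_mem_nhds z hr] with u hu
    exact (hU.iterate_pullback_self h hs (hsub hu)).symm
  have hn : ‖deriv (sinhMap l a)^[n] w‖ * ‖deriv P z‖ = 1 := by rw [← norm_mul, hchain, norm_one]
  rw [le_div_iff₀ hr] at hder
  have hD := G.deriv_le n
  have hρ := G.rho_pos
  rw [← hz] at hD
  have h3 : ρ * (R * |z.im|) ≤ 2 * |z.im| * (2 * M) := by
    calc ρ * (R * |z.im|) = (‖deriv (sinhMap l a)^[n] w‖ * ‖deriv P z‖) * (ρ * (R * |z.im|)) := by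
          rw [hn, one_mul]
      _ = (‖deriv (sinhMap l a)^[n] w‖ * ρ) * (‖deriv P z‖ * (R * |z.im|)) := by ring
      _ ≤ _ := by
          apply mul_le_mul hD hder (by positivity) (by positivity)
  nlinarith

/-- An obstructed interval around an orbit point is hit by the real orbit of an interval. -/
theorem GoodOrbit.exists_return (hl : 0 < l) (h : IsSlitSection l a φ M₀) (G : GoodOrbit l a ρ w)
    {n : ℕ} {t e R M κ : ℝ} (hκ : 0 ≤ κ) (hR : 0 < R) (hM : M₀ ≤ M) (hMR : 4 * M < R * ρ)
    (ht : t ≤ ((sinhMap l a)^[n] w).re - R * |((sinhMap l a)^[n] w).im|)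
    (he : ((sinhMap l a)^[n] w).re + R * |((sinhMap l a)^[n] w).im| ≤ e)
    (hb : ‖(sinhMap l a)^[n] w‖ + R * |((sinhMap l a)^[n] w).im| ≤ M)
    (hlens : κ * |((sinhMap l a)^[n] w).im| * (e - t) + ((sinhMap l a)^[n] w).im ^ 2 ≤
      (((sinhMap l a)^[n] w).re - t) * (e - ((sinhMap l a)^[n] w).re)) :
    ∃ j < n, ∀ b : ℝ, realMap l a b ≤ ((sinhMap l a)^[j + 1] w).re +
        κ * |((sinhMap l a)^[j + 1] w).im| → ∀ x : ℝ, |x| < |b| →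
      (realMap l a)^[n - j] x ∈ Ioo t e ∧ ∀ i, 0 < i → i < n - j → (realMap l a)^[i] x ≠ 0 := by
  have hY : 0 < |((sinhMap l a)^[n] w).im| := abs_pos.2 (G.im_ne_zero n)
  have hr : 0 < R * |((sinhMap l a)^[n] w).im| := mul_pos hR hY
  obtain ⟨k, hk, hx⟩ := obstruction h hκ (y := w) (n := n) (t := t) (e := e)
    (fun i _ => ⟨G.im_ne_zero i, G.re_ne_zero i, G.lt_pi i⟩)
    (by linarith) hlens (G.not_unobstructed h hR hM hMR ht he hb)
  refine ⟨n - 1 - k, by omega, fun b hb x hxb => ?_⟩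
  rw [show n - 1 - k + 1 = n - k by omega] at hb
  have h1 : realMap l a x < realMap l a b := (realMap_lt_iff_abs hl).2 hxb
  obtain ⟨h2, h3⟩ := hx (realMap l a x) (realMap_ge hl x) (h1.trans_le hb)
  rw [← Function.iterate_succ_apply (realMap l a)] at h2
  rw [show n - (n - 1 - k) = k + 1 by omega]
  refine ⟨h2, fun i hi hik => ?_⟩
  obtain ⟨i, rfl⟩ : ∃ i', i = i' + 1 := ⟨i - 1, by omega⟩
  rw [Function.iterate_succ_apply]
  exact h3 i (by omega)

theorem IsTame.exists_goodOrbit {W : Set ℂ} (hl : 0 < l) (h : IsTame (sinhMap l a) W w) :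
    ∃ Xs > 0, ∀ τ > 0, ∃ (w' : ℂ) (ρ : ℝ), IsTame (sinhMap l a) W w' ∧ GoodOrbit l a ρ w' ∧
      ∀ n, |((sinhMap l a)^[n] w').re| ≤ Xs ∧
        |((sinhMap l a)^[n] w').im| ≤ τ * |((sinhMap l a)^[n] w').re| := by
  obtain ⟨hY, Xs, hXs, hX⟩ := h.asymptotics hl
  refine ⟨Xs, hXs, fun τ hτ => ?_⟩
  obtain ⟨n0, hn0⟩ := eventually_atTop.1 (hX.and ((hY.eventually_lt_const zero_lt_one).and
    ((h.tendsto_orbitSlope hl).eventually_le_const hτ)))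
  have h' := h.iterate (isOpenMap_sinhMap hl) n0
  obtain ⟨ρ, hρ, hd⟩ := h'.exists_norm_deriv_le differentiable_sinhMap
  have e : ∀ n, (sinhMap l a)^[n] ((sinhMap l a)^[n0] w) = (sinhMap l a)^[n + n0] w :=
    fun n => (Function.iterate_add_apply _ _ _ _).symm
  refine ⟨(sinhMap l a)^[n0] w, ρ, h', ⟨hρ, h'.im_ne_zero, h'.re_ne_zero, fun n => ?_, hd,
    (h'.derivRatio hl).1, (h'.asymptotics hl).1⟩, fun n => ⟨?_, ?_⟩⟩
  · rw [e]; exact (hn0 (n + n0) (by omega)).2.1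
  · rw [e]; exact (hn0 (n + n0) (by omega)).1.le
  · rw [e]
    have := (hn0 (n + n0) (by omega)).2.2
    unfold orbitSlope at this
    rwa [div_le_iff₀ (abs_pos.2 (h.re_ne_zero _))] at this

end goodOrbit

section realDynamics
variable {l a : ℝ}

/-- The real orbit of `x` avoids the critical point and stays in `(-X, X)`. -/
def FreeOrbit (l a X x : ℝ) : Prop :=
  ∀ k, (realMap l a)^[k] x ≠ 0 ∧ |(realMap l a)^[k] x| < X

theorem continuous_iterate_realMap (n : ℕ) : Continuous (realMap l a)^[n] :=
  continuous_realMap.iterate n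

theorem realMap_injOn_of_ne_zero (hl : 0 < l) {S : Set ℝ} (hS : IsPreconnected S)
    (h0 : (0 : ℝ) ∉ S) : InjOn (realMap l a) S := by
  intro u hu v hv huv
  have habs : |u| = |v| :=
    le_antisymm ((realMap_le_iff_abs hl).1 huv.le) ((realMap_le_iff_abs hl).1 huv.ge)
  rcases abs_eq_abs.1 habs with h | h
  · exact h
  · exfalso
    have hoc := hS.ordConnected
    rcases le_total v 0 with hv0 | hv0
    · exact h0 (hoc.out hv hu ⟨hv0, by linarith⟩)
    · exact h0 (hoc.out hu hv ⟨by linarith, hv0⟩)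

theorem iterate_realMap_injOn (hl : 0 < l) {S : Set ℝ} (hS : IsPreconnected S) {N : ℕ}
    (h0 : ∀ x ∈ S, ∀ i < N, (realMap l a)^[i] x ≠ 0) : InjOn (realMap l a)^[N] S := by
  induction N with
  | zero => exact injOn_id _
  | succ N ih =>
    rw [Function.iterate_succ']
    refine InjOn.comp (t := (realMap l a)^[N] '' S) ?_ (ih fun x hx i hi => h0 x hx i (by omega))
      (mapsTo_image _ _)
    refine realMap_injOn_of_ne_zero hl
      (hS.image _ (continuous_iterate_realMap N).continuousOn) ?_
    rintro ⟨x, hx, hx0⟩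
    exact h0 x hx N (by omega) hx0

theorem freeOrbit_of_frequently {X : ℝ} (hX : ∀ x : ℝ, X ≤ |x| → |x| + 1 ≤ realMap l a x)
    {x B : ℝ} (hx : x ≠ 0)
    (h : ∀ N, ∃ n ≥ N, |(realMap l a)^[n] x| ≤ B ∧
      ∀ i, 0 < i → i < n → (realMap l a)^[i] x ≠ 0) : FreeOrbit l a X x := by
  intro k
  constructor
  · rcases Nat.eq_zero_or_pos k with rfl | hk
    · exact hx
    · obtain ⟨n, hn, -, h2⟩ := h (k + 1)
      exact h2 k hk (by omega)
  · by_contra hcon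
    rw [not_lt] at hcon
    have hgrow : ∀ i : ℕ, X + i ≤ |(realMap l a)^[k + i] x| := by
      intro i
      induction i with
      | zero => simpa using hcon
      | succ i ih =>
        have h1 := hX _ ((le_add_of_nonneg_right (Nat.cast_nonneg i)).trans ih)
        rw [← Function.iterate_succ_apply' (realMap l a)] at h1
        have h2 := le_abs_self ((realMap l a)^[(k + i).succ] x)
        rw [show k + (i + 1) = (k + i).succ by omega]
        push_cast
        linarith
    obtain ⟨i, hi⟩ := exists_nat_gt (B - X)
    obtain ⟨n, hn, h1, -⟩ := h (k + i)
    obtain ⟨m, rfl⟩ : ∃ m, n = k + m := ⟨n - k, by omega⟩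
    have h3 := hgrow m
    have h4 : (i : ℝ) ≤ m := by exact_mod_cast (show i ≤ m by omega)
    linarith

theorem freeOrbit_of_trap {X : ℝ} (hX : ∀ x : ℝ, X ≤ |x| → |x| + 1 ≤ realMap l a x)
    {b : ℝ} {N : ℕ} (hN : 0 < N)
    (h : ∀ x : ℝ, |x| < b → |(realMap l a)^[N] x| < b ∧
      ∀ i, 0 < i → i ≤ N → (realMap l a)^[i] x ≠ 0) {x : ℝ} (hx : x ≠ 0) (hxb : |x| < b) :
    FreeOrbit l a X x := by
  have key : ∀ m : ℕ, |(realMap l a)^[N * m] x| < b ∧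
      ∀ i, 0 < i → i ≤ N * m → (realMap l a)^[i] x ≠ 0 := by
    intro m
    induction m with
    | zero => exact ⟨hxb, fun i hi hi' => by omega⟩
    | succ m ih =>
      obtain ⟨h1, h2⟩ := h _ ih.1
      refine ⟨?_, fun i hi hi' => ?_⟩
      · rw [Nat.mul_succ, add_comm, Function.iterate_add_apply]; exact h1
      · by_cases hc : i ≤ N * m
        · exact ih.2 i hi hc
        · have := h2 (i - N * m) (by omega) (by rw [Nat.mul_succ] at hi'; omega)
          rwa [← Function.iterate_add_apply, Nat.sub_add_cancel (by omega)] at this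
  refine freeOrbit_of_frequently hX (B := b) hx fun n => ⟨N * n, Nat.le_mul_of_pos_left n hN,
    (key n).1.le, fun i hi hi' => (key n).2 i hi hi'.le⟩

end realDynamics

section noHom
variable {l a : ℝ} {w : ℂ} {ρ : ℝ} {φ : ℂ → ℂ} {M₀ : ℝ}

theorem exists_shadow_half (hl : 0 < l) (a : ℝ) {M : ℝ} (hM : 0 < M) :
    ∃ D ≥ 2, ∀ z : ℂ, z.re ≠ 0 → |z.re| ≤ M → |z.im| ≤ 1 → D * |z.im| ≤ |z.re| →
      ∃ b, |z.re| / 2 ≤ b ∧ realMap l a b ≤ (sinhMap l a z).re := by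
  obtain ⟨D, hD, h⟩ := exists_shadow hl a le_rfl hM
  refine ⟨D, hD, fun z h1 h2 h3 h4 => ?_⟩
  obtain ⟨h5, h6⟩ := h z h1 h2 h3 h4
  exact ⟨_, h5, h6.trans_eq (by ring)⟩

theorem exists_lens {x y R : ℝ} (hx : x ≠ 0) (hR : 0 < R) (hy : 0 < y) (hRy : R * y ≤ |x| / 2) :
    ∃ t e : ℝ, t ≤ x - R * y ∧ x + R * y ≤ e ∧
      R * y * (e - t) + y ^ 2 ≤ (x - t) * (e - x) ∧
      ∀ u ∈ Ioo t e, u ≠ 0 ∧ |u| < (|x| ^ 2 + y ^ 2) / (|x| - R * y) := by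
  have hX : 0 < |x| := abs_pos.2 hx
  have hRy0 : 0 < R * y := mul_pos hR hy
  have hden : 0 < |x| - R * y := by linarith
  set E := (|x| ^ 2 + y ^ 2) / (|x| - R * y) with hE
  have hEe : E * (|x| - R * y) = |x| ^ 2 + y ^ 2 := div_mul_cancel₀ _ hden.ne'
  have hEx : |x| + R * y ≤ E := by
    rw [hE, le_div_iff₀ hden]; nlinarith [sq_nonneg (R * y)]
  rcases lt_or_gt_of_ne hx with h | h
  · rw [abs_of_neg h] at *
    refine ⟨-E, 0, by linarith, by linarith, by nlinarith, fun u hu => ⟨hu.2.ne, ?_⟩⟩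
    rw [abs_of_neg hu.2]; linarith [hu.1]
  · rw [abs_of_pos h] at *
    refine ⟨0, E, by linarith, by linarith, by nlinarith, fun u hu => ⟨hu.1.ne', ?_⟩⟩
    rw [abs_of_pos hu.1]; exact hu.2

theorem lens_ratio {x y κ D : ℝ} (hx : 0 < x) (hy : 0 ≤ y) (hκ : 0 ≤ κ) (hD : 0 ≤ D)
    (hκy : κ * y ≤ x / 2) :
    (x ^ 2 + y ^ 2) / (x - κ * y) * (1 - (κ ^ 2 + D + 1) * (y / x) ^ 2) ≤
      x + κ * y - D * y ^ 2 / x := by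
  have hden : 0 < x - κ * y := by linarith
  have e : (x + κ * y - D * y ^ 2 / x) * (x - κ * y) -
      (x ^ 2 + y ^ 2) * (1 - (κ ^ 2 + D + 1) * (y / x) ^ 2) =
      D * κ * y ^ 3 / x + (κ ^ 2 + D + 1) * y ^ 4 / x ^ 2 := by
    field_simp; ring
  have h0 : 0 ≤ D * κ * y ^ 3 / x + (κ ^ 2 + D + 1) * y ^ 4 / x ^ 2 := by positivity
  rw [div_mul_eq_mul_div, div_le_iff₀ hden]
  linarith

theorem lower_bound_of_recursion {E A : ℕ → ℝ} {m C : ℝ} {j₁ : ℕ} (hm : 0 < m) (hC : 0 < C)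
    (hA : Monotone A) (hA2 : ∀ n, C * (A n - A j₁) ≤ 1 / 2)
    (h : ∀ n ≥ j₁, m ≤ E n ∨ ∃ j, j₁ ≤ j ∧ j < n ∧ E j * (1 - C * (A (j + 1) - A j)) ≤ E n) :
    ∀ n ≥ j₁, m / 2 ≤ E n := by
  have key : ∀ n ≥ j₁, m * (1 - C * (A n - A j₁)) ≤ E n := by
    intro n
    induction n using Nat.strong_induction_on with
    | _ n ih =>
      intro hn
      rcases h n hn with h1 | ⟨j, hj, hjn, h1⟩
      · have : 0 ≤ C * (A n - A j₁) := mul_nonneg hC.le (sub_nonneg.2 (hA hn))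
        nlinarith
      · refine le_trans ?_ h1
        have i1 := ih j hjn hj
        have i2 : A (j + 1) ≤ A n := hA hjn
        have i3 : 0 ≤ A (j + 1) - A j := sub_nonneg.2 (hA j.le_succ)
        have i4 : 0 ≤ A j - A j₁ := sub_nonneg.2 (hA hj)
        have i5 := hA2 (j + 1)
        set p := C * (A (j + 1) - A j)
        set q := C * (A j - A j₁)
        have hp : 0 ≤ p := mul_nonneg hC.le i3
        have hq : 0 ≤ q := mul_nonneg hC.le i4
        have hpq : p + q = C * (A (j + 1) - A j₁) := by simp only [p, q]; ring
        have hpn : p + q ≤ C * (A n - A j₁) := by rw [hpq]; gcongr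
        calc m * (1 - C * (A n - A j₁)) ≤ m * (1 - (p + q)) := by gcongr
          _ ≤ m * (1 - q) * (1 - p) := by nlinarith [mul_nonneg hm.le (mul_nonneg hp hq)]
          _ ≤ _ := by
            gcongr
            linarith
  intro n hn
  have := key n hn
  nlinarith [hA2 n]

theorem GoodOrbit.exists_returning_times (hl : 0 < l) (h : IsSlitSection l a φ M₀)
    (G : GoodOrbit l a ρ w) {Xs : ℝ} (hXs0 : 0 < Xs)
    (hXs : ∀ n, |((sinhMap l a)^[n] w).re| ≤ Xs)
    (hhalf : ∀ n, ∃ b, |((sinhMap l a)^[n] w).re| / 2 ≤ b ∧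
      realMap l a b ≤ ((sinhMap l a)^[n + 1] w).re) {X : ℝ}
    (hX : ∀ x : ℝ, X ≤ |x| → |x| + 1 ≤ realMap l a x)
    (hno : ¬∃ β > 0, ∀ x ∈ Ioo 0 β, FreeOrbit l a X x) :
    ∃ δ > 0, ∃ R j₁ : ℕ, ∀ n ≥ j₁, ∃ N, 0 < N ∧ ∀ x : ℝ, |x| < δ →
      |(realMap l a)^[N] x - ((sinhMap l a)^[n] w).re| ≤ R * |((sinhMap l a)^[n] w).im| ∧
      ∀ i, 0 < i → i < N → (realMap l a)^[i] x ≠ 0 := by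
  have hρ := G.rho_pos
  have hXn : ∀ n, 0 < |((sinhMap l a)^[n] w).re| := fun n => abs_pos.2 (G.re_ne_zero n)
  have hYn : ∀ n, 0 < |((sinhMap l a)^[n] w).im| := fun n => abs_pos.2 (G.im_ne_zero n)
  have hYX : ∀ n, |((sinhMap l a)^[n] w).im| =
      orbitSlope l a w n * |((sinhMap l a)^[n] w).re| := fun n => by
    unfold orbitSlope; rw [div_mul_cancel₀ _ (hXn n).ne']
  set M := max M₀ (Xs + 2)
  have hM : M₀ ≤ M := le_max_left _ _
  have hM2 : Xs + 2 ≤ M := le_max_right _ _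
  obtain ⟨R, hRgt⟩ := exists_nat_gt (max (4 * M / ρ) 1)
  have hR1 : (1 : ℝ) < R := (le_max_right _ _).trans_lt hRgt
  have hMR : 4 * M < R * ρ := by
    have := (le_max_left _ _).trans_lt hRgt
    rwa [div_lt_iff₀ hρ] at this
  obtain ⟨D, hD2, hD⟩ := exists_shadow hl a (κ := R) (by linarith) hXs0
  set C := (R : ℝ) ^ 2 + D + 1
  have hC : 0 < C := by positivity
  set A : ℕ → ℝ := fun n => ∑ i ∈ Finset.range n, orbitSlope l a w i ^ 2 with hAdef
  have hA : Monotone A := by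
    refine monotone_nat_of_le_succ fun n => ?_
    rw [hAdef]; simp only [Finset.sum_range_succ]
    linarith [sq_nonneg (orbitSlope l a w n)]
  have hAs : ∀ n, A (n + 1) - A n = orbitSlope l a w n ^ 2 := fun n => by
    rw [hAdef]; simp only [Finset.sum_range_succ]; ring
  have hAlim := G.summable.hasSum.tendsto_sum_nat
  have hAle : ∀ n, A n ≤ ∑' i, orbitSlope l a w i ^ 2 := fun n => hA.ge_of_tendsto hAlim n
  have htend : Tendsto (orbitSlope l a w) atTop (𝓝 0) := by
    have := G.summable.tendsto_atTop_zero.sqrt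
    simpa [Real.sqrt_sq (show 0 ≤ orbitSlope l a w _ from
      div_nonneg (abs_nonneg _) (abs_nonneg _))] using this
  obtain ⟨j₁, hj₁⟩ := eventually_atTop.1 ((htend.eventually_le_const
    (show 0 < min (1 / (2 * R : ℝ)) (1 / D) by positivity)).and
    ((G.tendsto_im.eventually_le_const (show 0 < 1 / (R : ℝ) by positivity)).and
    (hAlim.eventually (lt_mem_nhds (sub_lt_self (∑' i, orbitSlope l a w i ^ 2)
      (show 0 < 1 / (2 * C) by positivity))))))
  have hA2 : ∀ n, C * (A n - A j₁) ≤ 1 / 2 := by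
    intro n
    have h1 := (hj₁ j₁ le_rfl).2.2
    have h2 : A n - A j₁ ≤ 1 / (2 * C) := by linarith [hAle n, hAdef]
    calc C * (A n - A j₁) ≤ C * (1 / (2 * C)) := by gcongr
      _ = 1 / 2 := by field_simp
  have hRY : ∀ n ≥ j₁, R * |((sinhMap l a)^[n] w).im| ≤ 1 := fun n hn => by
    have := (hj₁ n hn).2.1
    rwa [le_div_iff₀ (by positivity), mul_comm] at this
  have hRYX : ∀ n ≥ j₁, R * |((sinhMap l a)^[n] w).im| ≤ |((sinhMap l a)^[n] w).re| / 2 :=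
    fun n hn => by
    have := (hj₁ n hn).1.trans (min_le_left _ _)
    rw [hYX n]
    calc R * (orbitSlope l a w n * |((sinhMap l a)^[n] w).re|) ≤
        R * (1 / (2 * R) * |((sinhMap l a)^[n] w).re|) := by gcongr
      _ = _ := by field_simp
  have hDYX : ∀ n ≥ j₁, D * |((sinhMap l a)^[n] w).im| ≤ |((sinhMap l a)^[n] w).re| :=
    fun n hn => by
    have := (hj₁ n hn).1.trans (min_le_right _ _)
    rw [hYX n]
    calc D * (orbitSlope l a w n * |((sinhMap l a)^[n] w).re|) ≤
        D * (1 / D * |((sinhMap l a)^[n] w).re|) := by gcongr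
      _ = _ := by field_simp
  have hnorm : ∀ n ≥ j₁, ‖(sinhMap l a)^[n] w‖ + R * |((sinhMap l a)^[n] w).im| ≤ M :=
    fun n hn => by
    have := Complex.norm_le_abs_re_add_abs_im ((sinhMap l a)^[n] w)
    linarith [hXs n, hRY n hn, G.im_lt n]
  obtain ⟨m, hm, hmj⟩ : ∃ m > 0, ∀ j < j₁, m ≤ |((sinhMap l a)^[j] w).re| / 2 := by
    clear hA2 hRY hRYX hDYX hnorm hj₁
    induction j₁ with
    | zero => exact ⟨1, one_pos, fun j hj => by omega⟩
    | succ j₁ ih =>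
      obtain ⟨m, hm, h⟩ := ih
      refine ⟨min m (|((sinhMap l a)^[j₁] w).re| / 2), lt_min hm (half_pos (hXn _)),
        fun j hj => ?_⟩
      rcases Nat.lt_succ_iff_lt_or_eq.1 hj with h1 | rfl
      · exact (min_le_left _ _).trans (h j h1)
      · exact min_le_right _ _
  set E : ℕ → ℝ := fun n => (|((sinhMap l a)^[n] w).re| ^ 2 + |((sinhMap l a)^[n] w).im| ^ 2) /
    (|((sinhMap l a)^[n] w).re| - R * |((sinhMap l a)^[n] w).im|) with hE
  have hrec : ∀ n ≥ j₁, m ≤ E n ∨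
      ∃ j, j₁ ≤ j ∧ j < n ∧ E j * (1 - C * (A (j + 1) - A j)) ≤ E n := by
    intro n hn
    obtain ⟨t, e, ht, he, hlens, hu⟩ := exists_lens (G.re_ne_zero n) (show (0 : ℝ) < R by linarith)
      (hYn n) (hRYX n hn)
    rw [sq_abs] at hlens
    obtain ⟨j, hjn, hret⟩ := G.exists_return hl h (κ := R) (by linarith) (by linarith) hM hMR ht he
      (hnorm n hn) hlens
    have hbE : ∀ b > 0, realMap l a b ≤ ((sinhMap l a)^[j + 1] w).re +
        R * |((sinhMap l a)^[j + 1] w).im| → b < E n := by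
      intro b hb hgb
      by_contra hcon
      rw [not_lt] at hcon
      refine hno ⟨b, hb, fun x hx => freeOrbit_of_trap hX (N := n - j) (b := b) (by omega) ?_
        hx.1.ne' (by rw [abs_of_pos hx.1]; exact hx.2)⟩
      intro x hx
      obtain ⟨h1, h2⟩ := hret b hgb x (by rwa [abs_of_pos hb])
      obtain ⟨h3, h4⟩ := hu _ h1
      refine ⟨h4.trans_le hcon, fun i hi hi' => ?_⟩
      rcases hi'.lt_or_eq with h5 | rfl
      · exact h2 i hi h5
      · exact h3
    by_cases hj : j < j₁
    · left
      obtain ⟨b, hb1, hb2⟩ := hhalf j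
      have hb0 : m ≤ b := (hmj j hj).trans hb1
      exact hb0.trans (hbE b (hm.trans_le hb0) (by
        have : 0 ≤ R * |((sinhMap l a)^[j + 1] w).im| := by positivity
        linarith)).le
    · right
      rw [not_lt] at hj
      refine ⟨j, hj, hjn, ?_⟩
      obtain ⟨h1, h2⟩ := hD _ (G.re_ne_zero j) (hXs j) (G.im_lt j).le (hDYX j hj)
      rw [← Function.iterate_succ_apply' (sinhMap l a)] at h2
      have h3 := hbE _ (lt_of_lt_of_le (half_pos (hXn j)) h1) h2
      refine le_trans ?_ h3.le
      rw [hAs]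
      exact lens_ratio (hXn j) (hYn j).le (by linarith) (by linarith) (hRYX j hj)
  have hlow := lower_bound_of_recursion hm hC hA hA2 hrec
  have hXlow : ∀ n ≥ j₁, m / 8 ≤ |((sinhMap l a)^[n] w).re| := by
    intro n hn
    have h1 := hlow n hn
    have h2 := hRYX n hn
    have h3 : |((sinhMap l a)^[n] w).im| ≤ R * |((sinhMap l a)^[n] w).im| := by
      nlinarith [hYn n]
    have h4 : E n ≤ 4 * |((sinhMap l a)^[n] w).re| := by
      rw [hE]; simp only
      rw [div_le_iff₀ (by linarith [hXn n])]
      nlinarith [hXn n, hYn n]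
    linarith
  refine ⟨m / 16, by positivity, R, j₁, fun n hn => ?_⟩
  have hY := hYn n
  obtain ⟨j, hjn, hret⟩ := G.exists_return hl h (n := n) (κ := 0) (R := R) le_rfl
    (by linarith) hM hMR le_rfl le_rfl (hnorm n hn) (by
      rw [← sq_abs ((sinhMap l a)^[n] w).im]
      have : |((sinhMap l a)^[n] w).im| ≤ R * |((sinhMap l a)^[n] w).im| := by nlinarith
      nlinarith [pow_le_pow_left₀ hY.le this 2])
  obtain ⟨b, hb1, hb2⟩ := hhalf j
  have hb3 : m / 16 ≤ b := by
    by_cases hj : j < j₁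
    · linarith [hmj j hj]
    · linarith [hXlow j (not_lt.1 hj)]
  refine ⟨n - j, by omega, fun x hx => ?_⟩
  obtain ⟨h1, h2⟩ := hret b (by simpa using hb2) x (hx.trans_le (hb3.trans (le_abs_self b)))
  refine ⟨abs_le.2 ⟨?_, ?_⟩, h2⟩ <;> linarith [h1.1, h1.2]

theorem GoodOrbit.exists_freeOrbit (hl : 0 < l) (h : IsSlitSection l a φ M₀)
    (G : GoodOrbit l a ρ w) {Xs : ℝ} (hXs0 : 0 < Xs)
    (hXs : ∀ n, |((sinhMap l a)^[n] w).re| ≤ Xs)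
    (hhalf : ∀ n, ∃ b, |((sinhMap l a)^[n] w).re| / 2 ≤ b ∧
      realMap l a b ≤ ((sinhMap l a)^[n + 1] w).re) {X : ℝ}
    (hX : ∀ x : ℝ, X ≤ |x| → |x| + 1 ≤ realMap l a x) :
    ∃ β > 0, ∀ x ∈ Ioo 0 β, FreeOrbit l a X x := by
  by_contra hno
  obtain ⟨δ, hδ, R, j₁, hret⟩ := G.exists_returning_times hl h hXs0 hXs hhalf hX hno
  choose! N hN0 hN using hret
  have hunb : ∀ B, ∀ᶠ n in atTop, B < N n := by
    intro B
    by_contra hcon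
    have : ∃ k ≤ B, ∃ᶠ n in atTop, N n = k := by
      by_contra hc
      push Not at hc
      refine hcon ?_
      have h1 : ∀ᶠ n in atTop, ∀ k ∈ Finset.range (B + 1), N n ≠ k :=
        (Finset.range (B + 1)).eventually_all.2 fun k hk =>
          hc k (Nat.lt_succ_iff.1 (Finset.mem_range.1 hk))
      filter_upwards [h1] with n hn
      by_contra hlt
      exact hn (N n) (Finset.mem_range.2 (by omega)) rfl
    obtain ⟨k, -, hk⟩ := this
    have hk' := hk.and_eventually (eventually_ge_atTop j₁)
    have heq : (realMap l a)^[k] (δ / 2) = (realMap l a)^[k] (δ / 3) := by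
      by_contra hne
      have hpos : 0 < |(realMap l a)^[k] (δ / 2) - (realMap l a)^[k] (δ / 3)| :=
        abs_pos.2 (sub_ne_zero.2 hne)
      have hlim : Tendsto (fun n => 2 * ((R : ℝ) * |((sinhMap l a)^[n] w).im|)) atTop (𝓝 0) := by
        simpa using (G.tendsto_im.const_mul (R : ℝ)).const_mul 2
      obtain ⟨n, ⟨hnk, hnj⟩, hn⟩ := (hk'.and_eventually (hlim.eventually_lt_const hpos)).exists
      subst hnk
      have h1 := (hN n hnj (δ / 2) (by rw [abs_of_pos (by positivity)]; linarith)).1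
      have h2 := (hN n hnj (δ / 3) (by rw [abs_of_pos (by positivity)]; linarith)).1
      rw [abs_le] at h1 h2
      have : |(realMap l a)^[N n] (δ / 2) - (realMap l a)^[N n] (δ / 3)| ≤
          2 * ((R : ℝ) * |((sinhMap l a)^[n] w).im|) :=
        abs_le.2 ⟨by linarith, by linarith⟩
      linarith
    obtain ⟨n, hnk, hnj⟩ := hk'.exists
    have := iterate_realMap_injOn hl (S := Ioo 0 δ) isPreconnected_Ioo (N := k)
      (fun x hx i hi => by
        rcases Nat.eq_zero_or_pos i with rfl | hi0
        · exact hx.1.ne'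
        · exact (hN n hnj x (by rw [abs_of_pos hx.1]; exact hx.2)).2 i hi0 (hnk ▸ hi))
      (show δ / 2 ∈ Ioo 0 δ from ⟨by linarith, by linarith⟩)
      (show δ / 3 ∈ Ioo 0 δ from ⟨by linarith, by linarith⟩) heq
    linarith
  refine hno ⟨δ, hδ, fun x hx => freeOrbit_of_frequently hX (B := Xs + R) hx.1.ne' fun B => ?_⟩
  obtain ⟨n, hn, hnj⟩ := ((hunb B).and (eventually_ge_atTop j₁)).exists
  obtain ⟨h1, h2⟩ := hN n hnj x (by rw [abs_of_pos hx.1]; exact hx.2)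
  refine ⟨N n, hn.le, ?_, h2⟩
  have h3 : (R : ℝ) * |((sinhMap l a)^[n] w).im| ≤ R := by
    have := (G.im_lt n).le
    calc (R : ℝ) * |((sinhMap l a)^[n] w).im| ≤ R * 1 := by gcongr
      _ = R := mul_one _
  have h4 := abs_le.1 h1
  have h5 := abs_le.1 (hXs n)
  exact abs_le.2 ⟨by linarith, by linarith⟩

end noHom

section maxFree
variable {l a X β : ℝ} {φ : ℂ → ℂ} {M₀ : ℝ}

/-- `(0, β)` is a maximal interval of points with free real orbit. -/
structure IsMaxFree (l a X β : ℝ) : Prop where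
  pos : 0 < β
  free : ∀ x ∈ Ioo 0 β, FreeOrbit l a X x
  maximal : ∀ β' > β, ∃ x ∈ Ioo 0 β', ¬FreeOrbit l a X x

theorem exists_isMaxFree (h : ∃ β > 0, ∀ x ∈ Ioo 0 β, FreeOrbit l a X x) :
    ∃ β, IsMaxFree l a X β := by
  set S := {β : ℝ | 0 < β ∧ ∀ x ∈ Ioo 0 β, FreeOrbit l a X x} with hS
  have hne : S.Nonempty := let ⟨β, h1, h2⟩ := h; ⟨β, h1, h2⟩
  have hb : BddAbove S := by
    refine ⟨max X 0, fun β hβ => ?_⟩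
    by_contra hcon
    rw [not_le] at hcon
    have hm : (β + max X 0) / 2 ∈ Ioo 0 β :=
      ⟨by linarith [le_max_right X 0, hβ.1], by linarith⟩
    have := (hβ.2 _ hm 0).2
    simp only [Function.iterate_zero, id, abs_of_pos hm.1] at this
    linarith [le_max_left X 0]
  obtain ⟨β₀, hβ₀⟩ := hne
  refine ⟨sSup S, hβ₀.1.trans_le (le_csSup hb hβ₀), fun x hx => ?_, fun β' hβ' => ?_⟩
  · obtain ⟨β, hβ, hxβ⟩ := exists_lt_of_lt_csSup ⟨β₀, hβ₀⟩ hx.2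
    exact hβ.2 x ⟨hx.1, hxβ⟩
  · by_contra hcon
    push Not at hcon
    have : β' ∈ S := ⟨(hβ₀.1.trans_le (le_csSup hb hβ₀)).trans hβ', hcon⟩
    exact absurd (le_csSup hb this) (not_le.2 hβ')

theorem IsMaxFree.exists_image (hl : 0 < l) (H : IsMaxFree l a X β) (k : ℕ) :
    ∃ u v, u < v ∧ (realMap l a)^[k] '' Ioo 0 β = Ioo u v :=
  exists_image_Ioo_eq (M := X) H.pos (continuous_iterate_realMap k).continuousOn
    (iterate_realMap_injOn hl isPreconnected_Ioo fun x hx i _ => (H.free x hx i).1)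
    fun x hx => (H.free x hx k).2.le

theorem image_realMap_Ioo (hl : 0 < l) (hβ : 0 < β) :
    realMap l a '' Ioo 0 β = Ioo (l + a) (realMap l a β) := by
  apply Subset.antisymm
  · rintro _ ⟨x, hx, rfl⟩
    rw [← realMap_zero (l := l) (a := a)]
    have hm := strictMonoOn_realMap (l := l) (a := a) hl
    exact ⟨hm (mem_Ici.2 le_rfl) (mem_Ici.2 hx.1.le) hx.1, hm (mem_Ici.2 hx.1.le) (mem_Ici.2 hβ.le) hx.2⟩
  · rw [← realMap_zero (l := l) (a := a)]
    exact intermediate_value_Ioo hβ.le continuous_realMap.continuousOn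

theorem realMap_gt (hl : 0 < l) {x : ℝ} (hx : x ≠ 0) : l + a < realMap l a x := by
  rw [← realMap_zero (l := l) (a := a), realMap_lt_iff_abs hl]; simpa using hx

theorem same_sign_of_isPreconnected {S : Set ℝ} (hS : IsPreconnected S) (h0 : (0 : ℝ) ∉ S)
    {x y : ℝ} (hx : x ∈ S) (hy : y ∈ S) : 0 < x * y := by
  have hoc := hS.ordConnected
  have hx0 : x ≠ 0 := by rintro rfl; exact h0 hx
  have hy0 : y ≠ 0 := by rintro rfl; exact h0 hy
  rcases lt_or_gt_of_ne hx0 with h1 | h1 <;> rcases lt_or_gt_of_ne hy0 with h2 | h2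
  · exact mul_pos_of_neg_of_neg h1 h2
  · exact absurd (hoc.out hx hy ⟨h1.le, h2.le⟩) h0
  · exact absurd (hoc.out hy hx ⟨h2.le, h1.le⟩) h0
  · exact mul_pos h1 h2

theorem pullback_orbitSign_ofReal (h : IsSlitSection l a φ M₀) {S : Set ℝ} {n : ℕ}
    (hS : IsPreconnected S) (h0 : ∀ x ∈ S, ∀ i < n, (realMap l a)^[i] x ≠ 0) {x y : ℝ}
    (hx : x ∈ S) (hy : y ∈ S) {j : ℕ} (hj : j ≤ n) :
    pullback φ (orbitSign l a y n) j ((realMap l a)^[n] x : ℝ) =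
      ((realMap l a)^[n - j] x : ℝ) := by
  rw [← iterate_sinhMap_ofReal, ← iterate_sinhMap_ofReal]
  refine h.pullback_iterate (isSign_orbitSign _ n) (fun i hi => ?_) hj
  have h1 : n - 1 - i < n := by omega
  constructor
  · have h2 : 0 < orbitSign l a y n i * ((sinhMap l a)^[n - 1 - i] (y : ℂ)).re :=
      orbitSign_mul_pos (by rw [iterate_sinhMap_ofReal]; exact h0 y hy _ h1)
    rw [iterate_sinhMap_ofReal, Complex.ofReal_re] at h2 ⊢
    have h3 := same_sign_of_isPreconnected
      (hS.image _ (continuous_iterate_realMap (l := l) (a := a) (n - 1 - i)).continuousOn)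
      (by rintro ⟨z, hz, hz0⟩; exact h0 z hz _ h1 hz0) (mem_image_of_mem _ hx)
      (mem_image_of_mem _ hy)
    rcases isSign_orbitSign (l := l) (a := a) (y : ℂ) n i with e | e <;> rw [e] at h2 ⊢ <;>
      nlinarith
  · rw [iterate_sinhMap_ofReal, Complex.ofReal_im, abs_zero]
    exact Real.pi_pos

theorem tendsto_length_of_disjoint {u v : ℕ → ℝ} {X : ℝ} (huv : ∀ i, u i < v i)
    (hsub : ∀ i, Ioo (u i) (v i) ⊆ Ioo (-X) X)
    (hd : Pairwise fun i j => Disjoint (Ioo (u i) (v i)) (Ioo (u j) (v j))) :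
    Tendsto (fun i => v i - u i) atTop (𝓝 0) := by
  have h1 : ∑' i, ENNReal.ofReal (v i - u i) ≠ ⊤ := by
    have h2 := MeasureTheory.measure_iUnion (μ := MeasureTheory.volume) hd
      (fun i => measurableSet_Ioo)
    simp only [Real.volume_Ioo] at h2
    rw [← h2]
    refine ne_top_of_le_ne_top ?_ (MeasureTheory.measure_mono (iUnion_subset hsub))
    simp
  have h3 := ENNReal.tendsto_atTop_zero_of_tsum_ne_top h1
  have h4 := (ENNReal.tendsto_toReal ENNReal.zero_ne_top).comp h3
  refine h4.congr fun i => ?_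
  simp [ENNReal.toReal_ofReal (sub_nonneg.2 (huv i).le)]

theorem exists_record {L : ℕ → ℝ} (hL : ∀ i, 0 < L i) (h : Tendsto L atTop (𝓝 0)) (N : ℕ) :
    ∃ n ≥ N, ∀ m < n, L n < L m := by
  have h1 : Tendsto (fun i => (L i)⁻¹) atTop atTop :=
    Tendsto.inv_tendsto_nhdsGT_zero (tendsto_nhdsWithin_iff.2 ⟨h, Eventually.of_forall hL⟩)
  obtain ⟨n, hn, hm⟩ := (frequently_atTop.1 (frequently_high_scores h1)) N
  exact ⟨n, hn, fun m hmn => (inv_lt_inv₀ (hL m) (hL n)).1 (hm m hmn)⟩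

theorem subset_of_disjoint_Ioo {u v p q r : ℝ} (hpq : p < q) (huv : u < v)
    (hd : Disjoint (Ioo p q) (Ioo u v)) (hsub : Ioo p q ⊆ Ioo (u - r) (v + r)) : q - p ≤ r := by
  have h1 := (Ioo_subset_Ioo_iff hpq).1 hsub
  by_contra hcon
  rw [not_le] at hcon
  rw [Set.disjoint_left] at hd
  have h2 : max p u < min q v := by
    rw [max_lt_iff, lt_min_iff, lt_min_iff]
    exact ⟨⟨hpq, by linarith⟩, by linarith, huv⟩
  obtain ⟨x, hx1, hx2⟩ := exists_between h2
  rw [max_lt_iff] at hx1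
  rw [lt_min_iff] at hx2
  exact hd ⟨hx1.1, hx2.1⟩ ⟨hx1.2, hx2.2⟩

end maxFree

section recurrence
variable {l a X β : ℝ} {φ : ℂ → ℂ} {M₀ : ℝ}

theorem distortion {Φ : ℂ → ℂ} {c r u v : ℝ} (hr : 0 < r)
    (hΦ : DifferentiableOn ℂ Φ (slitInterval (c - r) (c + r)))
    (hmaps : MapsTo Φ (slitInterval (c - r) (c + r)) (slitInterval u v))
    (hreal : ∀ x ∈ Ioo (c - r) (c + r), (Φ x).im = 0) {x y : ℝ} (hx : |x - c| ≤ r / 2)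
    (hy : |y - c| ≤ r / 2) : v - (Φ x).re ≤ 81 * (v - (Φ y).re) := by
  have hsub : ball (c : ℂ) r ⊆ slitInterval (c - r) (c + r) :=
    ball_subset_slitInterval (by simp) (by simp)
  have hslit : ∀ z ∈ ball (c : ℂ) r, (v : ℂ) - Φ z ∈ Complex.slitPlane := by
    intro z hz
    rw [Complex.mem_slitPlane_iff]
    rcases hmaps (hsub hz) with h | h
    · right; simpa using h
    · left; simpa using h.2
  set Q : ℂ → ℂ := fun z => csqrt (v - Φ z) with hQ
  have hQd : DifferentiableOn ℂ Q (ball (c : ℂ) r) :=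
    differentiableOn_csqrt.comp ((hΦ.mono hsub).const_sub _) hslit
  have hpos : ∀ z ∈ ball (c : ℂ) r, 0 < (Q z).re := fun z hz => csqrt_re_pos (hslit z hz)
  have hmem : ∀ x : ℝ, |x - c| ≤ r / 2 → (x : ℂ) ∈ ball (c : ℂ) r := by
    intro x hx
    rw [mem_ball, Complex.dist_of_im_eq (by simp), Complex.ofReal_re, Complex.ofReal_re,
      Real.dist_eq]
    linarith
  have hre : ∀ x : ℝ, |x - c| ≤ r / 2 → 0 < (Q x).re ∧ Q x = ((Q x).re : ℝ) ∧
      (Q x).re ^ 2 = v - (Φ x).re := by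
    intro x hx
    have hxm := hmem x hx
    have him : (Φ x).im = 0 := hreal x (by constructor <;> linarith [(abs_le.1 hx).1, (abs_le.1 hx).2])
    have e : (v : ℂ) - Φ x = ((v - (Φ x).re : ℝ) : ℂ) := by
      apply Complex.ext <;> simp [him]
    have hp : 0 < v - (Φ x).re := by
      have := hslit x hxm
      rw [e, Complex.ofReal_mem_slitPlane] at this
      exact this
    have hQi : (Q x).im = 0 := by
      simp only [hQ]; rw [e]; exact csqrt_ofReal_im hp
    have hQe : Q x = ((Q x).re : ℝ) := by apply Complex.ext <;> simp [hQi]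
    refine ⟨hpos _ hxm, hQe, ?_⟩
    have := csqrt_sq (Complex.slitPlane_ne_zero (hslit x hxm))
    have h2 : Q x ^ 2 = v - Φ x := this
    rw [hQe, e] at h2
    exact_mod_cast h2
  have hcc : |c - c| ≤ r / 2 := by simp; linarith
  obtain ⟨hc1, hc2, hc3⟩ := hre c hcc
  have key : ∀ x : ℝ, |x - c| ≤ r / 2 → (Q x).re ≤ 3 * (Q c).re ∧ (Q c).re ≤ 3 * (Q x).re := by
    intro x hx
    obtain ⟨h1, h2, h3⟩ := hre x hx
    have h4 := schwarz_ball_halfPlane hQd hpos (hmem x hx)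
    rw [h2, hc2, Complex.conj_ofReal, ← Complex.ofReal_sub, ← Complex.ofReal_sub,
      ← Complex.ofReal_add, Complex.norm_real, Complex.norm_real, Complex.norm_real,
      Real.norm_eq_abs, Real.norm_eq_abs, Real.norm_eq_abs,
      abs_of_pos (add_pos h1 hc1)] at h4
    have h5 : |(Q x).re - (Q c).re| * r ≤ r / 2 * ((Q x).re + (Q c).re) :=
      h4.trans (by gcongr)
    have h6 : |(Q x).re - (Q c).re| ≤ ((Q x).re + (Q c).re) / 2 := by
      refine le_of_mul_le_mul_right (h5.trans_eq (by ring)) hr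
    rw [abs_le] at h6
    constructor <;> linarith [h6.1, h6.2]
  obtain ⟨hx1, hx2, hx3⟩ := hre x hx
  obtain ⟨hy1, hy2, hy3⟩ := hre y hy
  rw [← hx3, ← hy3]
  have := (key x hx).1
  have := (key y hy).2
  nlinarith

theorem IsMaxFree.exists_inter (hl : 0 < l) (h : IsSlitSection l a φ M₀)
    (hX : ∀ x : ℝ, X ≤ |x| → |x| + 1 ≤ realMap l a x) (H : IsMaxFree l a X β) :
    ∃ k m, 0 < k ∧ k < m ∧
      ((realMap l a)^[k] '' Ioo 0 β ∩ (realMap l a)^[m] '' Ioo 0 β).Nonempty := by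
  by_contra hcon
  push Not at hcon
  have hdisj : ∀ k m, 0 < k → 0 < m → k ≠ m →
      Disjoint ((realMap l a)^[k] '' Ioo 0 β) ((realMap l a)^[m] '' Ioo 0 β) := by
    intro k m hk hm hkm
    rcases hkm.lt_or_gt with h1 | h1
    · exact disjoint_iff_inter_eq_empty.2 (hcon k m hk h1)
    · exact (disjoint_iff_inter_eq_empty.2 (hcon m k hm h1)).symm
  have hIm := fun k => H.exists_image hl (k + 1)
  choose u v huv hI using hIm
  have hIX : ∀ i, Ioo (u i) (v i) ⊆ Ioo (-X) X := by
    intro i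
    rw [← hI i]
    rintro _ ⟨x, hx, rfl⟩
    exact abs_lt.1 (H.free x hx _).2
  have hd : Pairwise fun i j => Disjoint (Ioo (u i) (v i)) (Ioo (u j) (v j)) := by
    intro i j hij
    rw [← hI i, ← hI j]
    exact hdisj _ _ (by omega) (by omega) (by omega)
  have hlim := tendsto_length_of_disjoint huv hIX hd
  have hI0 : Ioo (u 0) (v 0) = Ioo (l + a) (realMap l a β) := by
    rw [← hI 0, ← image_realMap_Ioo hl H.pos]; rfl
  obtain ⟨hu0, hv0⟩ : u 0 = l + a ∧ v 0 = realMap l a β := by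
    have hlt : l + a < realMap l a β := realMap_gt hl H.pos.ne'
    have e1 := (Ioo_subset_Ioo_iff (huv 0)).1 hI0.subset
    have e2 := (Ioo_subset_Ioo_iff hlt).1 hI0.superset
    exact ⟨le_antisymm e2.1 e1.1, le_antisymm e1.2 e2.2⟩
  set ℓ := v 0 - u 0 with hℓ
  have hℓ0 : 0 < ℓ := sub_pos.2 (huv 0)
  -- a definite neighbourhood of the first interval can be pulled back
  have hmain : ∀ N, ∃ n ≥ N, ∀ x : ℝ, l + a < x → x < realMap l a β + ℓ / 81 →
      |(realMap l a)^[n] x| ≤ 3 * X ∧ ∀ i < n, (realMap l a)^[i] x ≠ 0 := by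
    intro N
    obtain ⟨n, hn, hrec⟩ := exists_record (fun i => sub_pos.2 (huv i)) hlim N
    refine ⟨n, hn, ?_⟩
    set c := (u n + v n) / 2 with hc
    set r := v n - u n with hr
    have hr0 : 0 < r := sub_pos.2 (huv n)
    have e1 : c - r = u n - r / 2 := by rw [hc, hr]; ring
    have e2 : c + r = v n + r / 2 := by rw [hc, hr]; ring
    set y := realMap l a (β / 2) with hy
    have hy0 : y ∈ Ioo (u 0) (v 0) := by
      rw [← hI 0]; exact ⟨β / 2, ⟨half_pos H.pos, half_lt_self H.pos⟩, rfl⟩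
    have hs := isSign_orbitSign (l := l) (a := a) (y : ℂ) n
    set s := orbitSign l a (y : ℂ) n with hsdef
    have hfree : ∀ x ∈ Ioo (u 0) (v 0), ∀ i, (realMap l a)^[i] x ≠ 0 ∧
        (realMap l a)^[i] x ∈ Ioo (u i) (v i) := by
      intro x hx i
      rw [← hI 0] at hx
      obtain ⟨p, hp, rfl⟩ := hx
      rw [← Function.iterate_add_apply]
      refine ⟨(H.free p hp _).1, ?_⟩
      rw [← hI i]
      exact ⟨p, hp, rfl⟩
    have hpb : ∀ x ∈ Ioo (u 0) (v 0), ∀ j ≤ n,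
        pullback φ s j ((realMap l a)^[n] x : ℝ) = ((realMap l a)^[n - j] x : ℝ) :=
      fun x hx j hj => pullback_orbitSign_ofReal h isPreconnected_Ioo
        (fun x hx i _ => (hfree x hx i).1) hx hy0 hj
    have hmemT : ∀ x ∈ Ioo (u 0) (v 0), (realMap l a)^[n] x ∈ Ioo (c - r) (c + r) := by
      intro x hx
      have := (hfree x hx n).2
      rw [e1, e2]
      exact ⟨by linarith [this.1], by linarith [this.2]⟩
    have hU : Unobstructed (l + a) φ s (c - r) (c + r) n := by
      by_contra hnU
      obtain ⟨k, hk, hUk, x₀, hx₀, hx₀', hle⟩ := exists_first_obstruction hnU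
      obtain ⟨u', v', huv', him, -⟩ := hUk.exists_image_Ioo h hs (by linarith)
      have hsub1 : Ioo (u 0) (v 0) ⊆ Ioo u' v' := by
        intro x hx
        have hlow : u' < l + a := by
          have : (pullback φ s k x₀).re ∈ Ioo u' v' := by
            rw [← him]; exact ⟨x₀, ⟨hx₀, hx₀'⟩, rfl⟩
          exact this.1.trans_le hle
        refine ⟨hlow.trans (hu0 ▸ hx.1), ?_⟩
        -- the point of the orbit of `x` lies to the right of the first interval
        have hq := (hfree x hx (n - k)).2
        have hq' : (realMap l a)^[n - k] x ∈ Ioo u' v' := by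
          rw [← him]
          refine ⟨(realMap l a)^[n] x, hmemT x hx, ?_⟩
          simp only
          rw [hpb x hx k hk.le, Complex.ofReal_re]
        have hgt : l + a < (realMap l a)^[n - k] x := by
          rw [show n - k = (n - k - 1) + 1 by omega, Function.iterate_succ_apply']
          exact realMap_gt hl (hfree x hx _).1
        have hnot : (realMap l a)^[n - k] x ∉ Ioo (u 0) (v 0) := fun hm =>
          Set.disjoint_left.1 (hd (show n - k ≠ 0 by omega)) hq hm
        have : v 0 ≤ (realMap l a)^[n - k] x := by
          by_contra hlt
          exact hnot ⟨hu0 ▸ hgt, not_le.1 hlt⟩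
        exact (hx.2.trans_le this).trans hq'.2
      have hsub2 : Ioo (u k) (v k) ⊆ Ioo (u n - r / 2) (v n + r / 2) := by
        rw [← hI k]
        rintro _ ⟨p, hp, rfl⟩
        have hp1 : realMap l a p ∈ Ioo (u 0) (v 0) := by rw [← hI 0]; exact ⟨p, hp, rfl⟩
        have := hsub1 hp1
        rw [← him] at this
        obtain ⟨q, hq, hqp⟩ := this
        simp only at hqp
        have := (hUk.realMap_iterate h hs hq).1
        rw [hqp] at this
        rw [Function.iterate_succ_apply, this, ← e1, ← e2]
        exact hq
      have := subset_of_disjoint_Ioo (huv k) (huv n) (hd hk.ne) hsub2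
      linarith [hrec k hk]
    obtain ⟨u', v', huv', him, hmaps⟩ := hU.exists_image_Ioo h hs (by linarith)
    have hdist := fun (x y : ℝ) (hx : |x - c| ≤ r / 2) (hy : |y - c| ≤ r / 2) =>
      distortion (Φ := pullback φ s n) (c := c) (r := r) (x := x) (y := y) hr0
        (hU.differentiableOn h hs) hmaps (fun x hx => hU.pullback_ofReal_im h hx.1 hx.2) hx hy
    have hsub1 : Ioo (u 0) (v 0) ⊆ Ioo u' v' := by
      intro x hx
      rw [← him]
      refine ⟨(realMap l a)^[n] x, hmemT x hx, ?_⟩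
      simp only
      rw [hpb x hx n le_rfl]; simp
    have hbds := (Ioo_subset_Ioo_iff (huv 0)).1 hsub1
    have hcomp : ∀ p ∈ Ioo (u 0) (v 0), ∀ q ∈ Ioo (u 0) (v 0), v' - p ≤ 81 * (v' - q) := by
      have hnear : ∀ p ∈ Ioo (u 0) (v 0), |(realMap l a)^[n] p - c| ≤ r / 2 := by
        intro p hp
        have := (hfree p hp n).2
        rw [abs_le, hc, hr]
        constructor <;> linarith [this.1, this.2]
      intro p hp q hq
      have := hdist _ _ (hnear p hp) (hnear q hq)
      rw [hpb p hp n le_rfl, hpb q hq n le_rfl] at this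
      simpa using this
    have hv' : realMap l a β + ℓ / 81 ≤ v' := by
      rw [← hv0]
      by_contra hlt
      rw [not_le] at hlt
      set ε := (v 0 + ℓ / 81 - v') / 2 with hε
      have hε0 : 0 < ε := by rw [hε]; linarith
      have hεℓ : ε ≤ ℓ / 162 := by rw [hε]; linarith [hbds.2]
      have := hcomp (u 0 + ε / 81) ⟨by linarith, by rw [hℓ] at *; linarith⟩ (v 0 - ε)
        ⟨by rw [hℓ] at *; linarith, by linarith⟩
      linarith [hbds.2]
    intro x hx hx'
    have hxm : x ∈ Ioo u' v' := ⟨by linarith [hbds.1, hu0], by linarith⟩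
    rw [← him] at hxm
    obtain ⟨p, hp, rfl⟩ := hxm
    obtain ⟨h1, h2⟩ := hU.realMap_iterate h hs hp
    refine ⟨?_, h2⟩
    simp only
    rw [h1]
    have h3 := (Ioo_subset_Ioo_iff (huv n)).1 (hIX n)
    rw [e1, e2] at hp
    rw [abs_le]
    constructor <;> linarith [hp.1, hp.2, huv n]
  obtain ⟨β', hβ', hgβ'⟩ : ∃ β' > β, realMap l a β' < realMap l a β + ℓ / 81 := by
    have := (continuous_realMap (l := l) (a := a)).continuousAt.eventually_lt_const
      (show realMap l a β < realMap l a β + ℓ / 81 by linarith)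
    obtain ⟨β', h1, h2⟩ := ((this.filter_mono nhdsWithin_le_nhds).and
      (self_mem_nhdsWithin (s := Ioi β))).exists
    exact ⟨β', h2, h1⟩
  obtain ⟨x, hx, hnf⟩ := H.maximal β' hβ'
  refine hnf (freeOrbit_of_frequently hX (B := 3 * X) hx.1.ne' fun N => ?_)
  obtain ⟨n, hn, hpt⟩ := hmain N
  obtain ⟨h1, h2⟩ := hpt (realMap l a x) (realMap_gt hl hx.1.ne') (lt_of_lt_of_le
    ((realMap_lt_iff_abs hl).2 (by
      rw [abs_of_pos hx.1, abs_of_pos (H.pos.trans hβ')]; exact hx.2)) hgβ'.le)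
  refine ⟨n + 1, by omega, h1, fun i hi hi' => ?_⟩
  obtain ⟨i, rfl⟩ : ∃ i', i = i' + 1 := ⟨i - 1, by omega⟩
  exact h2 i (by omega)

end recurrence

section cycle
variable {l a X β : ℝ}

theorem monotoneOn_comp_self {G : ℝ → ℝ} {Y : Set ℝ} (hY : Y.OrdConnected) (hG : Continuous G)
    (hinj : InjOn G Y) (hmaps : MapsTo G Y Y) : MonotoneOn (G ∘ G) Y := by
  intro u hu v hv huv
  set A := min (min u v) (min (G u) (G v)) with hA
  set B := max (max u v) (max (G u) (G v)) with hB
  have hmin : ∀ {x y : ℝ}, x ∈ Y → y ∈ Y → min x y ∈ Y := fun {x y} hx hy => by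
    rcases min_choice x y with h | h <;> rw [h] <;> assumption
  have hmax : ∀ {x y : ℝ}, x ∈ Y → y ∈ Y → max x y ∈ Y := fun {x y} hx hy => by
    rcases max_choice x y with h | h <;> rw [h] <;> assumption
  have hAY : A ∈ Y := hmin (hmin hu hv) (hmin (hmaps hu) (hmaps hv))
  have hBY : B ∈ Y := hmax (hmax hu hv) (hmax (hmaps hu) (hmaps hv))
  have hsub : Icc A B ⊆ Y := hY.out hAY hBY
  have m1 : u ∈ Icc A B := ⟨by simp [hA], by simp [hB]⟩
  have m2 : v ∈ Icc A B := ⟨by simp [hA], by simp [hB]⟩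
  have m3 : G u ∈ Icc A B := ⟨by simp [hA], by simp [hB]⟩
  have m4 : G v ∈ Icc A B := ⟨by simp [hA], by simp [hB]⟩
  rcases hG.continuousOn.strictMonoOn_of_injOn_Icc' (m1.1.trans m1.2) (hinj.mono hsub) with h | h
  · exact h.monotoneOn m3 m4 (h.monotoneOn m1 m2 huv)
  · exact h.antitoneOn m4 m3 (h.antitoneOn m1 m2 huv)

theorem MonotoneOn.closure_of_continuous {H : ℝ → ℝ} {Y : Set ℝ} (h : MonotoneOn H Y)
    (hH : Continuous H) : MonotoneOn H (closure Y) := by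
  intro u hu v hv huv
  rcases huv.eq_or_lt with rfl | huv
  · exact le_rfl
  obtain ⟨p, hp, hpu⟩ := mem_closure_iff_seq_limit.1 hu
  obtain ⟨q, hq, hqv⟩ := mem_closure_iff_seq_limit.1 hv
  refine le_of_tendsto_of_tendsto ((hH.tendsto u).comp hpu) ((hH.tendsto v).comp hqv) ?_
  filter_upwards [hpu.eventually_lt hqv huv] with n hn
  exact h (hp n) (hq n) hn.le

theorem tendsto_iterate_of_monotoneOn {H : ℝ → ℝ} {Y : Set ℝ} (h : MonotoneOn H Y)
    (hH : Continuous H) (hmaps : MapsTo H Y Y) {X : ℝ} (hb : ∀ y ∈ Y, |y| ≤ X) {c : ℝ}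
    (hc : c ∈ Y) : ∃ p, H p = p ∧ Tendsto (fun i => H^[i] c) atTop (𝓝 p) := by
  have hmem : ∀ i, H^[i] c ∈ Y := fun i => hmaps.iterate i hc
  have hex : ∃ p, Tendsto (fun i => H^[i] c) atTop (𝓝 p) := by
    rcases le_total c (H c) with hle | hle
    · have hmono : Monotone fun i => H^[i] c := by
        refine monotone_nat_of_le_succ fun i => ?_
        induction i with
        | zero => exact hle
        | succ i ih =>
          rw [Function.iterate_succ_apply', Function.iterate_succ_apply' H (i + 1)]
          exact h (hmem _) (hmem _) ih
      exact ⟨_, tendsto_atTop_ciSup hmono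
        ⟨X, by rintro _ ⟨i, rfl⟩; exact (abs_le.1 (hb _ (hmem i))).2⟩⟩
    · have hanti : Antitone fun i => H^[i] c := by
        refine antitone_nat_of_succ_le fun i => ?_
        induction i with
        | zero => exact hle
        | succ i ih =>
          have := h (hmem (i + 1)) (hmem i) ih
          rwa [← Function.iterate_succ_apply' H (i + 1), ← Function.iterate_succ_apply' H i] at this
      exact ⟨_, tendsto_atTop_ciInf hanti
        ⟨-X, by rintro _ ⟨i, rfl⟩; exact (abs_le.1 (hb _ (hmem i))).1⟩⟩
  obtain ⟨p, hp⟩ := hex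
  refine ⟨p, ?_, hp⟩
  have h1 := (hH.tendsto p).comp hp
  have h2 : Tendsto (fun i => H^[i + 1] c) atTop (𝓝 p) := hp.comp (tendsto_add_atTop_nat 1)
  refine tendsto_nhds_unique h1 (h2.congr fun i => ?_)
  exact Function.iterate_succ_apply' _ _ _

theorem IsMaxFree.exists_cycle (hl : 0 < l) (H : IsMaxFree l a X β)
    (hR : ∃ k m, 0 < k ∧ k < m ∧
      ((realMap l a)^[k] '' Ioo 0 β ∩ (realMap l a)^[m] '' Ioo 0 β).Nonempty) :
    ∃ k M p, 0 < k ∧ 0 < M ∧ (realMap l a)^[M] p = p ∧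
      Tendsto (fun i => (realMap l a)^[k + M * i] 0) atTop (𝓝 p) := by
  obtain ⟨k, m, hk, hkm, x, ⟨p, hp, hpx⟩, q, hq, hqx⟩ := hR
  obtain ⟨d, rfl⟩ := Nat.exists_eq_add_of_lt hkm
  set D := d + 1 with hD
  have hD0 : 0 < D := Nat.succ_pos d
  set I : ℕ → Set ℝ := fun i => (realMap l a)^[k + D * i] '' Ioo 0 β with hI
  set Y := ⋃ i, I i with hY
  have hshift : ∀ i, ∀ y ∈ I i, (realMap l a)^[D] y ∈ I (i + 1) := by
    rintro i _ ⟨z, hz, rfl⟩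
    refine ⟨z, hz, ?_⟩
    rw [← Function.iterate_add_apply, show D + (k + D * i) = k + D * (i + 1) by ring]
  have hpre : IsPreconnected Y := by
    refine IsPreconnected.iUnion_of_chain
      (fun i => isPreconnected_Ioo.image _ (continuous_iterate_realMap _).continuousOn) fun i => ?_
    refine ⟨(realMap l a)^[D * i] x, ?_, ?_⟩
    · exact ⟨p, hp, by rw [← hpx, ← Function.iterate_add_apply, add_comm]⟩
    · refine ⟨q, hq, ?_⟩
      rw [← hqx, ← Function.iterate_add_apply, Nat.succ_eq_succ, Nat.succ_eq_add_one,
        show D * i + (k + d + 1) = k + D * (i + 1) by simp only [hD]; ring]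
  have hfree : ∀ y ∈ Y, ∀ i, (realMap l a)^[i] y ≠ 0 ∧ |(realMap l a)^[i] y| < X := by
    intro y hy i
    obtain ⟨j, z, hz, rfl⟩ := mem_iUnion.1 hy
    rw [← Function.iterate_add_apply]
    exact H.free z hz _
  have hmaps : MapsTo (realMap l a)^[D] Y Y := by
    intro y hy
    obtain ⟨j, hj⟩ := mem_iUnion.1 hy
    exact mem_iUnion.2 ⟨j + 1, hshift j y hj⟩
  have hcont := continuous_iterate_realMap (l := l) (a := a) D
  have hmono := (monotoneOn_comp_self hpre.ordConnected hcont
    (iterate_realMap_injOn hl hpre fun y hy i _ => (hfree y hy i).1) hmaps).closure_of_continuous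
    (hcont.comp hcont)
  have hc : (realMap l a)^[k] 0 ∈ closure Y := by
    have h0 : (0 : ℝ) ∈ closure (Ioo 0 β) := by
      rw [closure_Ioo H.pos.ne]; exact ⟨le_rfl, H.pos.le⟩
    refine closure_mono ?_ (image_closure_subset_closure_image
      (continuous_iterate_realMap (l := l) (a := a) k) ⟨0, h0, rfl⟩)
    exact subset_iUnion I 0
  obtain ⟨r, hr, hlim⟩ := tendsto_iterate_of_monotoneOn hmono (hcont.comp hcont)
    ((hmaps.comp hmaps).closure (hcont.comp hcont)) (X := X)
    (fun y hy => by
      have hcl : IsClosed {y : ℝ | |y| ≤ X} := isClosed_le continuous_abs continuous_const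
      exact hcl.closure_subset_iff.2 (fun y hy => (hfree y hy 0).2.le) hy) hc
  refine ⟨k, D + D, r, hk, by omega, ?_, ?_⟩
  · rw [Function.iterate_add]; exact hr
  · refine hlim.congr fun i => ?_
    rw [← Function.iterate_add, ← Function.iterate_mul, ← Function.iterate_add_apply, add_comm]

end cycle

section omegaLimit
variable {l a X β : ℝ} {φ : ℂ → ℂ} {M₀ ρ : ℝ} {w : ℂ}

theorem GoodOrbit.exists_critical_near (hl : 0 < l) (h : IsSlitSection l a φ M₀)
    (G : GoodOrbit l a ρ w) {Xs : ℝ} (hXs : ∀ n, |((sinhMap l a)^[n] w).re| ≤ Xs)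
    (hhalf : ∀ n, ∃ b, |((sinhMap l a)^[n] w).re| / 2 ≤ b ∧
      realMap l a b ≤ ((sinhMap l a)^[n + 1] w).re) {x : ℝ}
    (hx : MapClusterPt (x : ℂ) atTop fun n => (sinhMap l a)^[n] w) {r : ℝ} (hr : 0 < r) :
    ∃ i, 0 < i ∧ (realMap l a)^[i] 0 ∈ Ioo (x - r) (x + r) := by
  have hρ := G.rho_pos
  set M := max M₀ (Xs + 2) with hM
  set R := max 1 (4 * M / ρ + 1) with hR
  have hR1 : 1 ≤ R := le_max_left _ _
  have hR0 : 0 < R := by linarith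
  have hMR : 4 * M < R * ρ := by
    have : 4 * M / ρ + 1 ≤ R := le_max_right _ _
    have : 4 * M / ρ < R := by linarith
    rwa [div_lt_iff₀ hρ] at this
  have hlim : Tendsto (fun n => R * |((sinhMap l a)^[n] w).im|) atTop (𝓝 0) := by
    simpa using G.tendsto_im.const_mul R
  have hev := hlim.eventually_lt_const (show 0 < min 1 (r / 2) by positivity)
  have hfr := (mapClusterPt_iff_frequently.1 hx (ball (x : ℂ) (r / 2))
    (ball_mem_nhds _ (half_pos hr))).and_eventually hev
  obtain ⟨n, hn1, hn2⟩ := hfr.exists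
  set z := (sinhMap l a)^[n] w with hz
  have hY : 0 < |z.im| := abs_pos.2 (G.im_ne_zero n)
  have hre : |z.re - x| < r / 2 := by
    rw [mem_ball, Complex.dist_eq] at hn1
    have := (Complex.abs_re_le_norm (z - x)).trans_lt hn1
    simpa using this
  have h1 : R * |z.im| < 1 := hn2.trans_le (min_le_left _ _)
  have h2 : R * |z.im| < r / 2 := hn2.trans_le (min_le_right _ _)
  have h3 : |z.im| ≤ R * |z.im| := le_mul_of_one_le_left hY.le hR1
  rw [abs_lt] at hre
  obtain ⟨j, hj, hret⟩ := G.exists_return hl h (n := n) (t := x - r) (e := x + r) le_rfl hR0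
    (le_max_left M₀ (Xs + 2)) hMR (by linarith) (by linarith)
    (by
      have := Complex.norm_le_abs_re_add_abs_im z
      have := hXs n
      have := G.im_lt n
      have : Xs + 2 ≤ M := le_max_right _ _
      linarith)
    (by
      have e : z.im ^ 2 = |z.im| * |z.im| := by rw [← sq, sq_abs]
      rw [← hz, e]
      have : |z.im| * |z.im| ≤ (r / 2) * (r / 2) := by gcongr <;> linarith
      nlinarith [mul_nonneg (show 0 ≤ z.re - (x - r) - r / 2 by linarith)
        (show 0 ≤ x + r - z.re - r / 2 by linarith)])
  obtain ⟨b, hb1, hb2⟩ := hhalf j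
  refine ⟨n - j, by omega, (hret b (by linarith) 0 ?_).1⟩
  have : 0 < |((sinhMap l a)^[j] w).re| := abs_pos.2 (G.re_ne_zero j)
  rw [abs_zero]
  exact abs_pos.2 (by linarith)

theorem exists_tendsto_cycle {g : ℝ → ℝ} (hg : Continuous g) {k M : ℕ} {p c : ℝ} (hM : 0 < M)
    (hlim : Tendsto (fun i => g^[k + M * i] c) atTop (𝓝 p)) (n : ℕ) :
    ∃ j, Tendsto (fun i => g^[n + M * i] c) atTop (𝓝 (g^[j] p)) := by
  have hk : k ≤ M * k := Nat.le_mul_of_pos_left k hM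
  refine ⟨n + M * k - k, (tendsto_add_atTop_iff_nat k).1 ?_⟩
  refine (((hg.iterate (n + M * k - k)).tendsto p).comp hlim).congr fun i => ?_
  simp only [Function.comp]
  rw [← Function.iterate_add_apply,
    show n + M * k - k + (k + M * i) = n + M * (i + k) by rw [mul_add]; omega]

theorem mem_cycle_of_mem_closure {g : ℝ → ℝ} (hg : Continuous g) {k M : ℕ} {p c x : ℝ}
    (hM : 0 < M) (hlim : Tendsto (fun i => g^[k + M * i] c) atTop (𝓝 p))
    (hx : ∀ r > 0, ∃ i, 0 < i ∧ g^[i] c ∈ Ioo (x - r) (x + r)) :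
    (∃ j, x = g^[j] p) ∨ ∃ i, 0 < i ∧ x = g^[i] c := by
  choose j hj using exists_tendsto_cycle hg hM hlim
  set K : Set ℝ := ⋃ n ∈ Ioc 0 M, insert (g^[j n] p) (range fun i => g^[n + M * i] c) with hK
  have hcl : IsClosed K :=
    ((finite_Ioc 0 M).isCompact_biUnion fun n _ => (hj n).isCompact_insert_range).isClosed
  have hmem : x ∈ K := by
    rw [← hcl.closure_eq, Metric.mem_closure_iff]
    intro ε hε
    obtain ⟨i, hi, h1, h2⟩ := hx ε hε
    refine ⟨g^[i] c, ?_, ?_⟩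
    · refine mem_biUnion (x := (i - 1) % M + 1) ⟨by omega, ?_⟩ (mem_insert_of_mem _ ⟨(i - 1) / M, ?_⟩)
      · exact Nat.mod_lt _ hM
      · simp only
        congr 2
        have := Nat.mod_add_div (i - 1) M
        omega
    · rw [Real.dist_eq, abs_lt]; constructor <;> linarith
  obtain ⟨n, hn, h1⟩ := mem_iUnion₂.1 hmem
  rcases h1 with h1 | ⟨i, hi⟩
  · exact Or.inl ⟨_, h1⟩
  · exact Or.inr ⟨_, by have := hn.1; omega, hi.symm⟩

theorem mem_cycle_of_eq {g : ℝ → ℝ} (hg : Continuous g) {k M : ℕ} {p c : ℝ}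
    (hM : 0 < M) (hlim : Tendsto (fun i => g^[k + M * i] c) atTop (𝓝 p)) {u d : ℕ}
    (hd : 0 < d) (hu : g^[u + d] c = g^[u] c) : ∃ j, g^[u] c = g^[j] p := by
  obtain ⟨j, hj⟩ := exists_tendsto_cycle hg hM hlim u
  have hper : ∀ t, g^[u + d * t] c = g^[u] c := by
    intro t
    induction t with
    | zero => rfl
    | succ t ih =>
      rw [show u + d * (t + 1) = d + (u + d * t) by ring, Function.iterate_add_apply, ih,
        ← Function.iterate_add_apply, add_comm, hu]
  have hsub : Tendsto (fun t : ℕ => d * t) atTop atTop :=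
    tendsto_id.const_mul_atTop' hd
  have h1 := hj.comp hsub
  refine ⟨j, tendsto_nhds_unique tendsto_const_nhds (h1.congr fun t => ?_)⟩
  simp only [Function.comp]
  rw [show M * (d * t) = d * (M * t) by ring, hper]

theorem GoodOrbit.mem_cycle (hl : 0 < l) (h : IsSlitSection l a φ M₀)
    (G : GoodOrbit l a ρ w) {Xs : ℝ} (hXs : ∀ n, |((sinhMap l a)^[n] w).re| ≤ Xs)
    (hhalf : ∀ n, ∃ b, |((sinhMap l a)^[n] w).re| / 2 ≤ b ∧
      realMap l a b ≤ ((sinhMap l a)^[n + 1] w).re) {k M : ℕ} {p : ℝ} (hM : 0 < M)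
    (hlim : Tendsto (fun i => (realMap l a)^[k + M * i] 0) atTop (𝓝 p)) {x : ℂ}
    (hx : MapClusterPt x atTop fun n => (sinhMap l a)^[n] w) :
    ∃ j, x = ((realMap l a)^[j] p : ℝ) := by
  set z : ℕ → ℂ := fun n => (sinhMap l a)^[n] w with hz
  have hnorm : ∀ n, z n ∈ closedBall (0 : ℂ) (Xs + 1) := fun n => by
    rw [mem_closedBall_zero_iff]
    have := Complex.norm_le_abs_re_add_abs_im (z n)
    have := hXs n
    have := G.im_lt n
    linarith
  have hreal : ∀ x : ℂ, MapClusterPt x atTop z → x = (x.re : ℝ) := by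
    intro x hx
    obtain ⟨ψ, hψ, hlim⟩ := MapClusterPt.tendsto_subseq hx
    have h1 := (Complex.continuous_im.tendsto x).comp hlim
    have h2 : Tendsto (fun n => (z (ψ n)).im) atTop (𝓝 0) :=
      (tendsto_zero_iff_abs_tendsto_zero _).2 (G.tendsto_im.comp hψ.tendsto_atTop)
    have := tendsto_nhds_unique h1 h2
    exact Complex.ext rfl (by simpa using this)
  have hdich : ∀ x : ℝ, MapClusterPt (x : ℂ) atTop z →
      (∃ j, x = (realMap l a)^[j] p) ∨ ∃ i, 0 < i ∧ x = (realMap l a)^[i] 0 := fun x hx =>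
    mem_cycle_of_mem_closure continuous_realMap hM hlim fun r hr =>
      G.exists_critical_near hl h hXs hhalf hx hr
  have hpre : ∀ x : ℝ, MapClusterPt (x : ℂ) atTop z →
      ∃ y : ℝ, MapClusterPt (y : ℂ) atTop z ∧ realMap l a y = x := by
    intro x hx
    obtain ⟨ψ, hψ, hlim⟩ := MapClusterPt.tendsto_subseq hx
    obtain ⟨y, -, θ, hθ, hlim'⟩ := (isCompact_closedBall (0 : ℂ) (Xs + 1)).tendsto_subseq
      fun n => hnorm (ψ (n + 1) - 1)
    have hto : Tendsto (fun n => ψ (θ n + 1) - 1) atTop atTop := by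
      refine (tendsto_sub_atTop_nat 1).comp (hψ.tendsto_atTop.comp ?_)
      exact (tendsto_add_atTop_nat 1).comp hθ.tendsto_atTop
    have hy : MapClusterPt y atTop z := MapClusterPt.of_comp hto hlim'.mapClusterPt
    have hyr := hreal y hy
    refine ⟨y.re, hyr ▸ hy, ?_⟩
    have h1 := ((continuous_sinhMap (l := l) (a := a)).tendsto y).comp hlim'
    have h2 : Tendsto (fun n => z (ψ (θ n + 1))) atTop (𝓝 (x : ℂ)) :=
      hlim.comp ((tendsto_add_atTop_nat 1).comp hθ.tendsto_atTop)
    have h3 : sinhMap l a y = x := by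
      refine tendsto_nhds_unique (h1.congr fun n => ?_) h2
      simp only [Function.comp, hz]
      have hpos : 0 < ψ (θ n + 1) := (Nat.zero_le _).trans_lt (hψ (Nat.succ_pos (θ n)))
      rw [← Function.iterate_succ_apply' (sinhMap l a)]
      congr 2
      omega
    rw [hyr, sinhMap_ofReal] at h3
    exact_mod_cast h3
  have hcrit : ∀ i, 0 < i → MapClusterPt (((realMap l a)^[i] 0 : ℝ) : ℂ) atTop z →
      ∃ j, (realMap l a)^[i] 0 = (realMap l a)^[j] p := by
    intro i
    induction i using Nat.strong_induction_on with
    | _ i ih =>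
    intro hi hc
    obtain ⟨y, hy, hyi⟩ := hpre _ hc
    rcases hdich y hy with ⟨j, hj⟩ | ⟨m, hm, hym⟩
    · exact ⟨j + 1, by rw [← hyi, hj, Function.iterate_succ_apply']⟩
    · have e : (realMap l a)^[m + 1] 0 = (realMap l a)^[i] 0 := by
        rw [Function.iterate_succ_apply', ← hym, hyi]
      rcases lt_trichotomy (m + 1) i with h1 | h1 | h1
      · rw [← e]
        refine mem_cycle_of_eq continuous_realMap hM hlim (d := i - (m + 1)) (by omega) ?_
        rw [show m + 1 + (i - (m + 1)) = i by omega, e]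
      · obtain ⟨j, hj⟩ := ih m (by omega) hm (hym ▸ hy)
        exact ⟨j + 1, by rw [← e, Function.iterate_succ_apply', hj, Function.iterate_succ_apply']⟩
      · refine mem_cycle_of_eq continuous_realMap hM hlim (d := m + 1 - i) (by omega) ?_
        rw [show i + (m + 1 - i) = m + 1 by omega, e]
  have hxr := hreal x hx
  rw [hxr] at hx ⊢
  rcases hdich _ hx with ⟨j, hj⟩ | ⟨i, hi, hxi⟩
  · exact ⟨j, by rw [← hj]⟩
  · obtain ⟨j, hj⟩ := hcrit i hi (hxi ▸ hx)
    exact ⟨j, by rw [← hj, ← hxi]⟩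

end omegaLimit

section localDynamics
variable {h : ℂ → ℂ} {p : ℂ} {ζ : ℕ → ℂ}

theorem exists_invariant_of_norm_le {δ : ℝ} (hδ : 0 < δ)
    (hle : ∀ z ∈ ball p δ, ‖h z - p‖ ≤ ‖z - p‖)
    (hlim : Tendsto ζ atTop (𝓝 p)) :
    ∃ D, IsOpen D ∧ Bornology.IsBounded D ∧ MapsTo h D D ∧
      ∀ᶠ k in atTop, segment ℝ (ζ k) (ζ (k + 1)) ⊆ D := by
  refine ⟨ball p δ, isOpen_ball, isBounded_ball, fun z hz => ?_, ?_⟩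
  · have := hle z hz
    rw [mem_ball_iff_norm] at hz ⊢
    linarith
  · have h1 := hlim.eventually (ball_mem_nhds p hδ)
    have h2 := (hlim.comp (tendsto_add_atTop_nat 1)).eventually (ball_mem_nhds p hδ)
    filter_upwards [h1, h2] with k hk1 hk2
    exact (convex_ball p δ).segment_subset hk1 hk2

theorem not_tendsto_of_norm_ge {δ : ℝ} (hδ : 0 < δ)
    (hge : ∀ z ∈ ball p δ, ‖z - p‖ ≤ ‖h z - p‖) (hζ : ∀ k, ζ (k + 1) = h (ζ k))
    (hne : ∀ k, ζ k ≠ p) : ¬Tendsto ζ atTop (𝓝 p) := by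
  intro hlim
  obtain ⟨k, hk⟩ := eventually_atTop.1 (hlim.eventually (ball_mem_nhds p hδ))
  have hmono : ∀ j, ‖ζ k - p‖ ≤ ‖ζ (j + k) - p‖ := by
    intro j
    induction j with
    | zero => simp
    | succ j ih =>
      rw [show j + 1 + k = j + k + 1 by ring, hζ]
      exact ih.trans (hge _ (hk _ (by omega)))
  have h1 : Tendsto (fun j => ‖ζ (j + k) - p‖) atTop (𝓝 0) := by
    have := ((hlim.comp (tendsto_add_atTop_nat k)).sub_const p).norm
    simpa using this
  have := ge_of_tendsto' h1 hmono
  exact hne k (sub_eq_zero.1 (norm_le_zero_iff.1 this))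

/-- The normal form at a fixed point of multiplier one, in the coordinate `(z - p)⁻ʳ`. -/
theorem exists_parabolic_coordinate (hd : Differentiable ℂ h) (hp : h p = p)
    (hder : deriv h p = 1) (hid : h ≠ id) :
    ∃ r : ℕ, 0 < r ∧ ∃ τ : ℂ, τ ≠ 0 ∧ ∃ δ > 0, ∀ z ∈ ball p δ, z ≠ p → ∀ t ∈ Icc (0 : ℝ) 1,
      z + t * (h z - z) ≠ p ∧
      ‖((z + t * (h z - z) - p) ^ r)⁻¹ - ((z - p) ^ r)⁻¹ - t * τ‖ ≤ t * (‖τ‖ / 2) := by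
  have han : AnalyticAt ℂ (fun z => h z - z) p :=
    ((hd.analyticAt p).sub analyticAt_id)
  have hnz : ¬∀ᶠ z in 𝓝 p, h z - z = 0 := by
    intro hev
    refine hid ?_
    refine AnalyticOnNhd.eq_of_eventuallyEq (z₀ := p) (fun z _ => hd.analyticAt z)
      (fun z _ => analyticAt_id) ?_
    filter_upwards [hev] with z hz
    exact sub_eq_zero.1 hz
  obtain ⟨n, G, hG, hG0, hn⟩ := han.exists_eventuallyEq_pow_smul_nonzero_iff.2 hnz
  have hn2 : 2 ≤ n := by
    by_contra hlt
    have : n = 0 ∨ n = 1 := by omega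
    rcases this with rfl | rfl
    · have := hn.self_of_nhds
      simp [hp] at this
      exact hG0 this.symm
    · have h1 : HasDerivAt (fun z => h z - z) (deriv h p - 1) p :=
        (hd p).hasDerivAt.sub (hasDerivAt_id p)
      have h2 : HasDerivAt (fun z => (z - p) ^ 1 • G z) (G p) p := by
        have := ((hasDerivAt_id p).sub_const p).fun_mul hG.differentiableAt.hasDerivAt
        simpa using this
      have := h1.unique (h2.congr_of_eventuallyEq hn)
      rw [hder, sub_self] at this
      exact hG0 this.symm
  obtain ⟨r, rfl⟩ : ∃ r, n = r + 1 := ⟨n - 1, by omega⟩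
  have hr : 0 < r := by omega
  have hrC : (r : ℂ) ≠ 0 := by exact_mod_cast hr.ne'
  set q : ℂ → ℂ := fun s => ((1 + s) ^ r)⁻¹ with hq
  have hqd : HasDerivAt q (-(r : ℂ)) 0 := by
    have h1 : HasDerivAt (fun s : ℂ => (1 + s) ^ r) (r : ℂ) 0 := by
      have := ((hasDerivAt_id (0 : ℂ)).const_add 1).fun_pow r
      simpa using this
    have := h1.fun_inv (by simp)
    simpa using this
  have hslope : Tendsto (dslope q 0) (𝓝 0) (𝓝 (-(r : ℂ))) := by
    have := (continuousAt_dslope_same.2 hqd.differentiableAt).tendsto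
    rwa [dslope_same, hqd.deriv] at this
  set τ : ℂ := G p * -(r : ℂ) with hτ
  have hτ0 : τ ≠ 0 := mul_ne_zero hG0 (neg_ne_zero.2 hrC)
  have hprod : ∀ᶠ x : ℂ × ℂ in 𝓝 (G p) ×ˢ 𝓝 (-(r : ℂ)), dist (x.1 * x.2) τ < ‖τ‖ / 2 := by
    rw [← nhds_prod_eq]
    exact (continuous_mul.tendsto (G p, -(r : ℂ))).eventually
      (ball_mem_nhds _ (by positivity))
  obtain ⟨P, hP, Q, hQ, hPQ⟩ := eventually_prod_iff.1 hprod
  obtain ⟨η, hη, hηQ⟩ := Metric.eventually_nhds_iff_ball.1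
    ((hslope.eventually hQ).and (eventually_norm_sub_lt (0 : ℂ) one_pos))
  have hs : Tendsto (fun z => (z - p) ^ r * G z) (𝓝 p) (𝓝 0) := by
    have := (((continuous_id.sub continuous_const).pow r).tendsto p (f := fun z : ℂ => (z - p) ^ r)).mul
      hG.continuousAt.tendsto
    simpa [hr.ne'] using this
  obtain ⟨δ, hδ, hδP⟩ := Metric.eventually_nhds_iff_ball.1
    ((hn.and (hG.continuousAt.tendsto.eventually hP)).and (hs.eventually (ball_mem_nhds 0 hη)))
  refine ⟨r, hr, τ, hτ0, δ, hδ, fun z hz hzp t ht => ?_⟩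
  obtain ⟨⟨e, hPz⟩, hsz⟩ := hδP z hz
  set u := z - p with hu
  have hu0 : u ≠ 0 := sub_ne_zero.2 hzp
  set s := u ^ r * G z with hsdef
  have hts : (t : ℂ) * s ∈ ball (0 : ℂ) η := by
    rw [dist_zero_right] at hsz
    rw [mem_ball_zero_iff, norm_mul, Complex.norm_real, Real.norm_eq_abs, abs_of_nonneg ht.1]
    exact (mul_le_of_le_one_left (norm_nonneg _) ht.2).trans_lt hsz
  obtain ⟨hQt, hsmall⟩ := hηQ _ hts
  have h1ts : (1 : ℂ) + t * s ≠ 0 := by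
    intro h0
    have : (t : ℂ) * s = -1 := by linear_combination h0
    rw [this] at hsmall
    simp at hsmall
  have ez : z + t * (h z - z) - p = u * (1 + t * s) := by
    have e' : h z - z = u ^ (r + 1) * G z := e
    rw [e', hsdef, hu]; ring
  refine ⟨fun h0 => ?_, ?_⟩
  · rw [h0, sub_self] at ez
    exact mul_ne_zero hu0 h1ts ez.symm
  · have hsl : (t : ℂ) * s * dslope q 0 (t * s) = q (t * s) - 1 := by
      have := sub_smul_dslope q 0 ((t : ℂ) * s)
      simpa [hq] using this
    have hmain : ((u * (1 + t * s)) ^ r)⁻¹ - (u ^ r)⁻¹ = t * (G z * dslope q 0 (t * s)) := by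
      have h2 : ((u * (1 + t * s)) ^ r)⁻¹ = (u ^ r)⁻¹ * q (t * s) := by
        rw [mul_pow, mul_inv]
      have hur : u ^ r ≠ 0 := pow_ne_zero _ hu0
      rw [h2, show (u ^ r)⁻¹ * q (t * s) - (u ^ r)⁻¹ = (u ^ r)⁻¹ * (q (t * s) - 1) by ring, ← hsl,
        hsdef]
      field_simp
    rw [ez, hmain, ← mul_sub, norm_mul, Complex.norm_real, Real.norm_eq_abs, abs_of_nonneg ht.1]
    refine mul_le_mul_of_nonneg_left ?_ ht.1
    have := hPQ hPz hQt
    rw [dist_eq_norm] at this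
    exact this.le

theorem exists_invariant_of_parabolic (hd : Differentiable ℂ h) (hp : h p = p)
    (hder : deriv h p = 1) (hid : h ≠ id) (hζ : ∀ k, ζ (k + 1) = h (ζ k)) (hne : ∀ k, ζ k ≠ p)
    (hlim : Tendsto ζ atTop (𝓝 p)) :
    ∃ D, IsOpen D ∧ Bornology.IsBounded D ∧ MapsTo h D D ∧
      ∀ᶠ k in atTop, segment ℝ (ζ k) (ζ (k + 1)) ⊆ D := by
  obtain ⟨r, hr, τ, hτ, δ, hδ, H⟩ := exists_parabolic_coordinate hd hp hder hid
  have hτn : 0 < ‖τ‖ := norm_pos_iff.2 hτ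
  set F : ℂ → ℝ := fun z => (((z - p) ^ r)⁻¹ * (starRingEnd ℂ) τ).re with hF
  have hττ : (τ * (starRingEnd ℂ) τ).re = ‖τ‖ ^ 2 := by
    rw [Complex.mul_conj, Complex.ofReal_re, Complex.normSq_eq_norm_sq]
  have hstep : ∀ z ∈ ball p δ, z ≠ p → ∀ t ∈ Icc (0 : ℝ) 1,
      z + t * (h z - z) ≠ p ∧ F z + t * (‖τ‖ ^ 2 / 2) ≤ F (z + t * (h z - z)) := by
    intro z hz hzp t ht
    obtain ⟨h1, h2⟩ := H z hz hzp t ht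
    refine ⟨h1, ?_⟩
    set E := ((z + t * (h z - z) - p) ^ r)⁻¹ - ((z - p) ^ r)⁻¹ - t * τ with hE
    have e : F (z + t * (h z - z)) = F z + t * ‖τ‖ ^ 2 + (E * (starRingEnd ℂ) τ).re := by
      rw [← hττ, ← Complex.re_ofReal_mul, hF]
      simp only
      rw [← Complex.add_re, ← Complex.add_re]
      congr 1
      rw [hE]; ring
    have h3 : |(E * (starRingEnd ℂ) τ).re| ≤ t * (‖τ‖ / 2) * ‖τ‖ := by
      refine (Complex.abs_re_le_norm _).trans ?_
      rw [norm_mul, RCLike.norm_conj]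
      gcongr
    rw [e]
    have := (abs_le.1 h3).1
    nlinarith
  set Mb := ‖τ‖ / δ ^ r with hMb
  set D := {p}ᶜ ∩ F ⁻¹' Ioi Mb with hD
  have hDball : D ⊆ ball p δ := by
    rintro z ⟨hzp, hz⟩
    have hzp' : 0 < ‖z - p‖ := norm_pos_iff.2 (sub_ne_zero.2 hzp)
    have h1 : F z ≤ (‖z - p‖ ^ r)⁻¹ * ‖τ‖ := by
      refine (Complex.re_le_norm _).trans_eq ?_
      rw [norm_mul, RCLike.norm_conj, norm_inv, norm_pow]
    have h2 : ‖τ‖ / δ ^ r < (‖z - p‖ ^ r)⁻¹ * ‖τ‖ := lt_of_lt_of_le hz h1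
    rw [mem_ball_iff_norm]
    by_contra hge
    rw [not_lt] at hge
    have h3 : δ ^ r ≤ ‖z - p‖ ^ r := by gcongr
    have h4 : (‖z - p‖ ^ r)⁻¹ ≤ (δ ^ r)⁻¹ := inv_anti₀ (by positivity) h3
    have := mul_le_mul_of_nonneg_right h4 hτn.le
    rw [div_eq_inv_mul] at h2
    linarith
  have hseg : ∀ z ∈ D, ∀ t ∈ Icc (0 : ℝ) 1, z + t * (h z - z) ∈ D := by
    intro z hz t ht
    obtain ⟨h1, h2⟩ := hstep z (hDball hz) hz.1 t ht
    refine ⟨h1, lt_of_lt_of_le hz.2 (le_trans ?_ h2)⟩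
    have := mul_nonneg ht.1 (by positivity : 0 ≤ ‖τ‖ ^ 2 / 2)
    linarith
  refine ⟨D, ?_, isBounded_ball.subset hDball, fun z hz => ?_, ?_⟩
  · refine ContinuousOn.isOpen_inter_preimage ?_ isOpen_compl_singleton isOpen_Ioi
    refine Complex.continuous_re.comp_continuousOn (ContinuousOn.mul ?_ continuousOn_const)
    refine ContinuousOn.inv₀ (by fun_prop) fun z hz => pow_ne_zero _ (sub_ne_zero.2 hz)
  · have := hseg z hz 1 ⟨zero_le_one, le_rfl⟩
    simpa using this
  · obtain ⟨k, hk⟩ := eventually_atTop.1 (hlim.eventually (ball_mem_nhds p hδ))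
    have hgrow : ∀ j : ℕ, F (ζ k) + j * (‖τ‖ ^ 2 / 2) ≤ F (ζ (j + k)) := by
      intro j
      induction j with
      | zero => simp
      | succ j ih =>
        have := (hstep _ (hk (j + k) (by omega)) (hne _) 1 ⟨zero_le_one, le_rfl⟩).2
        rw [show j + 1 + k = j + k + 1 by ring, hζ]
        push_cast at this ⊢
        rw [one_mul, one_mul, add_sub_cancel] at this
        linarith
    obtain ⟨j0, hj0⟩ := exists_nat_gt ((Mb - F (ζ k)) / (‖τ‖ ^ 2 / 2))
    rw [div_lt_iff₀ (by positivity)] at hj0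
    refine eventually_atTop.2 ⟨j0 + k, fun n hn => ?_⟩
    have hnD : ζ n ∈ D := by
      refine ⟨hne n, ?_⟩
      obtain ⟨j, rfl⟩ : ∃ j, n = j + k := ⟨n - k, by omega⟩
      have h1 : (j0 : ℝ) ≤ j := by exact_mod_cast (by omega : j0 ≤ j)
      have := mul_le_mul_of_nonneg_right h1 (by positivity : 0 ≤ ‖τ‖ ^ 2 / 2)
      have := hgrow j
      simp only [mem_preimage, mem_Ioi]
      linarith
    rw [segment_eq_image']
    rintro _ ⟨t, ht, rfl⟩
    have := hseg _ hnD t ht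
    rw [hζ]
    simpa using this

theorem exists_invariant_of_tendsto (hd : Differentiable ℂ h) (hp : h p = p) {ν : ℝ}
    (hν : 0 ≤ ν) (hder : deriv h p = ν) (hid : h ≠ id) (hζ : ∀ k, ζ (k + 1) = h (ζ k))
    (hne : ∀ k, ζ k ≠ p) (hlim : Tendsto ζ atTop (𝓝 p)) :
    ∃ D, IsOpen D ∧ Bornology.IsBounded D ∧ MapsTo h D D ∧
      ∀ᶠ k in atTop, segment ℝ (ζ k) (ζ (k + 1)) ⊆ D := by
  have hbound : ∀ c > 0, ∃ δ > 0, ∀ z ∈ ball p δ, ‖h z - p - ν * (z - p)‖ ≤ c * ‖z - p‖ := by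
    intro c hc
    have h1 := (hasDerivAt_iff_isLittleO.1 (hd p).hasDerivAt).bound hc
    obtain ⟨δ, hδ, H⟩ := Metric.eventually_nhds_iff_ball.1 h1
    refine ⟨δ, hδ, fun z hz => ?_⟩
    have := H z hz
    rw [hp, hder, smul_eq_mul, mul_comm] at this
    exact this
  have hνn : ∀ z : ℂ, ‖(ν : ℂ) * (z - p)‖ = ν * ‖z - p‖ := fun z => by
    rw [norm_mul, Complex.norm_real, Real.norm_eq_abs, abs_of_nonneg hν]
  rcases lt_trichotomy ν 1 with h1 | h1 | h1
  · obtain ⟨δ, hδ, H⟩ := hbound (1 - ν) (by linarith)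
    refine exists_invariant_of_norm_le hδ (fun z hz => ?_) hlim
    have h2 := H z hz
    have h3 := norm_add_le (h z - p - ν * (z - p)) (ν * (z - p))
    rw [sub_add_cancel, hνn] at h3
    linarith
  · subst h1
    exact exists_invariant_of_parabolic hd hp (by simpa using hder) hid hζ hne hlim
  · obtain ⟨δ, hδ, H⟩ := hbound (ν - 1) (by linarith)
    refine absurd hlim (not_tendsto_of_norm_ge hδ (fun z hz => ?_) hζ hne)
    have h2 := H z hz
    have h3 := norm_sub_le (h z - p) (h z - p - ν * (z - p))
    rw [sub_sub_cancel, hνn] at h3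
    linarith

end localDynamics

section noTame
variable {l a : ℝ} {w : ℂ} {W : Set ℂ}

theorem tendsto_of_finite_clusterPts {h : ℂ → ℂ} (hh : Continuous h) {ζ : ℕ → ℂ}
    (hζ : ∀ k, ζ (k + 1) = h (ζ k)) {K S : Set ℂ} (hK : IsCompact K) (hmem : ∀ k, ζ k ∈ K)
    (hS : S.Finite) (hcl : ∀ x, MapClusterPt x atTop ζ → x ∈ S) (hfix : ∀ x ∈ S, h x = x) :
    ∃ p ∈ S, Tendsto ζ atTop (𝓝 p) := by
  obtain ⟨p, -, hp⟩ := hK.exists_mapClusterPt (f := atTop) (u := ζ)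
    (tendsto_principal.2 (Eventually.of_forall hmem))
  have hpS := hcl p hp
  refine ⟨p, hpS, ?_⟩
  obtain ⟨r, hr, hrS⟩ := Metric.mem_nhds_iff.1
    ((hS.subset (sdiff_subset (t := {p}))).isClosed.isOpen_compl.mem_nhds
      (show p ∈ (S \ {p})ᶜ by simp))
  rw [Metric.tendsto_atTop]
  intro ε hε
  obtain ⟨s', hs', hcont⟩ := Metric.continuousAt_iff.1 (hh.continuousAt (x := p)) (r / 2)
    (half_pos hr)
  set s := min (min s' ε) (r / 2) with hs
  have hs0 : 0 < s := by positivity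
  have hA : ∀ᶠ k in atTop, ¬(s ≤ dist (ζ k) p ∧ dist (ζ k) p ≤ r / 2) := by
    by_contra hcon
    have hcpt : IsCompact (closedBall p (r / 2) ∩ (ball p s)ᶜ) :=
      (isCompact_closedBall p (r / 2)).inter_right isOpen_ball.isClosed_compl
    obtain ⟨x, hx, hxc⟩ := hcpt.exists_mapClusterPt_of_frequently (l := atTop) (f := ζ) (by
      refine (not_eventually.1 hcon).mono fun k hk => ?_
      rw [not_not] at hk
      exact ⟨hk.2, fun hlt => absurd (mem_ball.1 hlt) (not_lt.2 hk.1)⟩)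
    have hxS := hcl x hxc
    have hxr : x ∈ ball p r := closedBall_subset_ball (half_lt_self hr) hx.1
    have := hrS hxr
    rw [mem_compl_iff, Set.mem_sdiff, not_and_not_right] at this
    have hxp : x = p := this hxS
    rw [hxp] at hx
    exact hx.2 (mem_ball_self hs0)
  obtain ⟨k1, hk1⟩ := eventually_atTop.1 hA
  obtain ⟨k0, hk0, hk01⟩ := ((mapClusterPt_iff_frequently.1 hp _
    (ball_mem_nhds p hs0)).and_eventually (eventually_ge_atTop k1)).exists
  have hind : ∀ j, dist (ζ (k0 + j)) p < s := by
    intro j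
    induction j with
    | zero => exact hk0
    | succ j ih =>
      have h1 := hcont (ih.trans_le ((min_le_left _ _).trans (min_le_left _ _)))
      rw [hfix p hpS, ← hζ] at h1
      by_contra hge
      exact hk1 (k0 + j + 1) (by omega) ⟨not_lt.1 hge, h1.le⟩
  refine ⟨k0, fun n hn => ?_⟩
  have := hind (n - k0)
  rw [show k0 + (n - k0) = n by omega] at this
  exact this.trans_le ((min_le_left _ _).trans (min_le_right _ _))

theorem subset_fatouSet_of_mapsTo_iterate {f : ℂ → ℂ} (hf : Differentiable ℂ f) {M : ℕ}
    (hM : 0 < M) {D : Set ℂ} (hD : IsOpen D) (hb : Bornology.IsBounded D)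
    (hmaps : MapsTo f^[M] D D) : D ⊆ FatouSet f := by
  have hcpt : IsCompact (closure D) := hb.isCompact_closure
  have hbd : ∀ r, ∃ C, ∀ z ∈ closure D, ‖f^[r] z‖ ≤ C := fun r =>
    hcpt.exists_bound_of_continuousOn (hf.continuous.iterate r).continuousOn
  choose C hC using hbd
  refine subset_fatouSet_of_bounded hf hD
    (M := ∑ r ∈ Finset.range M, |C r|) fun z hz n => ?_
  rw [← Nat.mod_add_div n M, Function.iterate_add_apply, Function.iterate_mul]
  refine (hC _ _ (subset_closure (hmaps.iterate _ hz))).trans ((le_abs_self _).trans ?_)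
  exact Finset.single_le_sum (f := fun r => |C r|) (fun r _ => abs_nonneg _)
    (Finset.mem_range.2 (Nat.mod_lt _ hM))

theorem iterate_sinhMap_ne_id {M : ℕ} (hM : 0 < M) : (sinhMap l a)^[M] ≠ id := by
  intro hid
  obtain ⟨n, rfl⟩ := Nat.exists_eq_succ_of_ne_zero hM.ne'
  have h1 := congrFun hid 1
  have h2 := congrFun hid (-1)
  rw [Function.iterate_succ_apply, sinhMap_neg, ← Function.iterate_succ_apply, h1] at h2
  norm_num at h2

theorem exists_deriv_iterate_ofReal (M : ℕ) (p : ℝ) :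
    ∃ ν : ℝ, deriv (sinhMap l a)^[M] p = ν := by
  have h1 : HasDerivAt (realMap l a)^[M] (deriv (realMap l a)^[M] p) p :=
    ((differentiable_realMap (l := l) (a := a)).iterate M p).hasDerivAt
  have h2 := h1.ofReal_comp
  have h3 := ((differentiable_iterate (differentiable_sinhMap (l := l) (a := a)) M
    (p : ℂ)).hasDerivAt).comp_ofReal
  refine ⟨_, h3.unique (h2.congr_of_eventuallyEq (Eventually.of_forall fun x => ?_))⟩
  simp only
  rw [iterate_sinhMap_ofReal]

theorem IsTame.not_tendsto_of_same_sign (hl : 0 < l) (hW : IsWanderingDomain (sinhMap l a) W)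
    (hT : IsTame (sinhMap l a) W w) {M : ℕ} (hM : 0 < M) {p ν : ℝ}
    (hp : (sinhMap l a)^[M] p = p) (hν : 0 ≤ ν) (hder : deriv (sinhMap l a)^[M] p = ν)
    (hsign : ∃ᶠ k in atTop,
      0 < ((sinhMap l a)^[M * k] w).im * ((sinhMap l a)^[M * (k + 1)] w).im) :
    ¬Tendsto (fun k => (sinhMap l a)^[M * k] w) atTop (𝓝 (p : ℂ)) := by
  intro hlim
  obtain ⟨D, hDo, hDb, hDm, hseg⟩ := exists_invariant_of_tendsto
    (differentiable_iterate differentiable_sinhMap M) hp hν hder (iterate_sinhMap_ne_id hM)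
    (ζ := fun k => (sinhMap l a)^[M * k] w)
    (fun k => by
      rw [← Function.iterate_add_apply, show M * (k + 1) = M + M * k by ring])
    (fun k h0 => hT.im_ne_zero (M * k) (by rw [h0, Complex.ofReal_im])) hlim
  have hDF := subset_fatouSet_of_mapsTo_iterate differentiable_sinhMap hM hDo hDb hDm
  obtain ⟨k, hk1, hk2⟩ := (hsign.and_eventually hseg).exists
  obtain ⟨ρ, hρ, N, hN, -⟩ := hT
  have hmem : ∀ n, (sinhMap l a)^[n] w ∈ (sinhMap l a)^[n + N] '' W := by
    intro n
    obtain ⟨v, hv, hvw⟩ := hN (mem_ball_self hρ)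
    exact ⟨v, hv, by rw [Function.iterate_add_apply, hvw]⟩
  set z := (sinhMap l a)^[M * k] w with hz
  set z' := (sinhMap l a)^[M * (k + 1)] w with hz'
  have hne : ∀ y ∈ segment ℝ z z', y.im ≠ 0 := by
    rintro y ⟨s, t, hs, ht, hst, rfl⟩ h0
    simp at h0
    have h1 : 0 < z.im ^ 2 := by
      have : z.im ≠ 0 := fun h => by rw [h, zero_mul] at hk1; exact lt_irrefl _ hk1
      positivity
    have h2 : s * z.im ^ 2 + t * (z.im * z'.im) = 0 := by linear_combination z.im * h0
    rcases hs.eq_or_lt with h3 | h3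
    · have : t = 1 := by linarith
      rw [← h3, this] at h2
      linarith
    · have := mul_pos h3 h1
      have := mul_nonneg ht hk1.le
      linarith
  have hsub := subset_image_iterate hl hW (convex_segment z z').isPreconnected
    (hk2.trans hDF) hne (left_mem_segment ℝ z z') (hmem (M * k))
  refine hW.not_mem_of_mem (m := M * k + N) (n := M * (k + 1) + N) ?_
    (hsub (right_mem_segment ℝ z z')) (hmem _)
  rw [mul_add, mul_one]
  omega

theorem no_tame (hl : 0 < l) (hW : IsWanderingDomain (sinhMap l a) W)
    (hT : IsTame (sinhMap l a) W w) : False := by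
  obtain ⟨Xs, hXs0, hgood⟩ := hT.exists_goodOrbit hl
  obtain ⟨D, hD, hshadow⟩ := exists_shadow_half hl a hXs0
  have hD0 : 0 < D := by linarith
  obtain ⟨w', ρ, hT', G, hor⟩ := hgood (1 / D) (by positivity)
  have hXs := fun n => (hor n).1
  have hhalf : ∀ n, ∃ b, |((sinhMap l a)^[n] w').re| / 2 ≤ b ∧
      realMap l a b ≤ ((sinhMap l a)^[n + 1] w').re := by
    intro n
    rw [Function.iterate_succ_apply']
    refine hshadow _ (G.re_ne_zero n) (hXs n) (G.im_lt n).le ?_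
    have := (hor n).2
    rw [one_div, inv_mul_eq_div, le_div_iff₀ hD0] at this
    linarith
  obtain ⟨X, hX0, hX⟩ := exists_realMap_growth hl a
  obtain ⟨φ, M₀, hφ⟩ := exists_isSlitSection hl a
  obtain ⟨β, H⟩ := exists_isMaxFree (G.exists_freeOrbit hl hφ hXs0 hXs hhalf hX)
  obtain ⟨k, M, q, -, hM, hq, hlim⟩ := H.exists_cycle hl (H.exists_inter hl hφ hX)
  have hcyc := fun x hx => G.mem_cycle hl hφ hXs hhalf hM hlim (x := x) hx
  have hto : Tendsto (fun k => M * k) atTop atTop := tendsto_id.const_mul_atTop' hM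
  have hper : Function.IsPeriodicPt (realMap l a) M q := hq
  obtain ⟨p, ⟨j, hj, rfl⟩, hp⟩ := tendsto_of_finite_clusterPts (h := (sinhMap l a)^[M])
    (ζ := fun k => (sinhMap l a)^[M * k] w')
    (S := (fun j => (((realMap l a)^[j] q : ℝ) : ℂ)) '' Iio M)
    (continuous_sinhMap.iterate M)
    (fun k => by
      rw [← Function.iterate_add_apply, show M * (k + 1) = M + M * k by ring])
    (isCompact_closedBall (0 : ℂ) (Xs + 1))
    (fun k => by
      rw [mem_closedBall_zero_iff]
      have := Complex.norm_le_abs_re_add_abs_im ((sinhMap l a)^[M * k] w')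
      have := hXs (M * k)
      have := G.im_lt (M * k)
      linarith)
    ((finite_Iio M).image _)
    (fun x hx => by
      obtain ⟨j, rfl⟩ := hcyc x (MapClusterPt.of_comp hto hx)
      exact ⟨j % M, Nat.mod_lt _ hM, by simp only; rw [hper.iterate_mod_apply]⟩)
    (by
      rintro _ ⟨j, -, rfl⟩
      simp only
      rw [iterate_sinhMap_ofReal, ← Function.iterate_add_apply, add_comm,
        Function.iterate_add_apply, hq])
  simp only at hp
  set r := (realMap l a)^[j] q with hr
  have hfix : (sinhMap l a)^[M] (r : ℂ) = r := by
    rw [iterate_sinhMap_ofReal, hr, ← Function.iterate_add_apply, add_comm,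
      Function.iterate_add_apply, hq]
  obtain ⟨ν, hν⟩ := exists_deriv_iterate_ofReal (l := l) (a := a) M r
  -- pass to the doubled period, for which the multiplier is nonnegative
  have hfix2 : (sinhMap l a)^[M + M] (r : ℂ) = r := by
    rw [Function.iterate_add_apply, hfix, hfix]
  have hν2 : deriv (sinhMap l a)^[M + M] (r : ℂ) = ((ν * ν : ℝ) : ℂ) := by
    have hd := differentiable_iterate (differentiable_sinhMap (l := l) (a := a)) M
    rw [Function.iterate_add, deriv_comp _ (hd _) (hd _), hfix, hν, Complex.ofReal_mul]
  have hfix4 : (sinhMap l a)^[M + M + (M + M)] (r : ℂ) = r := by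
    rw [Function.iterate_add_apply, hfix2, hfix2]
  have hν4 : deriv (sinhMap l a)^[M + M + (M + M)] (r : ℂ) = ((ν * ν * (ν * ν) : ℝ) : ℂ) := by
    have hd := differentiable_iterate (differentiable_sinhMap (l := l) (a := a)) (M + M)
    rw [Function.iterate_add _ (M + M), deriv_comp _ (hd _) (hd _), hfix2, hν2,
      ← Complex.ofReal_mul]
  have hp2 : Tendsto (fun k => (sinhMap l a)^[(M + M) * k] w') atTop (𝓝 (r : ℂ)) := by
    refine (hp.comp (tendsto_id.const_mul_atTop' two_pos)).congr fun k => ?_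
    simp only [Function.comp, id]
    rw [show M * (2 * k) = (M + M) * k by ring]
  have hp4 : Tendsto (fun k => (sinhMap l a)^[(M + M + (M + M)) * k] w') atTop (𝓝 (r : ℂ)) := by
    refine (hp2.comp (tendsto_id.const_mul_atTop' two_pos)).congr fun k => ?_
    simp only [Function.comp, id]
    rw [show (M + M) * (2 * k) = (M + M + (M + M)) * k by ring]
  by_cases hs : ∃ᶠ k in atTop,
      0 < ((sinhMap l a)^[(M + M) * k] w').im * ((sinhMap l a)^[(M + M) * (k + 1)] w').im
  · exact hT'.not_tendsto_of_same_sign hl hW (by omega) hfix2 (mul_self_nonneg ν) hν2 hs hp2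
  · rw [not_frequently] at hs
    obtain ⟨k0, hk0⟩ := eventually_atTop.1 hs
    refine hT'.not_tendsto_of_same_sign hl hW (by omega) hfix4 (mul_self_nonneg (ν * ν)) hν4
      (Eventually.frequently ?_) hp4
    refine eventually_atTop.2 ⟨k0, fun k hk => ?_⟩
    have h1 := hk0 (2 * k) (by omega)
    have h2 := hk0 (2 * k + 1) (by omega)
    rw [not_lt] at h1 h2
    rw [show (M + M) * (2 * k) = (M + M + (M + M)) * k by ring] at h1
    rw [show (M + M) * (2 * k + 1 + 1) = (M + M + (M + M)) * (k + 1) by ring] at h2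
    set x := ((sinhMap l a)^[(M + M + (M + M)) * k] w').im with hx
    set y := ((sinhMap l a)^[(M + M) * (2 * k + 1)] w').im with hy
    set z := ((sinhMap l a)^[(M + M + (M + M)) * (k + 1)] w').im with hz
    have hx0 : x ≠ 0 := G.im_ne_zero _
    have hy0 : y ≠ 0 := G.im_ne_zero _
    have hz0 : z ≠ 0 := G.im_ne_zero _
    have h3 := mul_nonneg_of_nonpos_of_nonpos h1 h2
    have hy2 : 0 < y ^ 2 := by positivity
    have h4 : 0 ≤ (x * z) * y ^ 2 := by linarith [show x * y * (y * z) = x * z * y ^ 2 by ring]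
    exact (nonneg_of_mul_nonneg_left h4 hy2).lt_of_ne (mul_ne_zero hx0 hz0).symm

end noTame

section enclosure

theorem exists_primitive_ball {F : ℂ → ℂ} {x : ℂ} {r : ℝ} (hF : DifferentiableOn ℂ F (ball x r)) :
    ∃ L : ℂ → ℂ, L x = 0 ∧ ∀ y ∈ ball x r, HasDerivAt L (F y) y := by
  exact (hF.isExactOn_ball).with_val_at x 0

theorem norm_sub_le_of_hasDerivAt_ball {Q q : ℂ → ℂ} {x : ℂ} {r K : ℝ}
    (hQ : ∀ y ∈ ball x r, HasDerivAt Q (q y) y) (hK : ∀ y ∈ ball x r, ‖q y‖ ≤ K) {z z' : ℂ}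
    (hz : z ∈ ball x r) (hz' : z' ∈ ball x r) : ‖Q z - Q z'‖ ≤ K * ‖z - z'‖ :=
  (convex_ball x r).norm_image_sub_le_of_norm_hasDerivWithin_le
    (fun y hy => (hQ y hy).hasDerivWithinAt) hK hz' hz

theorem norm_eval_mul_le_of_logarithm {h L E : ℂ → ℂ} {x c : ℂ} {r R A d C : ℝ}
    (hh : Differentiable ℂ h) (hE : Differentiable ℂ E) (hd : 0 < d)
    (hL : ∀ y ∈ ball x r, HasDerivAt L (deriv h y / (h y - c)) y)
    (hR : ∀ y ∈ ball x r, ‖h y‖ < R) (hA : ∀ y ∈ ball x r, ‖deriv h y‖ ≤ A)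
    (hdc : ∀ y ∈ ball x r, d ≤ ‖h y - c‖) (hC : ∀ y ∈ ball x r, ‖E (h y)‖ ≤ C)
    {z z' : ℂ} (hz : z ∈ ball x r) (hz' : z' ∈ ball x r) (hzz : h z = h z') :
    ‖E c‖ * ‖L z - L z'‖ ≤ C * A / d * ‖z - z'‖ := by
  have hds : DifferentiableOn ℂ (dslope E c) (ball 0 R) := by
    have : DifferentiableOn ℂ (dslope E c) univ := by
      rw [Complex.differentiableOn_dslope univ_mem]
      exact hE.differentiableOn
    exact this.mono (subset_univ _)
  obtain ⟨P, -, hP⟩ := exists_primitive_ball hds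
  have hQ : ∀ y ∈ ball x r, HasDerivAt (fun y => P (h y) + E c * L y)
      (E (h y) * deriv h y / (h y - c)) y := by
    intro y hy
    have hne : h y - c ≠ 0 := by
      intro h0
      have := hdc y hy
      rw [h0, norm_zero] at this
      linarith
    have h1 := (HasDerivAt.comp y (hP (h y) (mem_ball_zero_iff.2 (hR y hy)))
      (hh y).hasDerivAt).add ((hL y hy).const_mul (E c))
    refine h1.congr_deriv ?_
    rw [dslope_of_ne _ (sub_ne_zero.1 hne), slope_def_field]
    field_simp
    ring
  have h2 := norm_sub_le_of_hasDerivAt_ball hQ (K := C * A / d) (fun y hy => by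
    rw [norm_div, norm_mul]
    have := hC y hy
    have := hA y hy
    have := hdc y hy
    have := (norm_nonneg _).trans (hC y hy)
    have := (norm_nonneg _).trans (hA y hy)
    have : 0 ≤ C * A := by positivity
    gcongr) hz hz'
  rw [← norm_mul]
  refine le_of_eq_of_le ?_ h2
  congr 1
  simp only [hzz]
  ring

theorem norm_logarithm_sub_le {h L L' : ℂ → ℂ} {x c c' : ℂ} {r A d : ℝ} (hd : 0 < d)
    (hL : ∀ y ∈ ball x r, HasDerivAt L (deriv h y / (h y - c)) y)
    (hL' : ∀ y ∈ ball x r, HasDerivAt L' (deriv h y / (h y - c')) y)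
    (hA : ∀ y ∈ ball x r, ‖deriv h y‖ ≤ A)
    (hdc : ∀ y ∈ ball x r, d ≤ ‖h y - c‖) (hdc' : ∀ y ∈ ball x r, d ≤ ‖h y - c'‖)
    {z z' : ℂ} (hz : z ∈ ball x r) (hz' : z' ∈ ball x r) :
    ‖(L z - L z') - (L' z - L' z')‖ ≤ A * ‖c - c'‖ / (d * d) * ‖z - z'‖ := by
  have hQ : ∀ y ∈ ball x r, HasDerivAt (fun y => L y - L' y)
      (deriv h y * (c - c') / ((h y - c) * (h y - c'))) y := by
    intro y hy
    have hne : h y - c ≠ 0 := norm_pos_iff.1 (hd.trans_le (hdc y hy))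
    have hne' : h y - c' ≠ 0 := norm_pos_iff.1 (hd.trans_le (hdc' y hy))
    refine ((hL y hy).sub (hL' y hy)).congr_deriv ?_
    field_simp
    ring
  have h2 := norm_sub_le_of_hasDerivAt_ball hQ (K := A * ‖c - c'‖ / (d * d)) (fun y hy => by
    rw [norm_div, norm_mul, norm_mul]
    have := hA y hy
    have := hdc y hy
    have := hdc' y hy
    have := (norm_nonneg _).trans (hA y hy)
    gcongr) hz hz'
  refine le_of_eq_of_le ?_ h2
  congr 1
  ring

theorem logarithm_ne_conj {h L : ℂ → ℂ} {x₀ c u v r : ℝ} (hh : Differentiable ℂ h)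
    (hconj : ∀ y, h ((starRingEnd ℂ) y) = (starRingEnd ℂ) (h y))
    (hL : ∀ y ∈ ball (x₀ : ℂ) r, HasDerivAt L (deriv h y / (h y - c)) y) (hL0 : L x₀ = 0)
    (hne : ∀ y ∈ ball (x₀ : ℂ) r, h y - c ≠ 0)
    {z : ℂ} (hz : z ∈ ball (x₀ : ℂ) r) (hzu : h z = u) (hxv : h x₀ = v) (huc : u < c)
    (hcv : c < v) : L z ≠ L ((starRingEnd ℂ) z) := by
  have hr : 0 < r := nonempty_ball.1 ⟨z, hz⟩
  have hx : (x₀ : ℂ) ∈ ball (x₀ : ℂ) r := mem_ball_self hr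
  have hexp : ∀ y ∈ ball (x₀ : ℂ) r, (h y - c) * Complex.exp (-L y) = v - c := by
    intro y hy
    have hQ : ∀ y ∈ ball (x₀ : ℂ) r, HasDerivAt (fun y => (h y - c) * Complex.exp (-L y)) 0 y := by
      intro y hy
      refine ((((hh y).hasDerivAt.sub_const (c : ℂ))).fun_mul (hL y hy).fun_neg.cexp).congr_deriv ?_
      have := hne y hy
      field_simp
      ring
    have h2 := norm_sub_le_of_hasDerivAt_ball hQ (K := 0) (fun y _ => by simp) hy hx
    rw [zero_mul] at h2
    have h3 := sub_eq_zero.1 (norm_le_zero_iff.1 h2)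
    rw [h3, hxv, hL0]
    simp
  have hcb : ∀ y ∈ ball (x₀ : ℂ) r, (starRingEnd ℂ) y ∈ ball (x₀ : ℂ) r := by
    intro y hy
    rw [mem_ball, ← Complex.dist_conj_conj, Complex.conj_conj, Complex.conj_ofReal]
    exact hy
  have hLc : L ((starRingEnd ℂ) z) = (starRingEnd ℂ) (L z) := by
    have hQ : ∀ y ∈ ball (x₀ : ℂ) r,
        HasDerivAt (fun y => (starRingEnd ℂ) (L ((starRingEnd ℂ) y)) - L y) 0 y := by
      intro y hy
      have h1 := (hL _ (hcb y hy)).conj_conj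
      rw [Complex.conj_conj] at h1
      refine (h1.sub (hL y hy)).congr_deriv ?_
      have h4 : deriv h ((starRingEnd ℂ) y) = (starRingEnd ℂ) (deriv h y) := by
        have h5 := (hh y).hasDerivAt.conj_conj
        have h6 : (⇑(starRingEnd ℂ) ∘ h ∘ ⇑(starRingEnd ℂ)) = h := by
          funext w
          simp [hconj]
        rw [h6] at h5
        exact h5.deriv
      rw [h4, hconj]
      simp
    have h2 := norm_sub_le_of_hasDerivAt_ball hQ (K := 0) (fun y _ => by simp) hz hx
    rw [zero_mul] at h2
    have h3 := sub_eq_zero.1 (norm_le_zero_iff.1 h2)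
    simp only [Complex.conj_ofReal, hL0, map_zero, sub_zero] at h3
    rw [← sub_eq_zero.1 h3, Complex.conj_conj]
  intro heq
  rw [hLc] at heq
  obtain ⟨t, ht⟩ := Complex.conj_eq_iff_real.1 heq.symm
  have h1 := hexp z hz
  rw [hzu, ht] at h1
  have h2 : (u - c) * Real.exp (-t) = v - c := by exact_mod_cast h1
  nlinarith [Real.exp_pos (-t)]

theorem mem_fatouSet_of_enclosure {f h : ℂ → ℂ} {x₀ c u v ρ C : ℝ} (hf : Differentiable ℂ f)
    (hh : Differentiable ℂ h)
    (hconj : ∀ y, h ((starRingEnd ℂ) y) = (starRingEnd ℂ) (h y))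
    (hFat : ∀ y ∈ ball (x₀ : ℂ) ρ, h y ∈ FatouSet f)
    (hC : ∀ y ∈ ball (x₀ : ℂ) ρ, ∀ k : ℕ, ‖f^[k] (h y)‖ ≤ C)
    {z : ℂ} (hz : z ∈ ball (x₀ : ℂ) ρ) (hzu : h z = u) (hxv : h x₀ = v) (huc : u < c)
    (hcv : c < v) : (c : ℂ) ∈ FatouSet f := by
  by_cases hc : ∃ y ∈ ball (x₀ : ℂ) ρ, h y = c
  · obtain ⟨y, hy, hyc⟩ := hc
    rw [← hyc]
    exact hFat y hy
  push Not at hc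
  obtain ⟨r, hzr, hrρ⟩ := exists_between (mem_ball.1 hz)
  have hsub : closedBall (x₀ : ℂ) r ⊆ ball (x₀ : ℂ) ρ := closedBall_subset_ball hrρ
  have hr0 : 0 < r := dist_nonneg.trans_lt hzr
  have hcomp : IsCompact (closedBall (x₀ : ℂ) r) := isCompact_closedBall _ _
  have hne : (closedBall (x₀ : ℂ) r).Nonempty := ⟨x₀, mem_closedBall_self hr0.le⟩
  obtain ⟨y0, hy0, hmin⟩ := hcomp.exists_isMinOn hne
    (f := fun y => ‖h y - c‖) (hh.continuous.sub continuous_const).norm.continuousOn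
  obtain ⟨A, hA⟩ := hcomp.exists_bound_of_continuousOn
    (hh.contDiff (n := 1)).continuous_deriv_one.continuousOn
  set d := ‖h y0 - c‖ / 2 with hd
  have hd0 : 0 < d := by
    have : 0 < ‖h y0 - c‖ := norm_pos_iff.2 (sub_ne_zero.2 (hc y0 (hsub hy0)))
    positivity
  have hb : ball (x₀ : ℂ) r ⊆ closedBall (x₀ : ℂ) r := ball_subset_closedBall
  have hdd : ∀ y ∈ ball (x₀ : ℂ) r, d + d ≤ ‖h y - c‖ := by
    intro y hy
    have : ‖h y0 - c‖ ≤ ‖h y - c‖ := hmin (hb hy)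
    linarith
  have hdc' : ∀ c' : ℂ, ‖(c : ℂ) - c'‖ < d → ∀ y ∈ ball (x₀ : ℂ) r, d ≤ ‖h y - c'‖ := by
    intro c' hc' y hy
    have h1 : ‖h y - c‖ ≤ ‖h y - c'‖ + ‖(c : ℂ) - c'‖ := by
      rw [← norm_sub_rev c' (c : ℂ)]
      exact norm_sub_le_norm_sub_add_norm_sub _ _ _
    linarith [hdd y hy]
  have hlog : ∀ c' : ℂ, ‖(c : ℂ) - c'‖ < d → ∃ L : ℂ → ℂ, L x₀ = 0 ∧
      ∀ y ∈ ball (x₀ : ℂ) r, HasDerivAt L (deriv h y / (h y - c')) y := by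
    intro c' hc'
    refine exists_primitive_ball (DifferentiableOn.div ?_ (hh.sub_const _).differentiableOn ?_)
    · exact (hh.differentiableOn.deriv isOpen_univ).mono (subset_univ _)
    · intro y hy
      exact norm_pos_iff.1 (hd0.trans_le (hdc' c' hc' y hy))
  have hcc : ‖(c : ℂ) - c‖ < d := by simpa using hd0
  obtain ⟨L, hL0, hL⟩ := hlog c hcc
  set z' := (starRingEnd ℂ) z with hz'
  have hzb : z ∈ ball (x₀ : ℂ) r := hzr
  have hzb' : z' ∈ ball (x₀ : ℂ) r := by
    rw [mem_ball, hz', ← Complex.dist_conj_conj, Complex.conj_conj, Complex.conj_ofReal]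
    exact hzb
  have hzz : h z = h z' := by rw [hz', hconj, hzu, Complex.conj_ofReal]
  have hLne : L z ≠ L z' := logarithm_ne_conj hh hconj hL hL0
    (fun y hy => sub_ne_zero.2 (hc y (hsub (hb hy)))) hzb hzu hxv huc hcv
  have hA' : ∀ y ∈ ball (x₀ : ℂ) r, ‖deriv h y‖ ≤ A := fun y hy => hA y (hb hy)
  have hA0 : 0 ≤ A := (norm_nonneg _).trans (hA' z hzb)
  set η := ‖L z - L z'‖ with hη
  have hη0 : 0 < η := norm_pos_iff.2 (sub_ne_zero.2 hLne)
  have hC' : ∀ y ∈ ball (x₀ : ℂ) r, ∀ k : ℕ, ‖f^[k] (h y)‖ ≤ C := fun y hy => hC y (hsub (hb hy))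
  have hR : ∀ y ∈ ball (x₀ : ℂ) r, ‖h y‖ < C + 1 := by
    intro y hy
    have : ‖h y‖ ≤ C := hC' y hy 0
    linarith
  set B := A / (d * d) * ‖z - z'‖ with hB
  have hB0 : 0 ≤ B := by positivity
  set δ := min d (η / (2 * (B + 1))) with hδ
  have hδ0 : 0 < δ := by positivity
  refine subset_fatouSet_of_bounded (M := C * A / d * ‖z - z'‖ / (η / 2)) hf
    (isOpen_ball (x := (c : ℂ)) (ε := δ)) ?_ (mem_ball_self hδ0)
  intro c' hc' k
  have hcd : ‖(c : ℂ) - c'‖ < δ := by rwa [← dist_eq_norm, dist_comm]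
  have hcd' := hcd.trans_le (min_le_left _ _)
  obtain ⟨L', -, hL'⟩ := hlog c' hcd'
  have h1 := norm_eval_mul_le_of_logarithm hh (hf.iterate k) hd0 hL' hR hA' (hdc' c' hcd')
    (fun y hy => hC' y hy k) hzb hzb' hzz
  have h2 := norm_logarithm_sub_le hd0 hL hL' hA' (hdc' c hcc) (hdc' c' hcd') hzb hzb'
  have h3 : A * ‖(c : ℂ) - c'‖ / (d * d) * ‖z - z'‖ = B * ‖(c : ℂ) - c'‖ := by
    rw [hB]; ring
  have h4 : B * ‖(c : ℂ) - c'‖ ≤ η / 2 := by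
    have h5 := (hcd.trans_le (min_le_right _ _)).le
    rw [le_div_iff₀ (by positivity)] at h5
    nlinarith [norm_nonneg ((c : ℂ) - c')]
  have h6 : η / 2 ≤ ‖L' z - L' z'‖ := by
    have := norm_sub_norm_le (L z - L z') (L' z - L' z')
    linarith
  rw [le_div_iff₀ (by positivity)]
  exact (mul_le_mul_of_nonneg_left h6 (norm_nonneg _)).trans h1

end enclosure

section realEscaping
variable {l a : ℝ}

theorem two_mul_realMap_le_norm_deriv (hl : 0 < l) {x : ℝ} (h5 : 5 ≤ x) (ha : 2 * a ≤ realMap l a x) :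
    2 * realMap l a x ≤ ‖deriv (sinhMap l a) x‖ * x := by
  have hx0 : x ≠ 0 := by linarith
  have hx0' : (x : ℂ) ≠ 0 := by exact_mod_cast hx0
  have hxp : 0 < x := by linarith
  set S := l * Real.sinh x / x with hS
  have hS0 : 0 < S := by have := Real.sinh_pos_iff.2 hxp; positivity
  have hlS : l * Real.sinh x = S * x := by rw [hS]; field_simp
  have hc : l * Real.sinh x ≤ l * Real.cosh x := by
    have := (Real.sinh_lt_cosh x).le
    gcongr
  have hg : realMap l a x = S + a := realMap_of_ne hx0
  have hD : deriv (sinhMap l a) x = ((l * (x * Real.cosh x - Real.sinh x) / x ^ 2 : ℝ) : ℂ) := by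
    rw [deriv_sinhMap hx0']
    push_cast
    rfl
  rw [hD, Complex.norm_real, Real.norm_eq_abs]
  have h1 : l * (x * Real.cosh x - Real.sinh x) / x ^ 2 * x = l * Real.cosh x - S := by
    rw [hS]; field_simp
  have h2 : 2 * realMap l a x ≤ l * (x * Real.cosh x - Real.sinh x) / x ^ 2 * x := by
    rw [h1]
    rw [hg] at ha ⊢
    nlinarith
  exact h2.trans (by gcongr; exact le_abs_self _)

theorem pow_mul_iterate_le_norm_deriv (hl : 0 < l) {p T : ℝ} (hT : 5 ≤ T) (ha : 2 * |a| ≤ T)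
    (hp : ∀ n, T ≤ (realMap l a)^[n] p) (n : ℕ) :
    2 ^ n * (realMap l a)^[n] p ≤ ‖deriv (sinhMap l a)^[n] p‖ * p := by
  induction n with
  | zero => simp
  | succ n ih =>
    rw [deriv_iterate_succ differentiable_sinhMap, norm_mul, iterate_sinhMap_ofReal]
    have h1 := two_mul_realMap_le_norm_deriv (a := a) hl (hT.trans (hp n)) (by
      have := hp (n + 1)
      rw [Function.iterate_succ_apply'] at this
      linarith [le_abs_self a])
    rw [Function.iterate_succ_apply']
    set x := (realMap l a)^[n] p with hx
    have hxp : 0 < x := by linarith [hp n]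
    have h2 := mul_le_mul h1 ih (by positivity) (by positivity)
    have h3 : x * (2 ^ (n + 1) * realMap l a x) ≤
        x * (‖deriv (sinhMap l a) x‖ * ‖deriv (sinhMap l a)^[n] p‖ * p) := by
      rw [pow_succ]; linarith
    exact le_of_mul_le_mul_left h3 hxp

theorem not_mem_fatouSet_of_large (hl : 0 < l) {p T : ℝ} (hT : 5 ≤ T) (ha : 2 * |a| ≤ T)
    (hT' : 2 * (l + |a|) + 1 ≤ T) (hp : ∀ n, T ≤ (realMap l a)^[n] p) :
    (p : ℂ) ∉ FatouSet (sinhMap l a) := by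
  intro hF
  have hM : 0 ≤ l + |a| := by positivity
  obtain ⟨δ, hδ, hd⟩ := equicontinuous_at_of_mem_fatouSet hF (ε := 1 / (1 + (l + |a|)))
    (by positivity)
  have hbig : ∀ y ∈ ball (p : ℂ) δ, ∀ n, l + |a| < ‖(sinhMap l a)^[n] y‖ := by
    intro y hy n
    refine lt_norm_of_sphericalDist_lt hM ?_ (hd y hy n)
    rw [iterate_sinhMap_ofReal, Complex.norm_real, Real.norm_eq_abs]
    exact hT'.trans ((hp n).trans (le_abs_self _))
  have hre : ∀ n, ∀ y ∈ ball (p : ℂ) δ, 0 < ((sinhMap l a)^[n] y).re := by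
    intro n
    refine IsPreconnected.pos_of_ne_zero (convex_ball _ _).isPreconnected
      (p := fun y => ((sinhMap l a)^[n] y).re)
      (Complex.continuous_re.comp (differentiable_iterate differentiable_sinhMap n).continuous).continuousOn
      ?_ (mem_ball_self hδ) ?_
    · intro y hy h0
      have h1 := hbig y hy (n + 1)
      rw [Function.iterate_succ_apply'] at h1
      have h2 : (sinhMap l a)^[n] y = (((sinhMap l a)^[n] y).im : ℂ) * Complex.I := by
        apply Complex.ext <;> simp
        exact h0
      rw [h2] at h1
      exact absurd (norm_sinhMap_mul_I_le hl _) (not_le.2 h1)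
    · rw [iterate_sinhMap_ofReal, Complex.ofReal_re]
      linarith [hp n]
  have hp0 : 0 < p := by linarith [show T ≤ p from hp 0]
  have key : ∀ n : ℕ, (2 : ℝ) ^ n ≤ 2 * p / δ := by
    intro n
    have h1 := schwarz_ball_halfPlane_deriv hδ
      (differentiable_iterate differentiable_sinhMap n).differentiableOn (hre n)
    have h2 := pow_mul_iterate_le_norm_deriv hl hT ha hp n
    rw [iterate_sinhMap_ofReal, Complex.ofReal_re] at h1
    have hx : 0 < (realMap l a)^[n] p := by linarith [hp n]
    rw [le_div_iff₀ hδ]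
    refine le_of_mul_le_mul_right ?_ hx
    calc 2 ^ n * δ * (realMap l a)^[n] p = 2 ^ n * (realMap l a)^[n] p * δ := by ring
      _ ≤ ‖deriv (sinhMap l a)^[n] p‖ * p * δ := by gcongr
      _ = ‖deriv (sinhMap l a)^[n] p‖ * δ * p := by ring
      _ ≤ 2 * (realMap l a)^[n] p * p := by gcongr
      _ = 2 * p * (realMap l a)^[n] p := by ring
  obtain ⟨n, hn⟩ := pow_unbounded_of_one_lt (2 * p / δ) (one_lt_two (α := ℝ))
  linarith [key n]

/-- Real points of the Fatou set have bounded orbits. -/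
theorem exists_bound_of_real_mem_fatouSet (hl : 0 < l) (a : ℝ) : ∃ X > 0, ∀ x : ℝ,
    (x : ℂ) ∈ FatouSet (sinhMap l a) → ∀ n, |(realMap l a)^[n] x| < X := by
  obtain ⟨X, hX, hg⟩ := exists_realMap_growth hl a
  refine ⟨X, hX, fun x hF n => ?_⟩
  by_contra hcon
  rw [not_lt] at hcon
  have h1 : ∀ k : ℕ, X + (k + 1) ≤ (realMap l a)^[n + 1 + k] x := by
    intro k
    induction k with
    | zero =>
      have := hg _ hcon
      rw [add_zero, Function.iterate_succ_apply']
      push_cast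
      linarith
    | succ k ih =>
      rw [← add_assoc (n + 1) k 1, Function.iterate_succ_apply']
      have h2 := le_abs_self ((realMap l a)^[n + 1 + k] x)
      have h3 : (0 : ℝ) ≤ k := Nat.cast_nonneg k
      have := hg ((realMap l a)^[n + 1 + k] x) (by linarith)
      push_cast
      linarith
  set T := max 5 (max (2 * |a|) (2 * (l + |a|) + 1)) with hT
  obtain ⟨k, hk⟩ := exists_nat_ge T
  refine not_mem_fatouSet_of_large hl (p := (realMap l a)^[n + 1 + k] x) (T := T) (le_max_left _ _)
    ((le_max_left _ _).trans (le_max_right _ _)) ((le_max_right _ _).trans (le_max_right _ _)) ?_ ?_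
  · intro j
    rw [← Function.iterate_add_apply, show j + (n + 1 + k) = n + 1 + (k + j) by ring]
    have := h1 (k + j)
    push_cast at this
    have h3 : (0 : ℝ) ≤ j := Nat.cast_nonneg j
    linarith
  · rw [← iterate_sinhMap_ofReal]
    exact iterate_mem_fatouSet (isOpenMap_sinhMap hl) _ hF

end realEscaping

section existsTame
variable {l a : ℝ}

theorem isOpen_image_iterate (hl : 0 < l) {W : Set ℂ} (hW : IsWanderingDomain (sinhMap l a) W)
    (n : ℕ) : IsOpen ((sinhMap l a)^[n] '' W) := by
  induction n with
  | zero => simpa using hW.isOpen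
  | succ n ih =>
    rw [Function.iterate_succ', image_comp]
    exact isOpenMap_sinhMap hl _ ih

theorem image_iterate_subset_fatouSet (hl : 0 < l) {W : Set ℂ}
    (hW : IsWanderingDomain (sinhMap l a) W) (n : ℕ) :
    (sinhMap l a)^[n] '' W ⊆ FatouSet (sinhMap l a) := by
  rintro _ ⟨w, hw, rfl⟩
  exact iterate_mem_fatouSet (isOpenMap_sinhMap hl) n (hW.subset_fatouSet hw)

theorem eq_of_real_segment_subset (hl : 0 < l) {W : Set ℂ}
    (hW : IsWanderingDomain (sinhMap l a) W) {p q : ℝ} {m n : ℕ}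
    (hp : (p : ℂ) ∈ (sinhMap l a)^[m] '' W) (hq : (q : ℂ) ∈ (sinhMap l a)^[n] '' W)
    (hpq : ∀ c ∈ uIcc p q, (c : ℂ) ∈ FatouSet (sinhMap l a)) : m = n := by
  by_contra hmn
  have hK : IsCompact ((fun c : ℝ => (c : ℂ)) '' uIcc p q) :=
    isCompact_uIcc.image Complex.continuous_ofReal
  obtain ⟨δ, hδ, hδF⟩ := hK.exists_thickening_subset_open (isOpen_fatouSet _)
    (by rintro _ ⟨c, hc, rfl⟩; exact hpq c hc)
  obtain ⟨δ₁, hδ₁, h₁⟩ := Metric.isOpen_iff.1 (isOpen_image_iterate hl hW m) _ hp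
  obtain ⟨δ₂, hδ₂, h₂⟩ := Metric.isOpen_iff.1 (isOpen_image_iterate hl hW n) _ hq
  obtain ⟨t, ht0, ht⟩ := exists_between (show 0 < min δ (min δ₁ δ₂) by positivity)
  have hdist : ∀ c : ℝ, dist ((c : ℂ) + t * Complex.I) c = t := by
    intro c
    rw [dist_eq_norm, add_sub_cancel_left, norm_mul, Complex.norm_I, mul_one, Complex.norm_real,
      Real.norm_eq_abs, abs_of_pos ht0]
  have hC : IsPreconnected ((fun c : ℝ => (c : ℂ) + t * Complex.I) '' uIcc p q) :=
    isPreconnected_uIcc.image _ (by fun_prop)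
  have hsub := subset_image_iterate hl hW (n := m) hC (by
      rintro _ ⟨c, hc, rfl⟩
      refine hδF (mem_thickening_iff.2 ⟨c, ⟨c, hc, rfl⟩, ?_⟩)
      rw [hdist]
      exact ht.trans_le (min_le_left _ _)) (by
      rintro _ ⟨c, hc, rfl⟩
      simpa using ht0.ne') ⟨p, left_mem_uIcc, rfl⟩ (h₁ (by
        rw [mem_ball, hdist]
        exact ht.trans_le ((min_le_right _ _).trans (min_le_left _ _))))
  exact hW.not_mem_of_mem hmn (hsub ⟨q, right_mem_uIcc, rfl⟩) (h₂ (by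
        rw [mem_ball, hdist]
        exact ht.trans_le ((min_le_right _ _).trans (min_le_right _ _))))

theorem iterate_sinhMap_conj (n : ℕ) (z : ℂ) : (sinhMap l a)^[n] ((starRingEnd ℂ) z) =
    (starRingEnd ℂ) ((sinhMap l a)^[n] z) := by
  induction n generalizing z with
  | zero => rfl
  | succ n ih => rw [Function.iterate_succ_apply, Function.iterate_succ_apply, sinhMap_conj, ih]

theorem real_mem_fatouSet_of_hit (hl : 0 < l) {x ρ C : ℝ}
    (hF : ball (x : ℂ) ρ ⊆ FatouSet (sinhMap l a))
    (hC : ∀ y ∈ ball (x : ℂ) ρ, ∀ n, ‖(sinhMap l a)^[n] y‖ ≤ C) {n : ℕ} {z : ℂ}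
    (hz : z ∈ ball (x : ℂ) ρ) (hre : ((sinhMap l a)^[n] z).re = 0)
    (him : ((sinhMap l a)^[n] z).im ≠ 0) {c : ℝ} (hc : l + a ≤ c)
    (hc' : c ≤ (realMap l a)^[n + 1] x) : (c : ℂ) ∈ FatouSet (sinhMap l a) := by
  have hx : (x : ℂ) ∈ ball (x : ℂ) ρ := mem_ball_self (nonempty_ball.1 ⟨z, hz⟩)
  rcases hc'.eq_or_lt with rfl | hlt
  · rw [← iterate_sinhMap_ofReal]
    exact iterate_mem_fatouSet (isOpenMap_sinhMap hl) _ (hF hx)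
  · set s := ((sinhMap l a)^[n] z).im with hs
    have h2 : (sinhMap l a)^[n] z = (s : ℂ) * Complex.I := by
      apply Complex.ext <;> simp [hre, hs]
    refine mem_fatouSet_of_enclosure (h := (sinhMap l a)^[n + 1]) (x₀ := x) (ρ := ρ) (C := C)
      (u := (sinhMap l a (s * Complex.I)).re) (v := (realMap l a)^[n + 1] x) (z := z)
      differentiable_sinhMap
      (differentiable_iterate differentiable_sinhMap _) (iterate_sinhMap_conj _) ?_ ?_ hz ?_
      (iterate_sinhMap_ofReal _ _) ((sinhMap_mul_I_re_lt hl him).trans_le hc) hlt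
    · intro y hy
      exact iterate_mem_fatouSet (isOpenMap_sinhMap hl) _ (hF hy)
    · intro y hy k
      rw [← Function.iterate_add_apply]
      exact hC y hy _
    · rw [Function.iterate_succ_apply', h2]
      apply Complex.ext
      · simp
      · rw [sinhMap_mul_I_im, Complex.ofReal_im]

theorem re_eq_zero_of_sinhMap_im (hl : 0 < l) {z : ℂ} (hz : z.im ≠ 0) (hz' : |z.im| < 1)
    (h : (sinhMap l a z).im = 0) : z.re = 0 := by
  have key : ∀ w : ℂ, 0 < w.re → w.im ≠ 0 → |w.im| < 1 → (sinhMap l a w).im ≠ 0 := by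
    intro w hw hwi hw1
    have := abs_lt.1 hw1
    rcases lt_or_gt_of_ne hwi with h | h
    · exact (sinhMap_im_neg hl hw h (by linarith [Real.pi_gt_three])).ne
    · exact (sinhMap_im_pos hl hw h (by linarith [Real.pi_gt_three])).ne'
  by_contra hre
  rcases lt_or_gt_of_ne hre with h' | h'
  · refine key (-z) (by simpa using h') (by simpa using hz) (by simpa using hz') ?_
    rw [sinhMap_neg]
    exact h
  · exact key z h' hz hz' h

theorem exists_isTame (hl : 0 < l) {W : Set ℂ} (hW : IsWanderingDomain (sinhMap l a) W) :
    ∃ w, IsTame (sinhMap l a) W w := by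
  by_cases hreal : ∃ (N : ℕ) (x : ℝ), (x : ℂ) ∈ (sinhMap l a)^[N] '' W
  swap
  · push Not at hreal
    obtain ⟨z, hz⟩ := hW.nonempty
    obtain ⟨ρ, hρ, hsub⟩ := Metric.isOpen_iff.1 hW.isOpen z hz
    refine ⟨z, ρ, hρ, 0, by simpa using hsub, fun y hy n h0 => ?_⟩
    refine hreal n ((sinhMap l a)^[n] y).re ⟨y, hsub hy, ?_⟩
    apply Complex.ext <;> simp [h0]
  obtain ⟨N, x, hx⟩ := hreal
  obtain ⟨X, hX, hbdd⟩ := exists_bound_of_real_mem_fatouSet hl a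
  have hxF := image_iterate_subset_fatouSet hl hW N hx
  obtain ⟨ρ₁, hρ₁, h₁⟩ := Metric.isOpen_iff.1 (isOpen_image_iterate hl hW N) _ hx
  obtain ⟨ρ₂, hρ₂, h₂⟩ := equicontinuous_at_of_mem_fatouSet hxF
    (ε := 2 / ((2 + X) * (1 + X))) (by positivity)
  set ρ := min ρ₁ ρ₂ with hρ
  have hρ0 : 0 < ρ := by positivity
  have hsub : ball (x : ℂ) ρ ⊆ (sinhMap l a)^[N] '' W :=
    (ball_subset_ball (min_le_left _ _)).trans h₁
  have hxX : ∀ n, ‖(sinhMap l a)^[n] x‖ ≤ X := by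
    intro n
    rw [iterate_sinhMap_ofReal, Complex.norm_real, Real.norm_eq_abs]
    exact (hbdd x hxF n).le
  have hdist : ∀ y ∈ ball (x : ℂ) ρ, ∀ n, dist ((sinhMap l a)^[n] y) ((sinhMap l a)^[n] x) < 1 :=
    fun y hy n => dist_lt_one_of_sphericalDist_lt (hxX n)
      (h₂ y ((mem_ball.1 hy).trans_le (min_le_right _ _)) n)
  have him : ∀ y ∈ ball (x : ℂ) ρ, ∀ n, |((sinhMap l a)^[n] y).im| < 1 := by
    intro y hy n
    have h := hdist y hy n
    rw [dist_eq_norm] at h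
    have h' := (Complex.abs_im_le_norm _).trans_lt h
    rwa [iterate_sinhMap_ofReal, Complex.sub_im, Complex.ofReal_im, sub_zero] at h'
  have hnorm : ∀ y ∈ ball (x : ℂ) ρ, ∀ n, ‖(sinhMap l a)^[n] y‖ ≤ X + 1 := by
    intro y hy n
    have h := hdist y hy n
    rw [dist_eq_norm] at h
    have := norm_le_norm_add_norm_sub' ((sinhMap l a)^[n] y) ((sinhMap l a)^[n] x)
    linarith [hxX n]
  have hF : ball (x : ℂ) ρ ⊆ FatouSet (sinhMap l a) :=
    hsub.trans (image_iterate_subset_fatouSet hl hW N)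
  have hmem : ∀ n, (((realMap l a)^[n] x : ℝ) : ℂ) ∈ (sinhMap l a)^[n + N] '' W := by
    intro n
    obtain ⟨w, hw, hwx⟩ := hx
    refine ⟨w, hw, ?_⟩
    rw [Function.iterate_add_apply, hwx, iterate_sinhMap_ofReal]
  have hge : ∀ n, l + a ≤ (realMap l a)^[n + 1] x := by
    intro n
    rw [Function.iterate_succ_apply']
    exact realMap_ge hl _
  have huniq : ∀ n₁ n₂ : ℕ, (∃ z ∈ ball (x : ℂ) ρ, ((sinhMap l a)^[n₁] z).re = 0 ∧
      ((sinhMap l a)^[n₁] z).im ≠ 0) → (∃ z ∈ ball (x : ℂ) ρ, ((sinhMap l a)^[n₂] z).re = 0 ∧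
      ((sinhMap l a)^[n₂] z).im ≠ 0) → n₁ = n₂ := by
    rintro n₁ n₂ ⟨z₁, hz₁, hre₁, him₁⟩ ⟨z₂, hz₂, hre₂, him₂⟩
    have := eq_of_real_segment_subset hl hW (hmem (n₁ + 1)) (hmem (n₂ + 1)) (fun c hc => by
      have hc1 : l + a ≤ c := (le_min (hge n₁) (hge n₂)).trans hc.1
      rcases le_max_iff.1 hc.2 with h | h
      · exact real_mem_fatouSet_of_hit hl hF hnorm hz₁ hre₁ him₁ hc1 h
      · exact real_mem_fatouSet_of_hit hl hF hnorm hz₂ hre₂ him₂ hc1 h)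
    omega
  obtain ⟨n₀, hn₀⟩ : ∃ n₀, ∀ n ≥ n₀, ∀ z ∈ ball (x : ℂ) ρ, ((sinhMap l a)^[n] z).im ≠ 0 →
      ((sinhMap l a)^[n] z).re ≠ 0 := by
    by_cases hhit : ∃ n, ∃ z ∈ ball (x : ℂ) ρ, ((sinhMap l a)^[n] z).re = 0 ∧
      ((sinhMap l a)^[n] z).im ≠ 0
    · obtain ⟨n₁, h₁⟩ := hhit
      refine ⟨n₁ + 1, fun n hn z hz him hre => ?_⟩
      have := huniq n n₁ ⟨z, hz, hre, him⟩ h₁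
      omega
    · exact ⟨0, fun n _ z hz him hre => hhit ⟨n, z, hz, hre, him⟩⟩
  have hopen : ∀ n, IsOpenMap (sinhMap l a)^[n] := by
    intro n
    induction n with
    | zero => exact IsOpenMap.id
    | succ n ih => rw [Function.iterate_succ']; exact (isOpenMap_sinhMap hl).comp ih
  have hO : IsOpen ((sinhMap l a)^[n₀] '' ball (x : ℂ) ρ) := hopen n₀ _ isOpen_ball
  obtain ⟨δ, hδ, hδs⟩ := Metric.isOpen_iff.1 hO _ ⟨x, mem_ball_self hρ0, rfl⟩
  set w := (sinhMap l a)^[n₀] x + ((δ / 2 : ℝ) : ℂ) * Complex.I with hw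
  have hwim : w.im = δ / 2 := by
    rw [hw, iterate_sinhMap_ofReal]
    simp
  have hball : ball w (δ / 2) ⊆ ball ((sinhMap l a)^[n₀] x) δ := by
    refine ball_subset_ball' ?_
    rw [hw, dist_eq_norm, add_sub_cancel_left, norm_mul, Complex.norm_I, mul_one, Complex.norm_real,
      Real.norm_eq_abs, abs_of_pos (by positivity)]
    linarith
  refine ⟨w, δ / 2, by positivity, n₀ + N, ?_, ?_⟩
  · intro y hy
    obtain ⟨v, hv, rfl⟩ := hδs (hball hy)
    obtain ⟨u, hu, rfl⟩ := hsub hv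
    exact ⟨u, hu, by rw [Function.iterate_add_apply]⟩
  · intro y hy n
    induction n with
    | zero =>
      rw [mem_ball, dist_eq_norm] at hy
      have := (Complex.abs_im_le_norm _).trans_lt hy
      rw [Complex.sub_im, hwim] at this
      rw [Function.iterate_zero, id]
      linarith [(abs_lt.1 this).1]
    | succ n ih =>
      intro h0
      obtain ⟨v, hv, rfl⟩ := hδs (hball hy)
      rw [Function.iterate_succ_apply'] at h0
      rw [← Function.iterate_add_apply] at h0 ih
      exact hn₀ (n + n₀) (by omega) v hv ih (re_eq_zero_of_sinhMap_im hl ih (him v hv _) h0)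

theorem not_isWanderingDomain_sinhMap (hl : 0 < l) (W : Set ℂ) :
    ¬IsWanderingDomain (sinhMap l a) W := fun hW =>
  let ⟨_, hw⟩ := exists_isTame hl hW
  no_tame hl hW hw

end existsTame

section negConjugation
variable {f g : ℂ → ℂ}

theorem sphericalDist_neg (z w : ℂ) : sphericalDist (-z) (-w) = sphericalDist z w := by
  rw [sphericalDist, sphericalDist, dist_neg_neg, norm_neg, norm_neg]

theorem iterate_neg_conjugate (h : ∀ z, g z = -f (-z)) (n : ℕ) (z : ℂ) :
    g^[n] z = -f^[n] (-z) := by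
  induction n generalizing z with
  | zero => simp
  | succ n ih => rw [Function.iterate_succ_apply, Function.iterate_succ_apply, ih, h, neg_neg]

theorem neg_mem_fatouSet (h : ∀ z, g z = -f (-z)) {z : ℂ} (hz : z ∈ FatouSet f) :
    -z ∈ FatouSet g := by
  obtain ⟨N, hN, hzN, hd⟩ := hz
  refine ⟨(fun w => -w) ⁻¹' N, hN.preimage continuous_neg, by simpa using hzN,
    fun x hx ε hε => ?_⟩
  obtain ⟨δ, hδ, hd'⟩ := hd (-x) hx ε hε
  refine ⟨δ, hδ, fun y hy hyx n => ?_⟩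
  rw [iterate_neg_conjugate h, iterate_neg_conjugate h, sphericalDist_neg]
  exact hd' (-y) hy (by rwa [dist_neg_neg]) n

theorem image_neg_fatouSet (h : ∀ z, g z = -f (-z)) :
    Homeomorph.neg ℂ '' FatouSet f = FatouSet g := by
  apply Subset.antisymm
  · rintro _ ⟨z, hz, rfl⟩
    exact neg_mem_fatouSet h hz
  · intro z hz
    refine ⟨-z, neg_mem_fatouSet (f := g) (g := f) (fun w => by rw [h]; simp) hz, ?_⟩
    simp

theorem IsWanderingDomain.image_neg (h : ∀ z, g z = -f (-z)) {W : Set ℂ}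
    (hW : IsWanderingDomain f W) : IsWanderingDomain g (Homeomorph.neg ℂ '' W) := by
  obtain ⟨⟨z, hz, hWz⟩, hdisj⟩ := hW
  refine ⟨⟨-z, neg_mem_fatouSet h hz, ?_⟩, fun m n hmn => ?_⟩
  · rw [hWz, (Homeomorph.neg ℂ).image_connectedComponentIn hz, image_neg_fatouSet h]
    rfl
  · rw [eq_empty_iff_forall_notMem]
    rintro _ ⟨⟨_, ⟨x, hx, rfl⟩, rfl⟩, ⟨_, ⟨y, hy, rfl⟩, hxy⟩⟩
    rw [iterate_neg_conjugate h, iterate_neg_conjugate h] at hxy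
    simp only [Homeomorph.coe_neg, neg_neg, neg_inj] at hxy
    have : f^[m] x ∈ f^[m] '' W ∩ f^[n] '' W := ⟨⟨x, hx, rfl⟩, ⟨y, hy, hxy⟩⟩
    rw [hdisj m n hmn] at this
    exact this

end negConjugation

/-- **Theorem (Statement 2).** For `λ, a ∈ ℝ` with `λ ≠ 0`, the entire function
`f(z) = λ sinh(z)/z + a` (with `f(0) = λ + a`) has no wandering domain. -/
theorem no_wandering_domains_sinh
    (lam a : ℝ) (hlam : lam ≠ 0)
    (f : ℂ → ℂ)
    (hf : ∀ z : ℂ, z ≠ 0 → f z = (lam : ℂ) * Complex.sinh z / z + (a : ℂ))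
    (hf0 : f 0 = (lam : ℂ) + (a : ℂ)) :
    ¬∃ W : Set ℂ, IsWanderingDomain f W := by
  have hfs : f = sinhMap lam a := by
    funext z
    rcases eq_or_ne z 0 with rfl | hz
    · rw [hf0, sinhMap_zero]
    · rw [hf z hz, sinhMap_of_ne hz]
  rintro ⟨W, hW⟩
  rw [hfs] at hW
  rcases lt_or_gt_of_ne hlam with h | h
  · refine not_isWanderingDomain_sinhMap (l := -lam) (a := -a) (neg_pos.2 h) _
      (hW.image_neg fun z => ?_)
    rw [sinhMap_neg]
    simp [sinhMap]
    ring
  · exact not_isWanderingDomain_sinhMap h W hW
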